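/- Every finite simple graph G with no K_8-minor and with minimum degree at least 9 has an edge that belongs to at most 5 triangles. -/

import Mathlib

open SimpleGraph

/-- `H` is a minor of `G`: there is a family of nonempty, pairwise disjoint,
connected branch sets in `G`, one for each vertex of `H`, with an edge of `G`
between the branch sets corresponding to each edge of `H`. -/
def SimpleGraph.MinorOf {W V : Type} (H : SimpleGraph W) (G : SimpleGraph V) : Prop :=
  ∃ f : W → Set V,
    (∀ w, (f w).Nonempty) ∧
    (∀ w, (G.induce (f w)).Connected) ∧
    (∀ w₁ w₂, w₁ ≠ w₂ → Disjoint (f w₁) (f w₂)) ∧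
    (∀ w₁ w₂, H.Adj w₁ w₂ → ∃ v₁ ∈ f w₁, ∃ v₂ ∈ f w₂, G.Adj v₁ v₂)

namespace CliqueMinor

noncomputable section

open Classical

variable {V W : Type} {G G' : SimpleGraph V}

/-! ### Connected sets and clique models -/

/-- The finite set `s` is nonempty and induces a connected subgraph. -/
def Conn (G : SimpleGraph V) (s : Finset V) : Prop :=
  s.Nonempty ∧ ∀ A ⊆ s, A.Nonempty → A ≠ s → ∃ a ∈ A, ∃ b ∈ s \ A, G.Adj a b

/-- Some edge joins `s` to `t`. -/
def Touch (G : SimpleGraph V) (s t : Finset V) : Prop := ∃ a ∈ s, ∃ b ∈ t, G.Adj a b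

theorem Touch.symm {s t : Finset V} (h : Touch G s t) : Touch G t s := by
  obtain ⟨a, ha, b, hb, hab⟩ := h
  exact ⟨b, hb, a, ha, hab.symm⟩

theorem Touch.mono {s t s' t' : Finset V} (h : Touch G s t) (hs : s ⊆ s') (ht : t ⊆ t') :
    Touch G s' t' := by
  obtain ⟨a, ha, b, hb, hab⟩ := h
  exact ⟨a, hs ha, b, ht hb, hab⟩

theorem Conn.mono {s : Finset V} (h : Conn G s) (hle : G ≤ G') : Conn G' s :=
  ⟨h.1, fun _ hA hne hs => by
    obtain ⟨a, ha, b, hb, hab⟩ := h.2 _ hA hne hs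
    exact ⟨a, ha, b, hb, hle hab⟩⟩

theorem conn_singleton (v : V) : Conn G {v} :=
  ⟨Finset.singleton_nonempty v, fun _ hA hne hs =>
    absurd ((Finset.subset_singleton_iff.1 hA).resolve_left hne.ne_empty) hs⟩

/-- A part of a connected set without edges to the rest is everything. -/
theorem Conn.eq_of_closed {s A : Finset V} (h : Conn G s) (hA : A ⊆ s) (hne : A.Nonempty)
    (hcl : ∀ a ∈ A, ∀ b ∈ s, G.Adj a b → b ∈ A) : A = s := by
  by_contra hs
  obtain ⟨a, ha, b, hb, hab⟩ := h.2 A hA hne hs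
  rw [Finset.mem_sdiff] at hb
  exact hb.2 (hcl a ha b hb.1 hab)

theorem conn_of_closed {s : Finset V} (hne : s.Nonempty)
    (h : ∀ A ⊆ s, A.Nonempty → (∀ a ∈ A, ∀ b ∈ s, G.Adj a b → b ∈ A) → A = s) : Conn G s := by
  refine ⟨hne, fun A hA hAne hs => ?_⟩
  by_contra! hcon
  refine hs (h A hA hAne fun a ha b hb hab => ?_)
  by_contra hbA
  exact hcon a ha b (Finset.mem_sdiff.2 ⟨hb, hbA⟩) hab

/-- A set is connected if each of its points lies with a fixed point `c` in a connected subset. -/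
theorem conn_of_center {s : Finset V} {c : V} (hc : c ∈ s)
    (h : ∀ x ∈ s, ∃ t ⊆ s, c ∈ t ∧ x ∈ t ∧ Conn G t) : Conn G s := by
  have sub : ∀ A ⊆ s, (∀ a ∈ A, ∀ b ∈ s, G.Adj a b → b ∈ A) → ∀ t ⊆ s, Conn G t →
      (A ∩ t).Nonempty → t ⊆ A := by
    intro A _ hcl t ht hconn hne
    have := hconn.eq_of_closed (A := A ∩ t) Finset.inter_subset_right hne fun a ha b hb hab => by
      rw [Finset.mem_inter] at ha ⊢
      exact ⟨hcl a ha.1 b (ht hb) hab, hb⟩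
    exact Finset.inter_eq_right.1 this
  refine conn_of_closed ⟨c, hc⟩ fun A hA ⟨a, ha⟩ hcl => hA.antisymm fun x hx => ?_
  obtain ⟨t, ht, hct, hat, hconn⟩ := h a (hA ha)
  have hcA := sub A hA hcl t ht hconn ⟨a, Finset.mem_inter.2 ⟨ha, hat⟩⟩ hct
  obtain ⟨t, ht, hct, hxt, hconn⟩ := h x hx
  exact sub A hA hcl t ht hconn ⟨c, Finset.mem_inter.2 ⟨hcA, hct⟩⟩ hxt

theorem Conn.union_of_mem {s t : Finset V} (hs : Conn G s) (ht : Conn G t) {x : V} (hxs : x ∈ s)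
    (hxt : x ∈ t) : Conn G (s ∪ t) := by
  refine conn_of_center (Finset.mem_union_left t hxs) fun y hy => ?_
  rcases Finset.mem_union.1 hy with hy | hy
  · exact ⟨s, Finset.subset_union_left, hxs, hy, hs⟩
  · exact ⟨t, Finset.subset_union_right, hxt, hy, ht⟩

theorem conn_pair {a b : V} (h : G.Adj a b) : Conn G {a, b} := by
  refine conn_of_closed ⟨a, by simp⟩ fun A hA ⟨x, hx⟩ hcl => hA.antisymm ?_
  have hx' := hA hx
  simp only [Finset.mem_insert, Finset.mem_singleton] at hx'
  have hab : a ∈ A ∧ b ∈ A := by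
    rcases hx' with rfl | rfl
    · exact ⟨hx, hcl _ hx b (by simp) h⟩
    · exact ⟨hcl _ hx a (by simp) h.symm, hx⟩
  intro y hy
  simp only [Finset.mem_insert, Finset.mem_singleton] at hy
  rcases hy with rfl | rfl
  exacts [hab.1, hab.2]

theorem Conn.union {s t : Finset V} (hs : Conn G s) (ht : Conn G t) (h : Touch G s t) :
    Conn G (s ∪ t) := by
  obtain ⟨a, ha, b, hb, hab⟩ := h
  have h1 := hs.union_of_mem (conn_pair hab) ha (by simp)
  have h2 := h1.union_of_mem ht (x := b) (by simp) hb
  convert h2 using 1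
  ext x
  simp only [Finset.mem_union, Finset.mem_insert, Finset.mem_singleton]
  constructor
  · tauto
  · rintro ((h | rfl | rfl) | h) <;> tauto

theorem Conn.induce_connected {s : Finset V} (h : Conn G s) : (G.induce (s : Set V)).Connected := by
  obtain ⟨c, hc⟩ := h.1
  have key : ∀ x (hx : x ∈ (s : Set V)), (G.induce (s : Set V)).Reachable ⟨c, hc⟩ ⟨x, hx⟩ := by
    have := h.eq_of_closed
      (A := s.filter fun x => ∃ hx : x ∈ (s : Set V), (G.induce (s : Set V)).Reachable ⟨c, hc⟩ ⟨x, hx⟩)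
      (Finset.filter_subset _ _) ⟨c, Finset.mem_filter.2 ⟨hc, hc, Reachable.refl _⟩⟩ fun a ha b hb hab => by
        rw [Finset.mem_filter] at ha ⊢
        obtain ⟨has, _, hr⟩ := ha
        refine ⟨hb, hb, hr.trans (Adj.reachable ?_)⟩
        exact hab
    intro x hx
    have hx' := this.symm ▸ Finset.mem_coe.1 hx
    exact (Finset.mem_filter.1 hx').2.2
  have : Nonempty (s : Set V) := ⟨⟨c, hc⟩⟩
  exact ⟨fun x y => (key x.1 x.2).symm.trans (key y.1 y.2)⟩

/-- The graph `G` has a `K₈` minor. -/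
def HasK8 (G : SimpleGraph V) : Prop :=
  ∃ f : Fin 8 → Finset V, (∀ i, Conn G (f i)) ∧ (∀ i j, i ≠ j → Disjoint (f i) (f j)) ∧
    ∀ i j, i ≠ j → Touch G (f i) (f j)

theorem HasK8.minorOf (h : HasK8 G) : (⊤ : SimpleGraph (Fin 8)).MinorOf G := by
  obtain ⟨f, h1, h2, h3⟩ := h
  refine ⟨fun i => f i, fun i => (h1 i).1, fun i => (h1 i).induce_connected, fun i j hij => ?_,
    fun i j hij => ?_⟩
  · exact Finset.disjoint_coe.2 (h2 i j hij)
  · obtain ⟨a, ha, b, hb, hab⟩ := h3 i j hij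
    exact ⟨a, ha, b, hb, hab⟩

theorem HasK8.mono (h : HasK8 G) (hle : G ≤ G') : HasK8 G' := by
  obtain ⟨f, h1, h2, h3⟩ := h
  refine ⟨f, fun i => (h1 i).mono hle, h2, fun i j hij => ?_⟩
  obtain ⟨a, ha, b, hb, hab⟩ := h3 i j hij
  exact ⟨a, ha, b, hb, hle hab⟩

/-- A connected set of a graph `G'` remains connected when its vertices are replaced by connected
sets of `G` such that adjacent vertices become touching sets. -/
theorem Conn.biUnion {G' : SimpleGraph W} {f : W → Finset V} {s : Finset W} (hs : Conn G' s)
    (hc : ∀ w ∈ s, Conn G (f w)) (ht : ∀ a ∈ s, ∀ b ∈ s, G'.Adj a b → Touch G (f a) (f b)) :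
    Conn G (s.biUnion f) := by
  obtain ⟨w₀, hw₀⟩ := hs.1
  obtain ⟨c, hcw⟩ := (hc w₀ hw₀).1
  have key := hs.eq_of_closed
    (A := s.filter fun w => ∃ t ⊆ s.biUnion f, c ∈ t ∧ f w ⊆ t ∧ Conn G t)
    (Finset.filter_subset _ _)
    ⟨w₀, Finset.mem_filter.2 ⟨hw₀, f w₀, Finset.subset_biUnion_of_mem f hw₀, hcw,
      subset_rfl, hc w₀ hw₀⟩⟩ fun a ha b hb hab => by
      rw [Finset.mem_filter] at ha ⊢
      obtain ⟨has, t, hts, hct, hft, hconn⟩ := ha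
      refine ⟨hb, t ∪ f b, Finset.union_subset hts (Finset.subset_biUnion_of_mem f hb),
        Finset.mem_union_left _ hct, Finset.subset_union_right, ?_⟩
      exact hconn.union (hc b hb) ((ht a has b hb hab).mono hft subset_rfl)
  refine conn_of_center (c := c) (Finset.mem_biUnion.2 ⟨w₀, hw₀, hcw⟩) fun x hx => ?_
  obtain ⟨w, hw, hxw⟩ := Finset.mem_biUnion.1 hx
  rw [← key, Finset.mem_filter] at hw
  obtain ⟨-, t, hts, hct, hft, hconn⟩ := hw
  exact ⟨t, hts, hct, hft hxw, hconn⟩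

/-- A `K₈` minor survives when vertices are replaced by disjoint connected sets. -/
theorem HasK8.bind {G' : SimpleGraph W} (h : HasK8 G') (P : W → Prop) (f : W → Finset V)
    (hc : ∀ w, P w → Conn G (f w)) (hd : ∀ a b, P a → P b → a ≠ b → Disjoint (f a) (f b))
    (ht : ∀ a b, G'.Adj a b → P a ∧ Touch G (f a) (f b)) : HasK8 G := by
  obtain ⟨g, h1, h2, h3⟩ := h
  have hP : ∀ i, ∀ w ∈ g i, P w := by
    intro i w hw
    by_cases hs : {w} = g i
    · obtain ⟨j, hj⟩ : ∃ j, i ≠ j := ⟨i + 1, by simp⟩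
      obtain ⟨a, ha, b, -, hab⟩ := h3 i j hj
      rw [← hs, Finset.mem_singleton] at ha
      exact ha ▸ (ht a b hab).1
    · obtain ⟨a, ha, b, -, hab⟩ := (h1 i).2 {w} (by simpa using hw) (by simp) hs
      rw [Finset.mem_singleton] at ha
      exact ha ▸ (ht a b hab).1
  refine ⟨fun i => (g i).biUnion f, fun i => (h1 i).biUnion (fun w hw => hc w (hP i w hw))
    fun a _ b _ hab => (ht a b hab).2, fun i j hij => ?_, fun i j hij => ?_⟩
  · rw [Finset.disjoint_biUnion_left]
    intro a ha
    rw [Finset.disjoint_biUnion_right]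
    intro b hb
    refine hd a b (hP i a ha) (hP j b hb) ?_
    rintro rfl
    exact Finset.disjoint_left.1 (h2 i j hij) ha hb
  · obtain ⟨a, ha, b, hb, hab⟩ := h3 i j hij
    exact (ht a b hab).2.mono (Finset.subset_biUnion_of_mem f ha) (Finset.subset_biUnion_of_mem f hb)

/-- `a` colours `{0, …, m - 1}` such that each colour class below `k` is a star of the relation `R`
and any two of these classes are joined by `R`. -/
def StarModel (m k : ℕ) (R : ℕ → ℕ → Prop) (a : ℕ → ℕ) : Prop :=
  (∀ c < k, ∃ i < m, a i = c ∧ ∀ j < m, a j = c → j = i ∨ R i j) ∧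
  ∀ c < k, ∀ d < c, ∃ i < m, ∃ j < m, a i = c ∧ a j = d ∧ R i j

theorem StarModel.hasK8 {m : ℕ} {a : ℕ → ℕ} {f : ℕ → Finset V}
    (h : StarModel m 8 (fun i j => Touch G (f i) (f j)) a) (hc : ∀ i < m, Conn G (f i))
    (hd : ∀ i < m, ∀ j < m, i ≠ j → Disjoint (f i) (f j)) : HasK8 G := by
  have sub : ∀ c, ∀ i < m, a i = c →
      f i ⊆ ((Finset.range m).filter (a · = c)).biUnion f := fun c i hi hic =>
    Finset.subset_biUnion_of_mem f (by simpa using ⟨hi, hic⟩)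
  have touch : ∀ c < 8, ∀ d < c, Touch G (((Finset.range m).filter (a · = c)).biUnion f)
      (((Finset.range m).filter (a · = d)).biUnion f) := by
    intro c hc8 d hdc
    obtain ⟨i, hi, j, hj, hic, hjd, ht⟩ := h.2 c hc8 d hdc
    exact ht.mono (sub c i hi hic) (sub d j hj hjd)
  refine ⟨fun c => ((Finset.range m).filter (a · = c)).biUnion f, fun c => ?_, fun c d hcd => ?_,
    fun c d hcd => ?_⟩
  · obtain ⟨i, hi, hic, hstar⟩ := h.1 c c.2
    obtain ⟨x, hx⟩ := (hc i hi).1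
    refine conn_of_center (sub c i hi hic hx) fun y hy => ?_
    obtain ⟨j, hj, hy⟩ := Finset.mem_biUnion.1 hy
    rw [Finset.mem_filter, Finset.mem_range] at hj
    rcases hstar j hj.1 hj.2 with rfl | ht
    · exact ⟨f j, sub c j hi hic, hx, hy, hc j hi⟩
    · exact ⟨f i ∪ f j, Finset.union_subset (sub c i hi hic) (sub c j hj.1 hj.2),
        Finset.mem_union_left _ hx, Finset.mem_union_right _ hy, (hc i hi).union (hc j hj.1) ht⟩
  · rw [Finset.disjoint_biUnion_left]
    intro i hi
    rw [Finset.disjoint_biUnion_right]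
    intro j hj
    rw [Finset.mem_filter, Finset.mem_range] at hi hj
    refine hd i hi.1 j hj.1 ?_
    rintro rfl
    exact hcd (Fin.ext (hi.2.symm.trans hj.2))
  · rcases lt_or_gt_of_ne hcd with hlt | hlt
    · exact (touch d d.2 c hlt).symm
    · exact touch c c.2 d hlt

/-! ### Components -/

/-- `C` is a connected component of the subgraph induced on `Z`. -/
def IsComp (G : SimpleGraph V) (Z C : Finset V) : Prop :=
  C ⊆ Z ∧ Conn G C ∧ ∀ a ∈ C, ∀ b ∈ Z, G.Adj a b → b ∈ C

theorem IsComp.subset_of_conn {Z C A : Finset V} (h : IsComp G Z C) (hA : Conn G A) (hAZ : A ⊆ Z)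
    {x : V} (hxA : x ∈ A) (hxC : x ∈ C) : A ⊆ C := by
  have := hA.eq_of_closed (A := A ∩ C) Finset.inter_subset_left
    ⟨x, Finset.mem_inter.2 ⟨hxA, hxC⟩⟩ fun a ha b hb hab => by
      rw [Finset.mem_inter] at ha ⊢
      exact ⟨hb, h.2.2 a ha.2 b (hAZ hb) hab⟩
  exact Finset.inter_eq_left.1 this

theorem exists_isComp {Z : Finset V} {z : V} (hz : z ∈ Z) : ∃ C, IsComp G Z C ∧ z ∈ C := by
  obtain ⟨C, hC, hmax⟩ := Finset.exists_max_image
    (Z.powerset.filter fun C => z ∈ C ∧ Conn G C) Finset.card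
    ⟨{z}, by simpa using ⟨hz, conn_singleton z⟩⟩
  rw [Finset.mem_filter, Finset.mem_powerset] at hC
  obtain ⟨hCZ, hzC, hconn⟩ := hC
  refine ⟨C, ⟨hCZ, hconn, fun a ha b hb hab => ?_⟩, hzC⟩
  by_contra hbC
  have h1 := hconn.union (conn_singleton b) ⟨a, ha, b, by simp, hab⟩
  have h2 := hmax (C ∪ {b}) (by
    rw [Finset.mem_filter, Finset.mem_powerset]
    exact ⟨Finset.union_subset hCZ (by simpa using hb), Finset.mem_union_left _ hzC, h1⟩)
  have h3 : C.card < (C ∪ {b}).card :=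
    Finset.card_lt_card ⟨Finset.subset_union_left, fun h => hbC (h (by simp))⟩
  omega

/-- A component of a connected set minus a vertex `z` is attached to `z`. -/
theorem IsComp.adj_of_erase {D C : Finset V} {z : V} (hD : Conn G D) (hz : z ∈ D)
    (h : IsComp G (D.erase z) C) : ∃ a ∈ C, G.Adj a z := by
  by_contra! hcon
  have := hD.eq_of_closed (A := C) (h.1.trans (Finset.erase_subset _ _)) h.2.1.1
    fun a ha b hb hab => h.2.2 a ha b (Finset.mem_erase.2 ⟨by
      rintro rfl
      exact hcon a ha hab, hb⟩) hab
  have hzC : z ∈ C := this ▸ hz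
  simpa using h.1 hzC

/-- Deleting a component of `D - z` from a connected set `D` leaves a connected set. -/
theorem IsComp.conn_sdiff {D C : Finset V} {z : V} (hD : Conn G D) (hz : z ∈ D)
    (h : IsComp G (D.erase z) C) : Conn G (D \ C) := by
  have hzC : z ∉ C := fun hzC => by simpa using h.1 hzC
  refine conn_of_center (c := z) (Finset.mem_sdiff.2 ⟨hz, hzC⟩) fun x hx => ?_
  rw [Finset.mem_sdiff] at hx
  by_cases hxz : x = z
  · exact ⟨{z}, by simpa using ⟨hz, hzC⟩, by simp, by simp [hxz], conn_singleton z⟩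
  obtain ⟨C', hC', hxC'⟩ := exists_isComp (G := G) (Finset.mem_erase.2 ⟨hxz, hx.1⟩)
  obtain ⟨a, ha, haz⟩ := hC'.adj_of_erase hD hz
  refine ⟨C' ∪ {z}, ?_, by simp, Finset.mem_union_left _ hxC',
    hC'.2.1.union (conn_singleton z) ⟨a, ha, z, by simp, haz⟩⟩
  refine Finset.union_subset (fun y hy => Finset.mem_sdiff.2
    ⟨Finset.mem_of_mem_erase (hC'.1 hy), fun hyC => ?_⟩) (by simpa using ⟨hz, hzC⟩)
  exact hx.2 (h.subset_of_conn hC'.2.1 hC'.1 hy hyC hxC')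

end

end CliqueMinor

namespace CliqueMinor

/-! ### A certificate checker for dense graphs of small order -/

theorem blt_eq_false {i j : ℕ} (h : j ≤ i) : Nat.blt i j = false := by
  rw [← Bool.not_eq_true, Nat.blt_eq]
  omega

theorem beq_eq_false {i j : ℕ} : Nat.beq i j = false ↔ i ≠ j := by
  rw [← Bool.not_eq_true, Nat.beq_eq]

/-- `f i` holds for all `i < n`. -/
def allLT (f : ℕ → Bool) : ℕ → Bool
  | 0 => true
  | n + 1 => f n && allLT f n

/-- `f i` holds for some `i < n`. -/
def anyLT (f : ℕ → Bool) : ℕ → Bool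
  | 0 => false
  | n + 1 => f n || anyLT f n

theorem allLT_iff {f : ℕ → Bool} {n : ℕ} : allLT f n = true ↔ ∀ i < n, f i = true := by
  induction n with
  | zero => simp [allLT]
  | succ n ih =>
    rw [allLT, Bool.and_eq_true, ih, Nat.forall_lt_succ_right, and_comm]

theorem anyLT_iff {f : ℕ → Bool} {n : ℕ} : anyLT f n = true ↔ ∃ i < n, f i = true := by
  induction n with
  | zero => simp [anyLT]
  | succ n ih =>
    rw [anyLT, Bool.or_eq_true, ih, Nat.exists_lt_succ_right, or_comm]

/-- The number of `i < n` with `f i`. -/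
def countLT (f : ℕ → Bool) : ℕ → ℕ
  | 0 => 0
  | n + 1 => (bif f n then 1 else 0) + countLT f n

theorem countLT_le {f : ℕ → Bool} {p : ℕ → Prop} [DecidablePred p] {n : ℕ}
    (h : ∀ i < n, f i = true → p i) : countLT f n ≤ ((Finset.range n).filter p).card := by
  induction n with
  | zero => simp [countLT]
  | succ n ih =>
    have ih' := ih fun i hi => h i (by omega)
    rw [countLT, Finset.range_add_one, Finset.filter_insert]
    cases hf : f n with
    | false =>
      simp only [cond_false, zero_add]
      split_ifs
      · exact ih'.trans (Finset.card_le_card (Finset.subset_insert _ _))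
      · exact ih'
    | true =>
      rw [if_pos (h n (by omega) hf), Finset.card_insert_of_notMem (by simp)]
      simp only [cond_true]
      omega

section Checker

variable (m : ℕ)

/-- Bit `(i, j)` of a partial description `M` of a graph on `m` vertices. For `i < j` it says that
`i` and `j` are adjacent, for `j < i` that they are not. -/
def entryBit (M i j : ℕ) : Bool := Nat.testBit M (m * i + j)

/-- The description `M` says that the vertices `i` and `j` are adjacent. -/
def saysAdj (M i j : ℕ) : Bool := bif Nat.blt i j then entryBit m M i j else entryBit m M j i

/-- The description `M` says that the vertices `i` and `j` are not adjacent. -/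
def saysNonadj (M i j : ℕ) : Bool := bif Nat.blt i j then entryBit m M j i else entryBit m M i j

/-- The relabelling `p` carries the first description into the second one. -/
def refines (p : ℕ → ℕ) (M' M : ℕ) : Bool :=
  allLT (fun i => Nat.blt (p i) m && allLT (fun j => !Nat.beq (p i) (p j) &&
    ((!entryBit m M' j i || saysAdj m M (p i) (p j)) &&
      (!entryBit m M' i j || saysNonadj m M (p i) (p j)))) i) m

/-- Boolean test for `StarModel m k`. -/
def starCheck (k : ℕ) (adj : ℕ → ℕ → Bool) (a : ℕ → ℕ) : Bool :=
  allLT (fun c => anyLT (fun i => Nat.beq (a i) c &&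
      allLT (fun j => !Nat.beq (a j) c || (Nat.beq j i || adj i j)) m) m &&
    allLT (fun d => anyLT (fun i => Nat.beq (a i) c &&
      anyLT (fun j => Nat.beq (a j) d && adj i j) m) m) c) k

/-- The hexadecimal digit of `x` at position `k`. -/
def hexDigit (x k : ℕ) : ℕ := (x >>> (4 * k)) % 16

/-- The `i`-th block of 256 bits of a certificate. -/
def block (C i : ℕ) : ℕ := (C >>> (256 * i)) % 2 ^ 256

/-- The description refuted by a block. -/
def blockState (x : ℕ) : ℕ := x >>> (8 * (m + 5))

/-- Check the reason `x` for refuting the description `M`, where the descriptions in the first `n`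
blocks of `C` have been refuted and every vertex has at most `m - 7` non-neighbours. -/
def reasonCheck (exc : List (ℕ × ℕ)) (C n x M : ℕ) : Bool :=
  match hexDigit x 0 with
  | 1 => anyLT (fun i => Nat.ble 6 (hexDigit x (4 + i))) m &&
    starCheck m 6 (saysAdj m M) fun i => hexDigit x (4 + i)
  | 2 => let v := hexDigit x 4
    Nat.blt v m && Nat.blt (m - 7) (countLT (fun j => !Nat.beq v j && saysNonadj m M v j) m)
  | 3 => !exc.isEmpty && refines m (fun i => hexDigit x (4 + i)) 0 M &&
    exc.all fun e => Nat.blt e.1 m && (Nat.blt e.2 m && (!Nat.beq e.1 e.2 &&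
      saysNonadj m M (hexDigit x (4 + e.1)) (hexDigit x (4 + e.2))))
  | _ => let r := (x >>> 4) % 4096
    Nat.blt r n && refines m (fun i => hexDigit x (4 + i)) (blockState m (block C r)) M

/-- Check block `n`: it branches on a pair `u < v` and refutes both cases. -/
def blockCheck (exc : List (ℕ × ℕ)) (C n : ℕ) : Bool :=
  let x := block C n
  let M := blockState m x
  let u := hexDigit x (2 * m + 8)
  let v := hexDigit x (2 * m + 9)
  Nat.blt u v && (Nat.blt v m && (reasonCheck m exc C n x (M ||| 2 ^ (m * u + v)) &&
    reasonCheck m exc C n (x >>> (4 * (m + 4))) (M ||| 2 ^ (m * v + u))))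

/-- All of the first `N` blocks are correct, and the last one refutes the empty description. -/
def certCheck (exc : List (ℕ × ℕ)) (C N : ℕ) : Bool :=
  Nat.blt 0 N && (Nat.beq (blockState m (block C (N - 1))) 0 && allLT (blockCheck m exc C) N)

end Checker

section Soundness

variable {V : Type} (r : V → V → Prop) (Y : Finset V) {m : ℕ}

/-- `σ` enumerates `Y` injectively on `{0, …, m - 1}`. -/
def Enumerates (m : ℕ) (σ : ℕ → V) : Prop :=
  (∀ i < m, σ i ∈ Y) ∧ ∀ i < m, ∀ j < m, σ i = σ j → i = j

/-- The enumeration `σ` conforms to the description `M`. -/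
def Conforms (m : ℕ) (σ : ℕ → V) (M : ℕ) : Prop :=
  ∀ j < m, ∀ i < j, (entryBit m M i j = true → r (σ i) (σ j)) ∧
    (entryBit m M j i = true → ¬ r (σ i) (σ j))

variable {r Y}

theorem Conforms.adj (hr : ∀ ⦃x y⦄, r x y → r y x) {σ : ℕ → V} {M i j : ℕ} (h : Conforms r m σ M)
    (hi : i < m) (hj : j < m) (hij : i ≠ j) (hs : saysAdj m M i j = true) : r (σ i) (σ j) := by
  rcases lt_or_gt_of_ne hij with hlt | hlt
  · have : Nat.blt i j = true := by simpa using hlt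
    rw [saysAdj, this, cond_true] at hs
    exact (h j hj i hlt).1 hs
  · have : Nat.blt i j = false := blt_eq_false hlt.le
    rw [saysAdj, this, cond_false] at hs
    exact hr ((h i hi j hlt).1 hs)

theorem Conforms.not_adj (hr : ∀ ⦃x y⦄, r x y → r y x) {σ : ℕ → V} {M i j : ℕ} (h : Conforms r m σ M)
    (hi : i < m) (hj : j < m) (hij : i ≠ j) (hs : saysNonadj m M i j = true) :
    ¬ r (σ i) (σ j) := by
  rcases lt_or_gt_of_ne hij with hlt | hlt
  · have : Nat.blt i j = true := by simpa using hlt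
    rw [saysNonadj, this, cond_true] at hs
    exact (h j hj i hlt).2 hs
  · have : Nat.blt i j = false := blt_eq_false hlt.le
    rw [saysNonadj, this, cond_false] at hs
    exact fun h' => (h i hi j hlt).2 hs (hr h')

theorem refines_spec {p : ℕ → ℕ} {M' M : ℕ} (h : refines m p M' M = true) :
    (∀ i < m, p i < m) ∧ (∀ i < m, ∀ j < i, p i ≠ p j) ∧ ∀ i < m, ∀ j < i,
      (entryBit m M' j i = true → saysAdj m M (p i) (p j) = true) ∧
      (entryBit m M' i j = true → saysNonadj m M (p i) (p j) = true) := by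
  rw [refines, allLT_iff] at h
  refine ⟨fun i hi => ?_, fun i hi j hj => ?_, fun i hi j hj => ?_⟩
  · have := h i hi
    simp only [Bool.and_eq_true] at this
    simpa using this.1
  all_goals
    have := h i hi
    rw [Bool.and_eq_true, allLT_iff] at this
    have := this.2 j hj
    simp only [Bool.and_eq_true, Bool.or_eq_true, Bool.not_eq_true'] at this
    obtain ⟨h1, h2, h3⟩ := this
  · rintro heq
    rw [heq] at h1
    simp at h1
  · exact ⟨fun hb => by simpa [hb] using h2, fun hb => by simpa [hb] using h3⟩

theorem Enumerates.comp {σ : ℕ → V} {p : ℕ → ℕ} (h : Enumerates Y m σ) (h1 : ∀ i < m, p i < m)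
    (h2 : ∀ i < m, ∀ j < i, p i ≠ p j) : Enumerates Y m (σ ∘ p) := by
  refine ⟨fun i hi => h.1 _ (h1 i hi), fun i hi j hj hij => ?_⟩
  have := h.2 _ (h1 i hi) _ (h1 j hj) hij
  by_contra hne
  rcases lt_or_gt_of_ne hne with hlt | hlt
  · exact h2 j hj i hlt this.symm
  · exact h2 i hi j hlt this

theorem Conforms.comp (hr : ∀ ⦃x y⦄, r x y → r y x) {σ : ℕ → V} {p : ℕ → ℕ} {M' M : ℕ}
    (h : Conforms r m σ M) (hp : refines m p M' M = true) : Conforms r m (σ ∘ p) M' := by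
  obtain ⟨h1, h2, h3⟩ := refines_spec hp
  intro j hj i hi
  have hne := h2 j hj i hi
  have hi' : i < m := hi.trans hj
  refine ⟨fun hb => ?_, fun hb hadj => ?_⟩
  · exact hr (h.adj hr (h1 j hj) (h1 i hi') hne ((h3 j hj i hi).1 hb))
  · exact h.not_adj hr (h1 j hj) (h1 i hi') hne ((h3 j hj i hi).2 hb) (hr hadj)

theorem starModel_of_starCheck {k : ℕ} {adj : ℕ → ℕ → Bool} {R : ℕ → ℕ → Prop} {a : ℕ → ℕ}
    (hR : ∀ i < m, ∀ j < m, i ≠ j → adj i j = true → R i j) (h : starCheck m k adj a = true) :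
    StarModel m k R a := by
  rw [starCheck, allLT_iff] at h
  refine ⟨fun c hc => ?_, fun c hc d hd => ?_⟩
  · have := h c hc
    rw [Bool.and_eq_true, anyLT_iff] at this
    obtain ⟨i, hi, hci⟩ := this.1
    rw [Bool.and_eq_true, allLT_iff] at hci
    refine ⟨i, hi, by simpa using hci.1, fun j hj hjc => ?_⟩
    have hj' := hci.2 j hj
    simp only [Bool.or_eq_true, Bool.not_eq_true', hjc] at hj'
    by_cases hji : j = i
    · exact Or.inl hji
    · refine Or.inr (hR i hi j hj (Ne.symm hji) ?_)
      simpa [hji] using hj'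
  · have := h c hc
    rw [Bool.and_eq_true, allLT_iff] at this
    have := this.2 d hd
    rw [anyLT_iff] at this
    obtain ⟨i, hi, hci⟩ := this
    rw [Bool.and_eq_true, anyLT_iff] at hci
    obtain ⟨h3, j, hj, h4⟩ := hci
    rw [Bool.and_eq_true] at h4
    have h3' : a i = c := by simpa using h3
    have h4' : a j = d := by simpa using h4.1
    refine ⟨i, hi, j, hj, h3', h4', hR i hi j hj ?_ h4.2⟩
    rintro rfl
    omega

theorem entryBit_or {M u v i j : ℕ} (hv : v < m) (hj : j < m) :
    entryBit m (M ||| 2 ^ (m * u + v)) i j = true ↔ entryBit m M i j = true ∨ (i = u ∧ j = v) := by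
  rw [entryBit, entryBit, Nat.testBit_or, Bool.or_eq_true, Nat.testBit_two_pow, decide_eq_true_iff]
  refine or_congr_right ⟨fun h => ?_, fun ⟨h, h'⟩ => by rw [h, h']⟩
  have h1 := congrArg (· % m) h
  simp only [Nat.mul_add_mod, Nat.mod_eq_of_lt hv, Nat.mod_eq_of_lt hj] at h1
  subst h1
  have hm : 0 < m := by omega
  exact ⟨(Nat.eq_of_mul_eq_mul_left hm (by omega)).symm, rfl⟩

variable {exc : List (ℕ × ℕ)}

open Classical in
theorem false_of_reasonCheck (hr : ∀ ⦃x y⦄, r x y → r y x)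
    (hdeg : ∀ σ, Enumerates Y m σ → ∀ i < m,
      ((Finset.range m).filter fun j => i ≠ j ∧ ¬ r (σ i) (σ j)).card ≤ m - 7)
    (hmodel : ∀ σ, Enumerates Y m σ → ∀ a, (∃ y < m, 6 ≤ a y) →
      ¬ StarModel m 6 (fun i j => r (σ i) (σ j)) a)
    (hexc : exc ≠ [] → ∀ σ, Enumerates Y m σ → ¬ ∀ e ∈ exc, ¬ r (σ e.1) (σ e.2))
    {C n x M : ℕ} (hrec : ∀ k < n, ∀ σ, Enumerates Y m σ →
      ¬ Conforms r m σ (blockState m (block C k)))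
    (h : reasonCheck m exc C n x M = true) {σ : ℕ → V} (hσ : Enumerates Y m σ)
    (hM : Conforms r m σ M) : False := by
  rw [reasonCheck] at h
  split at h
  · rw [Bool.and_eq_true, anyLT_iff] at h
    obtain ⟨⟨y, hy, hy6⟩, h⟩ := h
    exact hmodel σ hσ _ ⟨y, hy, Nat.le_of_ble_eq_true hy6⟩
      (starModel_of_starCheck (fun i hi j hj hij => hM.adj hr hi hj hij) h)
  · simp only [Bool.and_eq_true, Nat.blt_eq] at h
    obtain ⟨hv, h⟩ := h
    refine absurd (hdeg σ hσ _ hv) (not_le.2 (h.trans_le (countLT_le fun i hi hf => ?_)))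
    simp only [Bool.and_eq_true, Bool.not_eq_true', beq_eq_false] at hf
    exact ⟨hf.1, hM.not_adj hr hv hi hf.1 hf.2⟩
  · simp only [Bool.and_eq_true, List.all_eq_true, Nat.blt_eq, Bool.not_eq_true',
      beq_eq_false] at h
    obtain ⟨⟨h0, h1⟩, h2⟩ := h
    obtain ⟨h3, h4, -⟩ := refines_spec h1
    have hcomp := hσ.comp h3 h4
    refine hexc (by simpa using h0) _ hcomp fun e he => ?_
    obtain ⟨h5, h6, h7, h8⟩ := h2 e he
    refine hM.not_adj hr (h3 _ h5) (h3 _ h6) ?_ h8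
    intro heq
    rcases lt_or_gt_of_ne h7 with hlt | hlt
    · exact h4 _ h6 _ hlt heq.symm
    · exact h4 _ h5 _ hlt heq
  · simp only [Bool.and_eq_true, Nat.blt_eq] at h
    obtain ⟨h3, h4, -⟩ := refines_spec h.2
    exact hrec _ h.1 _ (hσ.comp h3 h4) (hM.comp hr h.2)

open Classical in
theorem false_of_certCheck (hr : ∀ ⦃x y⦄, r x y → r y x)
    (hdeg : ∀ σ, Enumerates Y m σ → ∀ i < m,
      ((Finset.range m).filter fun j => i ≠ j ∧ ¬ r (σ i) (σ j)).card ≤ m - 7)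
    (hmodel : ∀ σ, Enumerates Y m σ → ∀ a, (∃ y < m, 6 ≤ a y) →
      ¬ StarModel m 6 (fun i j => r (σ i) (σ j)) a)
    (hexc : exc ≠ [] → ∀ σ, Enumerates Y m σ → ¬ ∀ e ∈ exc, ¬ r (σ e.1) (σ e.2))
    {C N : ℕ} (h : certCheck m exc C N = true) {σ : ℕ → V} (hσ : Enumerates Y m σ) : False := by
  simp only [certCheck, Bool.and_eq_true, Nat.blt_eq, Nat.beq_eq, allLT_iff] at h
  obtain ⟨hN, h0, hall⟩ := h
  have key : ∀ n < N, ∀ σ, Enumerates Y m σ → ¬ Conforms r m σ (blockState m (block C n)) := by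
    intro n
    induction n using Nat.strong_induction_on with
    | _ n ih =>
      intro hn τ hτ hc
      have hb := hall n hn
      simp only [blockCheck, Bool.and_eq_true, Nat.blt_eq] at hb
      obtain ⟨huv, hv, h1, h2⟩ := hb
      set u := hexDigit (block C n) (2 * m + 8)
      set v := hexDigit (block C n) (2 * m + 9)
      have hrec : ∀ k < n, ∀ σ, Enumerates Y m σ →
          ¬ Conforms r m σ (blockState m (block C k)) :=
        fun k hk => ih k hk (hk.trans hn)
      by_cases hadj : r (τ u) (τ v)
      · refine false_of_reasonCheck hr hdeg hmodel hexc hrec h1 hτ fun j hj i hi => ⟨?_, ?_⟩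
        · rw [entryBit_or hv hj]
          rintro (h' | ⟨rfl, rfl⟩)
          exacts [(hc j hj i hi).1 h', hadj]
        · rw [entryBit_or hv (hi.trans hj)]
          rintro (h' | ⟨rfl, rfl⟩)
          exacts [(hc j hj i hi).2 h', absurd huv (by omega)]
      · refine false_of_reasonCheck hr hdeg hmodel hexc hrec h2 hτ fun j hj i hi => ⟨?_, ?_⟩
        · rw [entryBit_or (huv.trans hv) hj]
          rintro (h' | ⟨rfl, rfl⟩)
          exacts [(hc j hj i hi).1 h', absurd huv (by omega)]
        · rw [entryBit_or (huv.trans hv) (hi.trans hj)]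
          rintro (h' | ⟨rfl, rfl⟩)
          exacts [(hc j hj i hi).2 h', hadj]
  refine key (N - 1) (by omega) σ hσ ?_
  rw [h0]
  intro j hj i hi
  simp [entryBit]

end Soundness

end CliqueMinor

namespace CliqueMinor

/-- Concatenate blocks, the first one in the lowest position. -/
def assemble (l : List ℕ) : ℕ := l.foldr (fun x c => c <<< 256 ||| x) 0

/-- The blocks of the certificate for order 7. -/
def blocksSeven : List ℕ :=
  [8048673541159909088328632461922664449,
   2731761557710760585739137647469658116,
   73305561189168682790002427312472084,
   31767190963165207929012982943580196,
   10997998577265740273369898030202932,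
   613399908435927874787805775265860,
   288890948812804456780275616055380,
   126626720223433951867598009270372,
   45492130048670128650709407629428,
   4922359081209646281715308560516,
   2401603676213637775447360012436,
   1129001315828266852851060310180,
   490224255557010631003112210612,
   168359845342811759529339912388,
   4951760157141563242655514836]

theorem certCheck_seven :
    certCheck 7 [] (assemble blocksSeven) 15 = true := by
  decide +kernel

/-- The blocks of the certificate for order 8. -/
def blocksEight : List ℕ :=
  [373539120836247866030272996386816579129573377,
   362388748236982359382162841270172423776370692,
   356813561937348435946178683472608836696670228,
   8364460912405966308183856962408403619020801,
   2789274612773231602913497131659095962550324,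
   1681462955636349763500830191155627950148,
   1511321774516104389892718537622460301396,
   1426251181518219173798645484267815043172,
   1383715884385451265637494256842140811380,
   1362448235185242011442803942380952092804,
   16409309148933176692357628438470986825729,
   5520273407383937037106124033023003328676,
   75755535381290288719155524370107990196,
   33220240704577355448397282351726461124,
   11952591504387368508961579642636992724,
   1318766270458574665462113978169688292,
   654157227319337804830731946595188980,
   321848960722508608375378684821897476,
   155694193598793896033001305583649044,
   72616176211636425747111867612922148,
   31076533692757576489466400275956020,
   10306078608018037745942918255870276,
   7716189203589232367603486353785172,
   6416847338355297231069365568274788,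
   5766542580438215548101556823916916,
   5440756376179560591916904100135300,
   5277229448750118999123829386641812,
   5194832159735284088026543678292388,
   16408303181981654456941471323344923000833,
   5519267440432414806393886655520068075972,
   74749568429768133269633967602143330772,
   32214273753055129440079643644726870500,
   10946624552865217763359761670607995380,
   312799318936499182576116741111284228,
   146648275515947031427942562533474836,
   63570258148132079112485611632591396,
   22030615630461860531053193744876084,
   1260160545797584507854046322754116,
   614847141497194030923555665871444,
   289060956581057045171390011933284,
   125534030360246128591364747690612,
   43136741420673937818413637304964,
   1304271617569590650312351285908]

theorem certCheck_eight :
    certCheck 8 [(0, 1), (2, 3), (4, 5), (6, 7)] (assemble blocksEight) 43 = true := by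
  decide +kernel

/-- The blocks of the certificate for order 9. -/
def blocksNine : List ℕ :=
  [1572340429316029567373116244422471012862558080119181672449,
   3064995469404065187325351804089983945661419362875080705,
   4387672287470608333231235707151770007204897226753,
   1532497105129861961268938297993068547593797810027233281,
   1609936073835019838112619544417393623578913538049,
   1498099123343731838859569277492455110945457216421956,
   1498053451417565247818856858683006000317936947953748,
   1496068479740358197455980307554583110968226611268,
   1476087012042474434686189732094765195952374415476,
   1464669034586873290162001179218457124630919381124,
   1464490628625285987722979186700426914487776313492,
   1464401425644491540711859385400609537885731815588,
   1464356824154094154947022655537337458006699278516,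
   335198529710468567553942703847548035329425409,
   3011292039581609518674900233108670139851604180,
   2922089058787163774896214151771407559823458532,
   2877487568389778088978161793014377799648018676,
   2855186823190922951925242795407179907031105796,
   78744045974509323479983482174138619960230100,
   34142555577123637852073320124920079928262948,
   11841810378268501089296519225233189240832308,
   691437778678671255012430141694448434676036,
   342988636218694932377293192675132789752148,
   168764064030655885425618666886911444910436,
   81651777774377085120568040601222762201460,
   38095634483978408138829364066800410558852,
   16317562676519792818746662408011224449428,
   5428526610531208329491948187038621106596,
   4747963478999690090752014558828583453108,
   4407680787560197968861913168240794665412,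
   4237539279581175078703499081368889983444,
   4152468363332386804410928646354927354340,
   4109932742948715838051280037269935751668,
   4088664770497603525658092341149429662212,
   1496624921289676472809338223283158780776288744374273,
   1496579249363509881768625804473709671065701527323172,
   24586888610193195926175388439514218015907381249,
   1751273976041244227975489009613730503499711044,
   1463243154730919125237377900941291626866823660116,
   1463064748769332178326460248902017572598858121828,
   1462975545788537731315340447602200195996813623924,
   1462930944298140345550503717738928116117781086852,
   1535488696465028812559834366181023453725694883660824577,
   2993155688343275277662961122739992791343423547244545,
   335176698386789056278325242411881537053130753,
   1585412268698391852390578302632650335975375556,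
   1496209287903946108611892221295387755947229908,
   1451607797506560422693839862538357995771790052,
   1429307052307705285640920864931160103154877172,
   1429297524400751452705944687001061635614835460,
   1428949075258647004487650325036967285069185812,
   1428774850686458965440698650511179063724344100,
   1428687738400202686640393599884893375041635124,
   1428644182256912287963411861208358952689992516,
   1499500847440690124455738001862592714070925422624769,
   2923170814015677084833789812532820535278236073985,
   167582910013889787989811985549522701511557121,
   82561318945109814819341857240792412005073796,
   37959828547724049982611993968712532972536724,
   15659083348868908287417848969281015445980068,
   4508710749279078162991563106173678672413620,
   79786657854475121081738740352845935178416836,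
   35185167457089435453828578303627395146449876,
   12884422258234298691051777403940504459019236,
   1734049658644468856767688320401763652862964,
   1723160622558197863812577614626407207404548,
   1548936051992667153773794116476464106832916,
   1461823765736467562288444712751896210703396,
   1418267622446073817724050135962100698186804,
   1396489550638615492546164213871907479487556,
   1395811645627829849402044179283414789129300,
   1395471362936390357280154077892827000341604,
   1395301221428411334389995663805955095659636,
   1395216150512162546115703093370941133030532,
   1395173614891778875149343444761856141427860,
   1464669030500826431118179917394041794558082154628,
   1464490624539239128680147793394124011185997087924,
   1464401421558444681669027992094306634583952590020,
   1464356820068047295904191262231034554704920052948,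
   3011287953534750475843506931561568044575621332,
   2922084972740304732064820850224305464547476724,
   2877483482342919046146768491467275704372036868,
   2855182737144063909093849493860077811755123988,
   78739959927650280648590180554978930646319316,
   34138469530264595020680018505760390614353204,
   11837724331409458257903217606073499926922564,
   687351731819628423619128522534759120766292,
   338915881648984937844486932657991255590244,
   166052438929897294137968747431928739661172,
   78940152673697720786506637926798464124292,
   35384009383303994355999355356440572200340,
   13605937575845687312000727485684974093732,
   2716901509857120956633379541744029271476,
   2036338376973449482930258407608342808004,
   1696055686801606752342638861482120447444,
   1525914178901810815772741555168622937572,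
   1440843262657973092711565084219120027124,
   1398307642274610402435990263167716427268,
   1377039669823516223930168844078868858388,
   1366405521338683238517257243085050480164,
   1365078209444669590265007261288502396468,
   1364413270928223473901828574602341647940,
   1364080639410723586506875839681250985556,
   1363914161392696813596036080642695366244,
   1363830760124406597927252809545407268468,
   1363788897230984660879497782418752931460,
   3114939451759188309095194940013594579829764,
   2940714879572416912668190851958549668431524,
   2853602593316217340450096698342134244181684,
   2810046450025823615152957371660491203544772,
   2788268378218365309242326699678450456725204,
   164691330231400974494263854440617026323828,
   77579043975201401142801744935486751770356,
   34022900684807674712294462365128859846404,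
   12244828877349367668295834494373261739796,
   1355792811360801312928486550432316917540,
   675229678477122963753977514550059075380,
   334946988305281366534818260296953497412,
   164805480405486563332876842698307274580,
   79734564161649973639656260463655651172,
   37198943778288416732037328127103338356,
   15930971327195371594171797753107056516,
   5296822842363519552242504423732938644,
   3969520323330848713607506009791661988,
   3304583074535257020866552500048627636,
   2971951636263456582386486852216424388,
   2805473623188368270896580592971810772,
   2722072355207562054142986244123002852,
   2680209461804892261710124863978473460,
   2659115755818227892497166031530231812,
   338913243962180793642941568070380166317412,
   164688671775409397286773121373567993251876,
   77576385519209825139514465000197247207476,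
   34020242228816099913210635561598884776004,
   12242170421357794073415460822602816161876,
   1353134355369228922251566010421400832100,
   672581607079269634981538687291831093364,
   332298916907428108597444330519176153220,
   162157409007633376231000155965208135828,
   77086492763796857373276816775234717860,
   34550872380435371301155127483360610484,
   13282899929342396998786840154042534084,
   2648751444510615792354789869346621652,
   1321448925477590776233576232014317796,
   656511676682069918989865766949488884,
   323880238410340316007043163795491076,
   157402225335322840014379949229082900,
   74000957354587458758028645058480420,
   32138063951988501822410309592156468,
   11044357965394968106694521822120260,
   335245694737721692151011859237204]

theorem certCheck_nine :
    certCheck 9 [(0, 1), (0, 2), (1, 2), (3, 4), (3, 5), (4, 5), (6, 7), (6, 8), (7, 8)] (assemble blocksNine) 151 = true := by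
  decide +kernel

/-- The blocks of the certificate for order 10. -/
def blocksTen : List ℕ :=
  [25132950816014949781063642875168345158970133699474488295425,
   24543874468226725720405197889183112840268128201271672833,
   23945905716356319770001092771910706232457523517980673,
   708606854463262852610884352343263990406125191169,
   353222178979719787878482102602610817536994836532,
   170534474313273846353284941271018952138735747140,
   79190621980009337215818081984194775468972441684,
   33518695813335544272216373719754443163457028196,
   10682732729957109425547240966506033040065560692,
   10330102196832458649209396839550719222847897732,
   10151696235161136914340553851313044389532532884,
   10062493254283937672037853736165963002241089700,
   10017891763803799676018225057564178337961607348,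
   9995591018522192303140132097235042035188105412,
   94930449105702284078832511694657551457416979152897,
   1394344316524414237125864521077839116569016271076,
   11973997203111275769521609943643157708766610623299828,
   11973266452292610733446256784013009849696488994636036,
   11972901076883277924639956126247588722453633743978772,
   11972718389178611478698430929086257130588235484889380,
   11972627045326278214189293462226970306411565721583924,
   325380396178209563496931952597988221092883333364,
   142692691511763642249192634762082983860683931988,
   51348839178499134374424615547499609092634181988,
   5676913011825341505099309641335014785673068916,
   5850974019879132781271996044620112589970490786180,
   5850617207955873214551994915885693728245127578004,
   5850438801994201892817126072897456053411812213156,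
   5850349599013324693574823372782308972024520769972,
   5850304997522844555578803744103707187360241287620,
   4632959377463143028635119221977096537439732100,
   4454553415791841575866394876746225900804112868,
   4365350434914643600904809981160122446097940980,
   4320748944434505683803858808154251811244474884,
   4298448199152898315568040996298213043949535764,
   4287297826470556254260715876658656848219472420,
   4286602289802745756362015659972132420629561908,
   4286253840575941965638871922317634348713509444,
   4286079615921001695409021432462141342121722452,
   4285992503551993185425817566506150868192068196,
   4285948947325950555565937012499911660593480308,
   4285927169171390865767718114468548086160425604,
   102945265358023569369291883385129004935699967201293856893042689,
   102944480720306646034196404171065946904139335865534669382484644,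
   100838206590095085307870688738016526494355371149108414775297,
   100445887731634132080875509560574957156859067256081772184260,
   421352010905316625977430224959507104005499034152012004558222917633,
   102844231087880281884342223107136802379524054715657963021795329,
   105415135911809250335425362719729049208254756261303644784442737396,
   105415135911809156799320573541937091875566927591561856308430766852,
   102844243251970101402545858529366700838739705793645538935046852,
   404578823954579333409288125617365445557185564664098979841,
   208419394723767860284536455544540761473305695554722857780,
   12259965492934086414584959319564628722285992450920022852,
   12566463436222050935612094226730801696611204111326830920532,
   12566463436199214972528715791884132563857955701203439453028,
   12566463435468464153863679716530972933710096631081810789236,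
   12566463435103088744530870910230315168288969388226560131972,
   24520130935116938175076070321156663413379210333162504193,
   24519943862907359819419463499761518487110651949943358372,
   296549100254992452783473884690649541614349319143425,
   109476890676636796177840911983438400049482577216452,
   15940875090439721410474284884113337083438214153172,
   12259980223557522832612069030845220147666874232954946532,
   12265951940656372292528339799542760222006319814198428500,
   12265954842250931563661701245944987387207180279616635908,
   12265954111500112898625283627123295608186334011267744788,
   12265953746124703565816800577368588386709394319941305380,
   12265953563436998899370878066930430479711472876837143604,
   94907635388876473248143448059423807727534864531457,
   1371530599698603406436800885844104939021662159956,
   5989875916854364939936232383811053638133098885416036,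
   5989510541445032131454371051541546126257310718231668,
   5989327853740365685533049035821353093399770773324932,
   5989236509888032421025099991399781387208508776121492,
   5989235800445576033715302412246597635984907467490468,
   5989235443633652774148582411117863217123182104282292,
   5989235265227691102826847542274874979448348788917444,
   5989235176024710225627605239574759832366961497474260,
   11973263664688571883782045732958003605382067222741236,
   11972898289279239074974500946586469779773222753928436,
   11972715601574572629356226652483337838210988419056900,
   11972624257722239364866103944627475607978273810679060,
   322548190648960432887926085620855574650398179572,
   139860485982514511640186767784950337418466166068,
   48516633649250003765418748570366962650416416068,
   2844707482576210896093442664202368343455302996,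
   2925134358298355835936986675051092847523882075492,
   2924781727764821318222426482534588290927332164980,
   2924603321803150016765015483042032440446278436228,
   2924514118822272818785411622999126160960700548500,
   2924469517331792680863668396678800114294975366564,
   2924447217947640541174251677760041859067904263604,
   2924436067574958199113235699060162611211949573572,
   2924435370677160920931584278325651743643146388948,
   2924435022227934117140861134587997245571230336484,
   2924434848003279176870631284098141752564638549492,
   2924434760890910168360648080232185762090708895236,
   2924434717334684125730788199678179522883110307348,
   1778476242216432420302098676159668911335277924,
   1600070280545130967533374330928798274715387444,
   1510867299667932992571789435342694820009215556,
   1466265809187795075470838262336824185155749460,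
   1443965063906187707235020450480785417860810340,
   1432814691223845645927695283571447533250020980,
   1432117793429313614270104416067889428144588420,
   1431769344202834341791134096471750948131178132,
   1431595119547914353661402249618258324672743076,
   1431508007178907111019313603223245783328360116,
   1431464450952864560078110554812920605155788484,
   1431442672798304874922166805254654566201296596,
   1431431783679486655154778669494203045760730852,
   822752738409358818042981218209764520921926261150234519982309377,
   822752346090500356375433478389848820706218012725299947580163844,
   822752290932540520013008885333712721324747620252753315549413377,
   822752290932540154637599552524906420666982199159044396142298916,
   822752290932539971949894886078964895469820867567178997883209524,
   822752487175917925384446602390525205541225804831899064418172929,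
   822752487175917879712520435633658037600640441678172634081134420,
   822752493210119071872132040084974320951902993830747413108754276,
   822752327715426106690760781672889766084248792980862410589996820,
   822802544900460509612178784308025270941376961944509557637120001,
   822802544517336624395706569635361764417242424012066249449146260,
   822752523863116716225332508765161185027739946927110434348597249,
   822752523863116670553406341997906897972404782881814195993577396,
   964163022715104029529530247577551085882473646343618455293462468,
   951307518456813169973164937660358569512579512136417356314312705,
   39492109964283341075866087613783629532949677155686686415175811073,
   26328073505713692829981336859095826695879849884679113553780670465,
   27176536400763581235227192796753581621429755268143542267599128580,
   27176536400670793419276328432111320282438614577744277034232711188,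
   27176536406800775491396031532352891409592479606429876278778660900,
   26353784128140175393321821603154551906938014940074579008949323828,
   26353784128139988321112243247391699238167105832828066213168941124,
   26353784128139894785007454069521857452601254748658320292218669140,
   26353784128139894762171490986055153559337029925724891731230460004,
   13164036654730165063735697838934033321002941838524103244076023809,
   13164036654730164972391845505669524183536082551723082301471459460,
   13164036654730164926719919338995731239934374287282749995956045972,
   13013943549425628795361740940137117394967140909449217,
   1088090545704836647623875658476989768533120732102657,
   196160516590628660041396891248001865101931333193061894340,
   25711204868476285831027740942602681498542760971865333158643924,
   25711204868382749726238563072760895932691676802119412208371940,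
   44528191323992686844657868825680354213694840954211049406465,
   31973987853242172441501354235311547879285409143184384065537,
   25742982695906473479598378769788530610408021730079241472575764,
   12946630082943766461896556984859557185795209071426714730497,
   105312298534245945798361765729822453578137689086208247556608098305,
   105312298534245945615674409512520628045011281584648249985062668612,
   118721442703445651738642544814603780290292667051635349050988953601,
   118721443071340362609103841292252692644197796504709125961446064129,
   118720639602318233113966070311468236901441650084831285320073873780,
   118720589385504537092730076987822138286345012325964475569638735873,
   118514901316222510222677178054685517573463374537117957691256340481,
   118514901511998815568295263720526592157764395868860591716894247332,
   105350865053429167231055510260141239656575723368290915151731752961,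
   105338009549075095308851174563319433606018988503432811677385490433,
   105338009549075095126163469896873185161441603868571817045459470804,
   105338009549075095080491543730116622387483561657301912070755715556,
   105338009548979314109187425676562380122360070933106531528252328436,
   105338009548979314017843573343370563140912699229623017293277563396,
   105338009548979126945633994987885609035229426912614278052801677844,
   105338009156660268483966447248242228744967734271830840598347123236,
   44920510182453953327560781728050624232066721536431020378004,
   25718272740892428176008888283374679729661722716544825962790913,
   25743381147833792211359564891281236449905963121474499907684948,
   25743381147740256106570387023539446502413995889229443946777188,
   102845021760685849423608312217043234023619543398311726689550337,
   128562307573374087018200617861850073374903534275832415695932036,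
   655909027422548370659650874806615003531964174359892852737,
   1195347504005631898911448583464718760274057948478330372097,
   1183087539701551912389502434034157641633609125829490507777,
   25718665056664014268817794958310701010158276297366489948752580,
   25718272740798709383515044045477010267109442293125617376299732,
   25717488103081786048419564654875859045364664637653972998425316,
   25717488103081763212456480928557122854398437219270503412271860,
   25717488102333474374143059055012881761368729000804831762320132,
   24520739103288823485126142681079212590413987447407902721,
   810449434688948669129288659146627032808115665895425,
   12855504354882327394346171431740928837186679197961227737238324,
   12855504354881596643527506312588825940999289282403164841052996,
   1184184278010894702771489751815830245763863481944884,
   1183818903298460181723507211278176529169732584082276,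
   31385509846341387077189715134478892481043521461785887506433,
   32764755832937999432243117879538899166753598811653767433092,
   7656348891391276376899965802876303899504826008424376434689,
   6871714170547726452622061009431821112512501362277783440292,
   6479395312086058904882241397967749459040256939770889898932,
   6479395312063222941798598158664531218603888637921052330948,
   6479394563774384628376724310187294134121766734545239935956,
   6479394189629965471665494477530384456287466495398617549796,
   6283234760399131697795553363194484295714143409167775304692,
   6283234760399087096304966289664694882795884091289124211716,
   6283234760399064795559684682291816789835554954986350709780,
   6283234760398351171713747086099970433061112647124496944164,
   6283234760397994359790487519379969304326693785399133735988,
   49050099557936823809231810487537806149227345114819461121,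
   49050099512264897642381479450745913745441203685140991060,
   501119682478897938564967425131803216359238127946039297,
   117995797262425723892303918607668678417507188919503988,
   106023221533195293701695576341970647038487994499596289,
   106023175861269126852317654346258214643464159240391828,
   10242204557151073298382308602990785674998888816184484,
   12855504367214500711683177800767420779158546655750159109980161,
   12855504355335415760356634264045152473681951652027144822849537,
   12855504358330763367635872543946523960155189011687274322070740,
   1263128180611605131589063534470342966471729274159105,
   4258841163300175722827381590552893635307500110613748,
   4258818505743053683406071940138751418714038603877636,
   4258818461141563364230477438985134822516653070224660,
   25108411106829079407728828619605247524897512213932609113380,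
   25108410358540241094306782758626691233578471326542445153588,
   25108409984395821937595553553456828668717724828263909428548,
   30651270016575054348330818177977422414915536218283443636,
   30654263171883706547188122541591234031978531530008956260,
   6134334518029486174677844965323142622554588220463516964,
   6133586229191172752632612662236401985272647968743230852,
   6133212084772016041402799020085727574413431272668925332,
   6133025012562437685746211213449586072724371327190830500,
   6133025011848813839548657913014426273011625951480516020,
   6133025011492001916289414443916355738243067390041525700,
   6133025011313595954618111723806516174599336511881088468,
   3323457502452766549629358047494591648894460560936228,
   3136385292874410893345787555407865025726489664949748,
   3042849188085233023523016748560205449924523869605380,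
   3042848474461386909388731712019298555108814463438356,
   3042848117649463650146451036386477751614156183703076,
   3042847939243501978844919348984628072947181182520884,
   3042847850040521101646865468722228043851201657179716,
   2996079797645932135572180957926991209856710350999124,
   2996079786495559359768786736234450009898101200916068,
   2996079785798661562490605121081410535885589766475380,
   2996079785450212335686814397937672881387517850422916,
   2996079785275987680746544168087183025894511258635924,
   2996079785188875311738034184883317069904037328981668,
   5989236488987889273395263232696820074637957822153892,
   5989235775364043334176498734573552691686792189972164,
   5989235418552120076151236911562189236445462934851284,
   5989235240146158404906823777572967003662333525364452,
   5989235150943177527711221018588352027510654265986804,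
   2925825681399095247633434000473824762112710280548,
   2925113458155379551896560754769477672066643660564,
   2924756646232120309690161524305796993902311378724,
   2924578240270449008232750524813241143421257649972,
   2924489037289571810253146664770334863935679762244,
   2924444435799091672331403438450008817269954580308,
   2924433285426326253520322154814335394017683967844,
   2924432588528531721511912207537572738760050741108,
   2924432240079305242234790962070656424249165614980,
   2924432065854650322242018955076482755594835464084,
   2924431978742281314994734591282767567022619365284,
   2924431935186055272439151113087037065813575077812,
   1775694093584486827424822302919218483892847972,
   1597288131913185374656097957688347847272959956,
   1508085151035987399694513062102244392566788068,
   1463483660555849482593561889096373757713321972,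
   1441182915274242114357744077240334990418382852,
   1430032542591900053014151037744230338984415252,
   1429335644797368021392828042827439000702160932,
   1428987195570888748913857723231300520688750644,
   1428812970915968760784125876377807897230315588,
   1428725858546961518142037229982795355885932628,
   1428682302320918967200834181572470177713360996,
   1428660524166359282044890432014204138758869108,
   1428649635047541062259368310961205289115717764,
   1428644190446593577525529543358139381784252564,
   1428643510455112385705773944323688245033439396,
   1428643170089668715030753238892592871997706420,
   1428642999865408504824964265148801214846079172,
   1428642914711740024853791157248661415636504788,
   1428642872093367409999925982270347545397956836,
   1428642850742642727704714773752946639644922100,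
   11984954205959824709754197328122377208467951035875572,
   11984588830550491901272415204672570847095689869005076,
   11984406142845825455351172397772078964741676672749860,
   11984314798993492190843302562170208409053941424197940,
   12013134063392183125542687450244542341093002313972,
   11830446358725737204294948132408637103538680369492,
   11739102506392472696420180113194053728770630619492,
   11693430580225798903550854807287889134463669506420,
   161269223161809216748475220751053497653751972084,
   69925370828544708878349476683799906157371330964,
   24253444661870916013666445924955487881281933732,
   1417481578492481171639588320180175293369029044,
   703857732549000378698715049439751611838632388,
   351227199014828820318433381370383541665272276,
   172821237343527367839851232842220093412741604,
   83618256466329393168408533963627640636051956,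
   39016765986191476357599557665268007712068100,
   16716020704584108411923942516740242346611220,
   5565648022242047394741039184360626862428708,
   4870111357177697750221426788678268424819252,
   4521662130698425561393490673334536650101316,
   4347437475778437721803840527352915121148500,
   4260325106771195369857390839851375706247780,
   4216768880728644718796539137037199463158388,
   4194990726168959852994986286282162438148740,
   4184101607350740375749114102788911124189844,
   5850246464882816513878964910457306248214088844644,
   5849532841036960047325631083379006944412699726516,
   5849176029113702326304884544134635749325015093956,
   5848997623152031100911441975679871675678954885844,
   5848908420171153906502037846122888274935655961316,
   5848863818680673768733779841860835548290626884340,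
   4260815702180778954310771706782913714397971812,
   3548592458548506094918925312748521006612615956,
   3191780535289263893161969996388018873152049956,
   3013374573617962440393245651152344422970037044,
   2924171592740764465431660755566240968263865156,
   2879570102260626548330709582560370333410399060,
   2857269356979019180094891770704331566115459940,
   2856572459101410396650410067775913306939724660,
   2856224009874931124461581966792794416385889156,
   2856049785220011136621992316646812794856936340,
   2855962672851003894270045866959311255442035620,
   2855919116624961343618985015256497079198946228,
   2855897338470401658753183462405742042173936580,
   348446411512350911195152406954404928505778644,
   170040449841049458716570258426241480253248484,
   80837468963851484045127559547649027476558836,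
   36235978483713567234318583249289394552574980,
   13935233202106199288642968100761629187118100,
   2784860519764138271460064768382013702935588,
   2087962725232104873015950150310629823484980,
   1739513498752832684187827261683151739556932,
   1565288843832844844598177115701530210604116,
   1478176474825602492651727428199990795703396,
   1434620248783051841590875725385814552614004,
   1412842094223366975789322874630777527604356,
   1401952975405147498543450691137526213645460,
   1396508374457662746570772735422089124648100,
   1395828385722619179796566688796209644049588,
   1395488020603467039091476023571430440441028,
   1395317796363539223563341989291158351647956,
   1395232642696326883647650357640293656827108,
   1395190024323791238602177682751454773777652,
   1395168673599113875808314345959086428787972,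
   1395157956698398150066286919447169454839060,
   6401006682321249378007333304337828381933569380,
   6044194759062007176558654071983860501602899252,
   5865788797390705724098205810749916490970961220,
   5776585816513507749444896999165543475814864212,
   5731984326033369832652221910161403280511472996,
   5709683580751762464724680182307094952766608756,
   347051259124887046635749461763932259196342740,
   168645297453585594157167313235768810943813012,
   79442316576387619485724614357176358167123364,
   34840826096249702674915638058816725243139508,
   12540080814642334729240022910288959877682628,
   1389708132300273712057119577909344393500116,
   694171467235923939325426651777295610549732,
   345722240756651768631200280741292001990132,
   171497585836663947175437428979108093629956,
   84385216829421613362875035697006299321876,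
   40828990786870980435910627102267676825124,
   19050836227186132768245070566668272408116,
   8161717408966673656260181292854579041860,
   2717116461481939817492578226947247576660,
   2037127726438246176939792345664272209508,
   1696762607286123605736421340322689193588,
   1526538367358326211489681279488220993156,
   1441384700146004429685343848061146764948,
   1398766327610377518099963178659884308132,
   1377415602933032858123920605729159911092,
   1366698702217325249983788313249806554820,
   1361298713484467163138563738009645094612,
   692812996224231745103046557294412069606884,
   344363769744959575542180071696591064405748,
   170139114824971755219785175823122007332612,
   83026745817729422540590738429735064311572,
   39470519775178790746994285723711293101860,
   17692365215493944212696685076826739971892,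
   6803246397274486234079751691727897892676,
   1358645449789753528680104514535417714516,
   678656714746053087919583300963334625124,
   338291595593931650084168184336602896244,
   168067355666135389205384012216985982852,
   82913688453814740769002469504763041684,
   40295315918188962551577688818351871908,
   18944591240845435943491004602478761908,
   8227690525138961171314600837976692676,
   2827701792282007694045914312666519508,
   86169050976752075290622470296442852]

theorem certCheck_ten :
    certCheck 10 [(0, 1), (1, 2), (2, 3), (3, 4), (0, 4), (0, 5), (1, 6), (2, 7), (3, 8), (4, 9), (5, 7), (7, 9), (6, 9), (6, 8), (5, 8)] (assemble blocksTen) 384 = true := by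
  decide +kernel

/-- The blocks of the certificate for order 11. -/
def blocksEleven : List ℕ :=
  [622878433960020160419355301362741169319581744053092353,
   281658723689099574362084659325142604778086841640288260,
   281471651479521217459326591881563489784037907671023636,
   89909708871285090226113276714112306138315527516323876,
   89816172766495911110120245099827033257524573229809716,
   401735321135553945005547243694238157041235712248200751480833,
   401734554887783512061096796872792023232677753667527621214292,
   427508183460309055048740433843610882057595973154111489,
   44758442662993530344750438180418481096522894006026356,
   98122996941426176314925045938801752378425390272737181828,
   98122248652587862871363277719608747675058413470789664916,
   98121874508168706138948569643732918340144468587573149860,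
   98121687435959127762107391639515676689457039663722135732,
   42627573275765115095731504097335491973716323410641028,
   42253428856608382681347867547002087973764567804149972,
   42066356647030005840190066511201593139166071370023140,
   41972820542240806785778286545691516976803104070566132,
   41926052489846196624747836072390481885308560067264772,
   41925326020770713419935727204654035623288354164965652,
   41924960645361359426558243724791890091620475696316708,
   41924777957656671796045535705533834095330054219235636,
   41924686613804317346965215416577822866728361237938500,
   41924640941878129488601088992772834021971032504533332,
   823154014723292105876236071107120472938802561953056852193312769,
   823154013190796565010347191481125513229839412181676141692584308,
   401735297377406164517473580635285995300418828678554657488897,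
   401734531877924569886445428276392157904238161309902564229524,
   403937062217473169489891065230971177109326635074584577,
   20813177001000933637543168948619757845439387288994228,
   98099051675764183718217838669569953286239425291829117380,
   98098303386925870274656070450376948582872448489881600468,
   98097929242506713542241362374501119247958503606665085412,
   98097742170297135165400184370283877597271074682814071284,
   19338522562906410153307299447583264823969468665299396,
   18590233724592966591863519580074492366182302903960084,
   18216089305436234177175646885686313305067847104332324,
   18029017095857857335998831090882395029446900122124852,
   49057884867584407155289029860614195545218784764265235012,
   49057884136833588468569922826213125220616361971813450324,
   49057883771458179114576545342733263075084694093344801380,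
   49057883588770474426946032634714005019088403671867720308,
   49057883497426622072496952314425049007859801978886423172,
   18681627530595393142367951288716790949396122419855812,
   18681262155186059087410404872734935687148641509704356,
   18307117736029328002254763817175207878689452830229172,
   18306935048324660310161992861797442147015937487798980,
   18119862838746284798232187320770623508713499404534484,
   18119771494893950287571804095694902544728712557888228,
   18026235390104752562388019624958502578661803609293556,
   18026189718178584642443830265033803998521381010539268,
   17979421665783975810641375286506242189138084553032468,
   17979398829820891186055282859157054800919844078224164,
   3371639641469409313339040583365068037812901017185363919394034417665,
   1646308077878082682516433161364226829933220893789773148724396033,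
   803520556876640361463957539228392391831080142552160181157889,
   51918104870702138114281909224892727931815115974807388161,
   7070839132286932650630475642858584007344433771079407757556096317877388148,
   7070839132286932649864227872425639556897612324945599199285813792300073860,
   7070839132286932649481103987209167321040377635599367936920216047268660116,
   7070839132286932649289542044600931192477936324646925322506960692510196644,
   3450873173395288046290921122525664568160449894038128311467314759335937,
   3450873173395330956353503130894567289402920830933893321346140309816260,
   3087769533669187897134975802657410245951981016261328897,
   49062636125199756033295529433786194770476340061131506660,
   842909709536850252915882965362129888650973715332992241247596839924,
   842909709536850159379778176163075475682585767524418070303428576260,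
   842909709536847166224424922580237234198841634409098379776008127508,
   842909709536845669646748295714381345693014278968825339136598606884,
   1646311312019014466907207653211881530731928715220059501759561729,
   1646308173468146773566825714049521994340066698033829350745310276,
   808323973289062667773250393304345861004147222641091281944577,
   805185422421369327391311231249045613196923395099142587941988,
   803616146987522657200331041861979612070519666207141678548084,
   2501038197331235931495834033660854954602687714061601210369,
   931762763484565740515945798559563386248218236613504795796,
   147125046561230645015204491741095575907558170617202082980,
   411376286455169768569632937149108209013379089245928791550723252,
   100482690963528720712407514717989541300232769808295105922036,
   411476622021180272164489489517153057930470420789956472950752468,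
   411476622018187116811235906591291564698561886324629009169646820,
   411476622016690539134609040818155290054105279828037228716623092,
   411476622015942250296295597261254849165976995809551840787301636,
   100482688259750691650322098101373337889202724434684129837508,
   100482686763173015023456325269334837487371567628722296063268,
   100482686014884176710012768673130093413862605502543136032052,
   100482685640739757553280354269290361639321194660942398358852,
   100482685639282537659089162702214534177163470011303923287380,
   100482685638551786840402443595180133106838867588511471502692,
   100482685638186411431048450217696653244693335920633002853748,
   100482685638003723726360819704988633986637339630211525772676,
   200916316026028927724027822932266110117933873401610523115972,
   200916314529451251097161966720509379704295386405921646183844,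
   200916313781162412783718487704521369598425795877978655163828,
   200916313407017993626986077864223798645510230424509456844228,
   49059184149676232772449403427286709395465839444765966788,
   49058435860837919328892826237301639309944735716154017252,
   49058061716418762596478441412328868191974916565964424692,
   49057874644209184219637282422870629983175254166371042820,
   49057873182707546972387119176679543877093507164368012820,
   49057872456238471363868967267539288493113400299338335780,
   49057872090863062009880780813267360965427605494205253172,
   49057871908175357322250591356151161126375440805755094596,
   49057871816831504967801530050621208557034605637031429716,
   18669946935478287566701370276343941532588462304133572,
   18295802516321555152317733726010537532636706697643636,
   18108730306743178311159932690210042698038210263516804,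
   18015194201953979256748152724699966535675242964059796,
   18014828826544709004388573055305191477535123614729892,
   18014646138840021374200304361543066390434338323826356,
   18014554794987666925140187254028211014663072759416516,
   18014509123061479066777249252660954581713720894818004,
   17967741070666870234974784989582470942679856569124580,
   17967718234703785610388697204508449321381720675583732,
   17967706816722222695061720821841893031427769709364996,
   17967706103795421293599077182925411094833226029467412,
   17967705746983476849461174359699952271546477448267556,
   17967705568577493993568256668760239629446620914911028,
   17967705479374491931797831543963400077940210405476164,
   17967705434772980267088652702237997071730522908002132,
   17967705412472213800910097002048312338169196916508516,
   113133431171580921694761082621067524508089714638716280972837100882297356289,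
   113133427801587588301122764679842187247082779047022495968613936075715379201,
   55215655770991207794719249864265596222895831192903362861674101874884609,
   1684996666697495241202966049371335639026856886322676420994950758401,
   7070840817283599297345011009358897041135075607108667540249965392804448180,
   7070840817283599297153449066750660912572634296156224925836710038045984708,
   3452558170062181107892540932915492286744705413279761821431072796180481,
   3452558170061984948463310143743092427982861106504819352300336061612033,
   3452558170061978820259063778986956481182688655401997853184694743468020,
   1684996666699988538150011111293961387444840534145249635257416679425,
   1684996666696926541685847848422487309201610662893454922689274710036,
   1541055442456779475681492057383190636892565971484540929,
   11554519159405462492744166730482555101717803232659508,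
   411376139338883335367816741922279050150354939570370548656506948,
   411376139337386757691189876066390544322999499297329909246986324,
   411376139336638468852876432504622325129994795930353107299469412,
   7459391571604292448881128009963727886724355649964100,
   6711102733290848892284923265890219001388068573808772,
   6336958314134116477881083534115677590546467836135572,
   100433633916077278520190385352707524060134182946975815567524,
   100433633914615776882942343555258710722477202312314231982260,
   100433633913885026064255624448224309652152599889521780197572,
   100433633913519650654901631070740829790007068221643311548628,
   100433633913336962950214000558032810531951071931221834467556,
   8954603372189237288802938909763358542583692432246852,
   7458025695562372845217910663138626893298891838458116,
   7457294944743706064530813325948592555493005521324308,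
   6709006106430263837181618835652183230685335260236068,
   6708640731020929782224072419670327963634362926238004,
   6334496311864198697067242941672886190111271087507780,
   6334313624159531004974471986295120458437755745077588,
   6147241414581155493043478022830587855071414502558052,
   6147150070728820982383094797754866891086627655911796,
   24525982267820858255278204563950762815479092593673898372,
   24525982222148932087358260374608972004193171608695736724,
   24525935454096537478526457993907980536397374995228002724,
   24525935431260574393901871901498765236303376192373787060,
   1684996666696950206343106259615579262260036498790648201209366708628,
   1567714728790890057666772621486845502761160150452535297,
   35219187925001178451593906909857546618522109729573348,
   411577006621015073205615528596536839447215205937299039733156340,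
   411577006618021917852361967025943288261736057078521476798220804,
   411577006616525340175735101170054782434380616805480837388700180,
   411577006615777051337421657608286563241375913438504035441183268,
   200940868832589339074498348765641448732630740594107671970244,
   200940850873657230724493573223398506549843202485876212892100,
   200940847880513295452473561776177867418835107647492822403668,
   200940846383935618825607788944139367017003667414921138670180,
   200940845635646780512164232347934622943494705288741978638964,
   200940845261502361355431817944094891168953294447141240965764,
   35733624369736181462939535815616530578125631080366532,
   73592535200302606542226008496698389886833610078376954532,
   73591038634043961218100874521423279234430361048303274676,
   73590290345205647774544297331438209148909257319691324100,
   73589916200786491042129912506465438030939438169501731540,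
   73589729128576912665288753517007199822139775769908349668,
   73589727671357018495364834373738390007562560609478249204,
   73589726940606199808645727339337319682960137817026464516,
   73589726575230790454652349855857457537428469938557815572,
   73589726392543085767021837147838199481432179517080734500,
   73589726301199233412572756827549243470203577824099437364,
   1567714683118974780195199007486415948619349512987607041,
   35219142253085900896579965135092791375006757809032020,
   411376237445197269166144440714229207907367487765973462714157924,
   411376237442204113812890879143635656721888338907195899779222388,
   411376237440707536136264013287747150894532898634155260369701764,
   411376237439959247297950569725978931701528195267178458422184852,
   122635198561182523668626859486003149275943179812083859908,
   122632205405829270107294501850661704745772831293813296052,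
   122630708828152643241521669812161302914332598722129562564,
   122629960539314329797965073607417229405370472542969531348,
   122629586394895173065550669767685454863959630942231858148,
   13482030214273314071290150132474383686124367114510775793173971075073,
   13480384709717525454736013176825959656575968623225539982278869909505,
   411376142205557402505633340070423681524897685964209398974775297,
   7070839132698308740929900796075093944645120957174047059376223080686816292,
   7070839132698308740163653025642149494198299511040238501105940555109502004,
   7070839132698308739972091083033913344368210267529141920231772235865525316,
   3450873173395288058263930735849576820878008878619147612505929955672065,
   3450873584771421641894235415493077453239806565723268038075549498739812,
   3099742543282511809548654485336687037125537974003433473,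
   411376139748176857484354543459366319520984145193069470320430212,
   842909709488205492137628821576654387910462818195649893519030488212,
   842909709488205445369576426945225709527430863341671438600218086564,
   842909709488202452214223173383655115976245384192812661037283151028,
   842909709488200955636546546517799227470418028752539620397873630404,
   1232715123727331534833822895273450435178002356392427521,
   411376139796774711267623294959430436082204642989875435616079076,
   411376139796590562061319577714656943085522056649445881387420916,
   411376139748700076498463490030029543144369995971946472528677732,
   411376139745706921145209928371815982471115538647996415490395412,
   411376139744210343468583062598679707826658932151404635037371684,
   411376139743462054630269619041779266938530648132919247108050228,
   415779555025624343878625791110442725848536049165273764,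
   414282977348997478105793752610040894763787612649950548,
   413534688510684034549197547865967385801661433489919332,
   413160544091527302134793708134192844390819832752246132,
   100433657802848621771825649476906269259895554045925766729092,
   100458177637966371204358999389569584189900555353247907319188,
   100458177636504869567132225238715699175738262196021204356516,
   100458177635774118748445506131681298105413659773228752571828,
   100458177635408743339091512754197818243268128105350283922884,
   100458177635226055634403882241489798985212131814928806841812,
   200867288188133509502616738600104347022885549787836771732132,
   200867286691555832875750965768065846621054465039400256409076,
   200867285943266994562307409171861102547545502913221096377860,
   200867285569122575405574994768021370773004092071620358704660,
   31346254258011361277698447902884336332110102273198756,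
   30597965419697917721121257917814251171294000253505076,
   30223821000541185306736432945043133201474850063912516,
   30036748790962808465577443486804924401812450470530644,
   24549871870822138421173987775722708081275290736498052708,
   24549870409321198093567535321019402813651139094167686772,
   24549869678570379406931503768704289521322546819989769860,
   24549869313194970052943317314432361993636752014856687252,
   24549869130507265365313127857316162154584587326406528676,
   24549869039163413010864066551786209585243752157682863796,
   24549868993491486823005702425362403821635743733148290756,
   7067388259133222505541106659978826473362306944711987490252614237256941569,
   7067388259133223094019768565407193981078000324078039159179715187166937089,
   84808659112878931219747177318113319996364401722011971399276640275812843521,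
   52675831609968166528963397117465513690897523351125041436976742401,
   28269553039970632673087644381826165915908366322823657375719631175331876628,
   28269553039970632666957662218362610478487294226867673004086509432046882596,
   28269553039957777162603590296158274762259128667850439100083241031757205300,
   28269553039951349410426554335056106892622116084881696321647196895930486596,
   28269553039951348625788837411721011369283914323021170503027133348674801492,
   56539106076405096949631373484590389846882481279349291449118915365246599169,
   113133433751732067574030203440910160664903121779050120708754749300229013505,
   55235033245513726474715724217347475362642759614990580607969176099749889,
   55329445714994587992592281170516978077460868750055063775368865420148737,
   55221605928325985436406768463422632595771327611991637008299266336100260,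
   27620468857193799801267446952329186333500447606032967333826405800607745,
   13483482887049005975221323721333806644710701342678013236398968012801,
   53923402887774965668683347989172887925437544155256925198987379605505,
   7638650699444082208484479611400116562247322590360712106096808955876,
   7585994654043437367633119326329203499640386244213143302203268665332,
   28269560622435947812416055722801686862227392444024165872800359253143457796,
   5971382557104687157763257483259295938167633671165316191474417665,
   4325877999786567807780303440116038990146997215289580835069493249,
   3503125721509135462818799106885728425076281015232701723815444481,
   28269553882449281024756107056047915086932320419387640662637426553209753668,
   28269553882449280264638318786567041297327671017654525835477554867578343508,
   28269553882449280264255194901350569081408856339359568410194512309260390500,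
   3318025760515166105725639983681159197774037037188993313827454977,
   3317222291493036656259795126241425266643937672818375989503459329,
   3316820556981971931538023090283735388711734637941641428635484161,
   845995130990922434889463872915898161711154113005494728320143593636,
   28269606956355216963950908107132146873654759212333874382165631042345500673,
   28269606956348789211773872146029979004017746629365131604046585995230974148,
   3452558183320002318246780131509283275256412012778415568939179719000065,
   1685009924720424529767932592112402086426155474506539313950488526849,
   53919906592324789133397489932818068493850764701427274512312755552257,
   28269613696334653315055536340818286525153806238823441469209986338051330308,
   28269606956347986527395587674064514749858734214186916554190736692819792132,
   28269606956347985742757870750818622207314654944892533534878512421400482084,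
   113078212988318145102907574584285919551698723922622638630315234892869271553,
   1887196269915205904669105952641823613927371947804522883330209990311937,
   1780198981579951802984021236515213130331157050838093522154572320084308,
   28271333235435828898645721950534559004202443571303144739733094219486597476,
   28271333235435828898262598065318086788283628893008187314450051661168644468,
   1780199212978269675366466217211792768499337929183730750600834638151681,
   1780199187367694594988808700761770592603077925573671593536270455804308,
   1726279294033393315399474670587712711073331653785184369114842366218660,
   1726279290819517226881494119503743343629680755722045270596625883992500,
   1726279290819517226516118710171012746150454984334106304542441387069892,
   1726279290819517226329046500592635904972450767092455617113517536055764,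
   1726279290819517223335891147339031799083034464305373836510025630093796,
   3310593672061730305558032028905675191855621812309647470183317505,
   3297738167707659844855333641802539413064681155518632407883321860,
   3291310415530623883753165772331373558413939826387912954345427476,
   226180580403850175821030922131455331889576904443525696014915982255870443521,
   226173678657509813009420523748277863207082718771031654103671876880436297729,
   226170227784336417727526853138399119281920647738675299977002533671380451329,
   13803492703223540866271082483813459407655627032840876653434206810013697,
   28283356529157673330444612731712078259798286013489900694496360891822379620,
   28283356529157673330061488846495606043879471260917407525687869050996134516,
   13803492703524056728728834608909879249020949920186917652906369921056769,
   9942929153859322884355807076470799417192196595966425108054017,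
   3515176976823361782187937439153980014252299359194348518380196,
   301300888305381231103991987127958684750917121330082770588340,
   842498634649345433589165992730753107284074125758273052237441798852,
   6830271336997835387471485465283800125649521475393402002475060,
   28283356529148233353695357584788775294386766560440281981007698963662377700,
   28283356529148232569057640661453679771048564798579756162387635416406692596,
   842501548009578032575917398740748579293350975508450252548510779444,
   28283357371649378083995640016939996604071126310984299843827372242158752532,
   28283357371649378083612516131723524388152311632689342418544329683840799524,
   13804335195228810279756119836828222641617004483886755581156647907627172,
   12955937986985233808180773854005469374699542761351009415462913,
   842501647682704886608112274150469066853980892034465634723566719828,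
   842704121876281519382830561331490873023903358508015976224813749092,
   842704121876281145238411404616433994331350455120581012552047137652,
   842704121876280966935211650225010344564001213209479468088049013636,
   842704121876277973779858396620826570694820403436569746045561475988,
   842704121876276477202181769755048566641871070429171406924799808420,
   6729053065715486652031684257507440638647376607776105394536449,
   301300888679525549863814865420403180092897391669446150460356,
   13810235971357463509021129259448739454000851824402046133539350615558116,
   6743277776335935648195579483808525690873633683648493647137549191156,
   3291109548276073684752096822082202096261853374367378755940257956,
   113133434541574255873226950300172695848042999178984414451399899626532241409,
   113133432856577589176312009901893459420936970886265275039421635889396187137,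
   55220710760992082984713126129260526426165503776157222558166693497012225,
   6739986667572686731656907671146127149272708841656185041261496893441,
   28283363269134497622584410444076047274758015160128496257435141358436226116,
   28283363269134497622201286558859575058839200407556003088626649517609981012,
   13810232680348348868526546972878894208750096558783034589949769752252580,
   6739986767221293657035248324822036199946055788313393679711467475108,
   100433633708368494553045860883604211028730240876552230277972,
   205788503298484979344767457190521329856514603714397574832067732,
   205788503298297907135189080436982349886051906294092480147100836,
   205788527821228485352488573747496873684238665341515158076265652,
   205788527819731907675861707974360599039782058844923377623241924,
   205788527818983618837548264417460158151653774826437989693920468,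
   205788527818982161617654051958245149765533334102762138698257636,
   205788527818981430866835365239138115364463009500339346246472948,
   205788527818981065491426011245760631884600863968671467777824004,
   100433639133645260029977244607887378680052878604148990281796,
   411476597486379427591307465803285230573358286796607825757869348,
   411476597484882849914680600264106550707023698640247588889040180,
   411476597484134561076367156717245902572702991481616090346296644,
   100458154955483795095015781887875581468352956714212691809572,
   100458154207194956781572225291670837394844071377925615654244,
   100458153833050537624839810887831105620302660536324877981044,
   100458153831589035987571293152711391893942328710234291312004,
   100458153830858285168884657102144317777226559095509565314452,
   100458153830492909759530668896675286846275432278253884151204,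
   100458153830310222054843038688203411643012939091114885911988,
   7439033310515534465491482804853516955925969663690820,
   24526628171617990888349444777755478002469379728156399060,
   24526254027198834155935059952782706884499560577966806500,
   24526066954989255779093900963324468675699898178373424628,
   24526065493487618531843737717423524840112638473138083332,
   24526064762736799845207706165108411547784046198960166420,
   24526064397361390491219519710836484020098251393827083812,
   24526064214673685803589330253720284181046086705376925236,
   24526064123329833449140268948190331611705251536653260356,
   24525970587225741149702537982992792679409355447864399444,
   24525923819173346539541507606797027535417262776045803108,
   24525923773501420392889211275718221059772586035424269940,
   24525923750665457288326205320504527325645200171323102852,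
   24525923739247475725410878339479584109402056145301935764,
   24525923738533852025721961613867492699361313600822056612,
   24525923738177040081277823711044267240538026852240856756,
   24525923737998634098421930793353327527895926995707500228,
   24525923737909431096360160368228530688344420585198065364,
   24525923737864829584695451189386805285338210897700591332,
   6053613966636521544652203841490083191465638833949060,
   6053568294710353624708014499699271905544653855790852,
   6006800242315744792905559503033598497549040290371348,
   6006777406352660168319467093818298403550237436155684,
   98109657828125361310722938049350691585025689907698339364,
   29943212708474354609695098240395527324924629402783332,
   29941754062029412326547681925108259942424338288875348,
   29941024738458418396477199090721067551864759604221796,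
   29940659363049064408291933241231253831133857630394228,
   29940476675344376778103664547469128744033072339490692,
   29940385331492022329043547439954273368261806775080852,
   29940339659565834470680609438587016935312454910482340,
   908610672579049853336182242735304328592507657730163559370916,
   14141678264574770721615383426027022860420411995269648234639069800653920196,
   14141678264574769152339949579356831880205408260794390242589295720159778772,
   14141678264574769152148387636748595729046091021498377788811320340635457508,
   6901746347694515482007630805247710973931822279924102628195165859350516,
   903951694572874942970664253832780749099767995229923441643684,
   14141678266219370591648976862973009426216857057320913375982674434060258340,
   14141678264573866034327770820818040223272102936987835872890547563946642468,
   14141678277737902492705857215471858277764581940752351673569569309081999412,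
   6901759510827856039477209528510258817716844268480139721638019063681188,
   13164037292252042453666233212097617802737655805165764626387899220,
   842909710321470189210309443498031731090834252887943988771397048420,
   842909809970460238473866569345995759564310609702621676616392120436,
   842909809970460060170666814972301038405982723144070144753813952644,
   842909809970459966634562025773246625437594775335495973809645688980,
   842909809970456973479208772190408383953850642220176283282225240228,
   842909809970455476901532145324552495448023286779903242642815719604,
   14141681634567199427963938345071749681804014725223511697106865341693171748,
   6905116340124791300551494503956098106867295683996935151302163182981268,
   3369993334227513116738641679051386768254153172600509913544988299428,
   833683142405264793152665286116951465834933156531143709524,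
   49045425481929697630656290736441635141305490784295852292,
   100482673004596612340645055096421887650406236598620482705684,
   411476622003221340056117727057531490276820594180748554615658788,
   411476622000228184702864144131669997044918128694221341277034804,
   411476621998731607026237278358533722400461522197629560824011076,
   411476621997983318187923834801633281512333238179144172894689620,
   100482670300818583278559638479805684245371513616314506679476,
   100482668804240906651693865647767183843540150244759565244788,
   100482668055952068338250309051562439770031188118580405213572,
   100482667681807649181517894647722707995489777276979667540372,
   100482667680350429287326703080646880527336860803385588193700,
   100482667679619678468639983973612479457012258380593136409012,
   100482667679254303059285990596128999594866726712714667760068,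
   100482667679071615354598360083420980336810730422293190678996,
   200916304053411807602721594679571104443566731887790028494116,
   200916302556834130975856133404358875134816521368465388345844,
   200916301808545292662412591430503804693933705506757702326788,
   200916301434400873505680177654151120032365848406025051314708,
   49047211532556111466460623795882729367491818205519811876,
   49046463243717798022904046605897659282124347862267468340,
   49046089099298641290489661780924888164154528712077875780,
   49045902027089062913648502791466649955354866312484493908,
   49045900565587425666398339545275563849273119310481463908,
   49045899834836606979762307992960450556944527036303546996,
   49045899469461197625774121538688523029258732231170464388,
   49045899286773492938143932081572323190206567542720305812,
   49045899195429640583694870776042370620865732373996640932,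
   6699517786069899814419401224755079792748214076052948,
   6325373366913167400035764674421675788292927561669316,
   6138301157334790558877963638621180953694431127542484,
   6044765052545591504466183673111104791331463828085476,
   6043303550908365521944928218632647392921133572430580,
   6042572800089678885914564325957069029392762553768708,
   6042207424680324897729298476467255308661860579941140,
   6042024736975637267541029782705130221561075289037604,
   6041933393123282818480912675190274845789809724627764,
   6041887721197094960117974673823018412840457860029252,
   5995119669499384415769601668467912843899285122587476,
   5995096833536299791183509241118725455681044647779172,
   5995085415554736875856528216176855824854399423880052,
   5995084701931037978569400744553792412054789112732548,
   5995084345119093617508168429723079827662461964655508,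
   5995084166713110766807468369155698996499581926120356,
   5995084077510108705361482569854790354182807602863028,
   5995084032908597040672506909570543200803547522276292,
   5995084010607830574495139631818590879050198399589332,
   5995083999457436707581895502392190489282773192285156,
   1646308249322747049975588181301878412473481203687020404089552897,
   803692001541007909821959151246784706547717317121086744166401,
   3371638838176428868935444049198524188888660528096021283815655735297,
   1645504783365703634979196702833158916277150890763668713239478273,
   226044497592824227499008160478735761077116975490277572609,
   401959076943595885790555407734999474684509524189482488699972,
   401958310695825452846104960913553340875951253906956911385684,
   1645505567620296764263266339310437463045891906245525898035986433,
   1010299090722108297135485439025504502166384489555957907457,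
   231791355962236757067923768341305304523563245279697181828,
   822752508973340238806919246600313715727097628749307260590627988,
   230312737217907840596522479833017750690616638558409071764,
   229929613332691368360665245143671519354464328401330117812,
   3371639641448716133757974418197761568401929192413388409438848679937,
   1646308056419964470930469647293388110696222315013571039128977409,
   803499098758428864703424262512165720975374456943496609660929,
   30459752818943404636538280408648637620841876355075276801,
   421249166703156005531965236180466667615002093820379128139707587844,
   421454854772054908516801662877839516170413564959278107000208104724,
   421454904994669526684853423166908401608437847281730917829929082148,
   421454904994477964742245187038345961485907842399729470452039425332,
   3535419987598371288461439192236312660897496962722425560999182985119931716,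
   3535419987598371285396448110504534922913154980505428429961200028267584852,
   3535419987598371285395699821666221477319147499418163723316620813694672228,
   3535419987598371285395325677247064744904439423542334388402675930478157172,
   3535419987598371285395138605037486368063261419325092737715247006627143044,
   3535419987598371285395045068932697169008848450937144929141076062458879380,
   6901746347606709807609169693958617021316367860678753076652967828914177,
   6901746347594155604138396332431009245413750203808448339375254718651828,
   6901746347594155412576453724194794283152713231834095178660981737790916,
   1685819426825263190144299343921925846854209374317804841458990055425,
   822763266899818959968089355606886839825420718312700101568495617,
   10988239590083309761454207623798092574205935037080639897601,
   14134776518227886077976875160321607334363347733725569405921139920439614980,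
   14134776518227884508701441313651416354148343999250311413871365839945473556,
   14134776518227884508509879371043180202989026759954298960093390460421152292,
   822423122658820280157702134180885111776951726670536883830785,
   1725436587520066997013439940687946615194926820829395640941326545985092,
   1725436587507512793542666846769325091726107758521480661268322183028308,
   1725436587501235691807280166005468034654967533451301164446451405692516,
   50037661014237079923856592866128756412651583235175363061756496811393025,
   22430675627074824774491713836177365300923612086765291438398965548056577,
   8627182933493697391185720412810989484287817656361938589525322459250689,
   14143403701160565318106341302286885843400089315300956174092648846938087076,
   14143403701160563748830907455616694863185085580825698182042874766443945652,
   8627182933489112167520605740224336777863607771568632487367790411382785,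
   8627182933489112023852071787321810439594819524474089206960466093416148,
   13481824532479603856463082858502086171698922269300271450552850714772,
   56539106091214546947155568259731597842524423208555597024825044380066775041,
   56539106087923537832704718974389835762467293500325496154734346805808463873,
   15015239286039198950973255244296470564031138777865993835345084417,
   1851202827472543769086755430478851805589346830995332269190684452,
   14134776520078274448187699350960830304333073240007679048852059303990796084,
   421249175308558367794754678995070800425407531536162216331298479620,
   14134776939681936568214107978568315957963403087228856675291722401230888788,
   14136502376268634208969407647928923724967492572551641971872864008638832484,
   1725436586711080990936735991478487669994978731129978140155516220866561,
   1725858041559572303027641985575706020631516118786346294331458123210628,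
   1725858041553295201292255304811848963560375893716111457277366217219988,
   1725858041552510563575331969716305686938677259452070152899398789504932,
   1725858041552507498584250237938651438417946286869156415841087475687348,
   1725858041552507497835961399625205672719892663493845340153888749133764,
   1725858041552507497461816980468473258011816787664510426209005532618708,
   1725858041552507497274744770890096416833812570422859738780081681604580,
   3451294628250056494681590097495365581244444075248474544795341912276993,
   3451294628300267178582520080050724801481659598609709364621710059380740,
   7067388680568442306872737447364816458512901037188455191344239741607353636,
   7067388680568442306681175504756580329950460914658450309342792363717697572,
   421454904988347985501784906373056649447469541944696042151623007556,
   421454904985285987575406382324248788607147672521728418145199202372,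
   1725858041602626232097975533638135720217072803224176796485178650271828,
   1725858041602626231723831114481403305510185349832611187836419721666660,
   1725858041602626231536758904903026465017900897285787189754982671851636,
   1725858041602626231443222800113827410606120931775711027392015372394628,
   1725858041602626228450067446860244572364637187641913178170760698536084,
   809868728372931914330571625482748598263342207954797210042369,
   803591626639006735552494692941305922634900165089844949688500,
   14141678264573865332253670109280355233503636675353679231522279396342759425,
   6901747992307804616425093959126283427680420130027254388401135806316545,
   6901746346803247295219051893403617420014672486418518814026951346356225,
   6901746346790696161977393555404410366959819822293406382794569455509748,
   6403341431983461298542280877493914000219747706816215121921,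
   132374916782112284074793920921608644477159983220605853972,
   200999301204990042095607140348188795093646602951378571632932,
   200999109643047433859478753755373748586254319215091882402100,
   200999108894758595546118053111948824209785205301326799446340,
   200999108520614176389385638403872948380450291356443582931284,
   411377025172031172145479745399844424260558714011997666359115777,
   411376265054243039858877595902641631366341867354128508085346676,
   411376265053494751020564212605421137215056102305689723928060292,
   6901746346804221390877430734791453492622256258765021602057913742917633,
   6901746346791667187406657373263845716719638601894716873521313495392676,
   7380503578124478500001667408114445955407982346415817031681,
   1103401842737797736144688221427098907772505195750685155780,
   910307404588695739905136676280140418934149010524137848833,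
   125669687665539137522134051052904618817746425223157129700,
   125723193240481821896578679895619184399557000715704476148,
   131852988331735798953170890000003179428004296059459215876,
   50220128901471160270822466682606509181782900657651594559489,
   50250587250345869811862400411018128001299398708807395713572,
   50250587156809765022683284417991156066731701819798304334388,
   421454904988351072193242949239942011172315941283365886447601066564,
   421454904988348079037889695549436302034635897610158000068344422996,
   421454904985283087956157917812859072491797288434917941407548187236,
   421454904985281591378481290966941603927385946235522182703215551092,
   6901759510842249234086643028095559964180020772412874122547313701289985,
   6901759510840679958652796357904579749176286297154882520126297323086484,
   6901761362033110977144669447022810237399274965797850166646244438449956,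
   434413218041107890485231598480171307381546537758165915227878588417,
   6902180965695227884685418964164341974374430213105066770712848482968260,
   6902180965695227693123476355928190815057190917092594545993395249095380,
   3542321747109148973603156084501476165443116075611379516040773756538331876,
   1685819435649133997383142639406491929448577492271150786273348681729,
   822775229320747065171815562637628895329770949000302881651294209,
   13164059409229792381334127966693075630264959305259774234172850177,
   14809560950599773999419823921740108314574476091781435279910380324,
   13164056393278942101773214410736536830124720095238816943941100324,
   5964972851786563259696668292756416960573886316640202511629680641,
   2673964521782803482706120690973442327481728596187369452035112961,
   1851212243122200461628636097036311083420528935789651841937047553,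
   434618910818599389548563937072536966874797263235421868893550944964,
   434618910941013457185933316968398374100600791311118855761692730244,
   434618898386809986412571789404409110890968122286507916829136003988,
   3535420000762358409821707639345706497253841181985020596014303264770106276,
   3535420000762358409820959350507393050153372654013717510890723798552683444,
   3535420000762358409820585206088236317738664578137888175976778915336168388,
   3535420000762358409820398133878657940897486573920646525289349991485154260,
   226168502387245042553354417358587494608059676708293408070687504425323331585,
   226168502360916969636215120684107987685812840632784718348107582138028663796,
   226168502360904114131861048761903651987744883336179624851253512735065908228,
   226161600614557330629813162192848250383032487906066863035057193144445566977,
   226161600614557324352711426806167486545913837891037968792669719557076689956,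
   226178855006752372894681311285807711578580206873415922650477348407079862273,
   226178854980424299977542014611328204656333370797907232927897425089009820740,
   6955666252981181645184845519749504265481714709674043474580532337049601,
   226192658459966700963124273318997822895075485227641315825475148700300878948,
   226165051474579538707974534295548714792816697113175732137838918487132611684,
   226165051487730719662190110710584132555207543856432525529160263726330291332,
   226158149728219949109228717443754754857667543953768828541750834874582827009,
   226158149741383979315216559048167966214741250413006768162331826148940457124,
   226158149741383979312151567966436188496695328362921233811510076402035598516,
   220855883920452250535746059883938533607555843507867270970747470633636052,
   220855896261736431211506918614624331398455988524500976156291006355996673,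
   220855896261736430445259148181679881112354880288308770991114451791389924,
   3450873996148567794406350091649962720079555938799687593809806781062276,
   822753285900688972160511429606450386102452214750686636395207812,
   220855883920051325566105618887487364298170580247600173628120704125773076,
   13164037465043533286120636398821080994242040559043406292270972929,
   220855896261335505475197703280556762852999271361739164358475364825048372,
   220855896261335505092073818064084526995764582015507846652645398664979780,
   220855896261385501418160969430435717003970523673665250302612528419569665,
   220855896261385525746527680676421322175082835548607306517144949211800932,
   1725449750785125495474182049125877044139767400046564193638265549497716,
   3535420000556720458890070609372034832381201021030607021287734249236997508,
   3535420000762408528554847220222249247786162946700057438883282973226968468,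
   3535420000762408528554660148012670870945670662247510614885201536177153444,
   3535420000762408528554566611907881671891258882282000538722838568877696436,
   6901746346803436754095959791483641210992981447026786576052664087347201,
   6901746346803240594713519857261329289265769054857449662656877395181569,
   6902180965732890306391570639855897521231412420734380824686669841049060,
   14134776531391119260373392658960502883966443045825764435885066741604155393,
   14134776531391117691097958812290311903751439311350506444147537736421615108,
   66025879778361675417585879689834410241678324814534680869600231425,
   15015238501404334878834229687136160212623549741760046308944520740,
   14134776533242310122119490460708304518638051825167323197956380683251230260,
   434413210979371291026411809087482424318593306326515554349085622273,
   14134776952845972239027031210225446050375026980414631465957305494329632340,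
   14134776952845972238835469267617209899215709741118618956839097893676656228,
   434632017406834121078534265492292952783797552512408088420808654849,
   434632004975230293574443846488052641733126976838717556070368159364,
   434619149470876224575242785433181327714480288692237210642509997716,
   434619143193774489188562021596062677699451394430943023021354395300,
   1725871205840834720599588689277405325321948723133057014518648134444724,
   1725871205840834720225444270120672910613872847303722100573764917929668,
   8627183344877805509406379299311809308745079203410577439160599231594497,
   8627617963806670583364697934589093950151744250873259645356307368650468,
   14134776559364691830850831000676241733772350956663393044924869627676393473,
   14134776559364688692299963307335859881009811146291062766557835009610229508,
   14134776979174047509890538646039374898311721798193001126105223109273452545,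
   14134776979174045940618097954722437672483258139830214880105862526693025572,
   93793779505855286806295498865175210012011842290294531287013130241,
   92148274948534080809812455828106432230701401184959004942369030145,
   40109243540070813606662937886749470344871975410108609162422265684,
   461358397660096089624973520947194584121736825620887706594706466660,
   1725871617022383903651639459583264030209970080139513847788809751635828,
   1725871617016106801916252778819425583017679031024224785885688826439556,
   1725871617016106801167963940505978482549151059719959070685505197713300,
   434618942326525130197693664584727627418859472735043826831311512484,
   1725871205639967471240597820920394870211749195624587067013247538309044,
   1725871205639967470866453401763662455807909463850045656171646800635844,
   1725871205639967470679381192185285614629905246608155161069764725450708,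
   1725871205639869391619518508822637722383186939615216464595396829652356,
   1725871205639869391245374089665905307676299486223650855946637901047796,
   1725871205639869391058301880087528467184015033676826857865200851232772,
   1725871205639869390964765775298329412772235068166750695502233551775764,
   1725871205639869387971610422044746574530751324033008186513200006572068,
   434618948514742311286362453012496213919911007549925776446555750401,
   434618942237640575899681689155517027232563959914448625798868904004,
   434618942231510593736218133741944177286452332212353532223523137620,
   434618942228445602654486356004037719752471082311529842533318273124,
   434618942228442609499133102334721774094471670171908167599899289716,
   434618942228441112921456475468943770041522337164509828479137622148,
   421454905769871464584216721992533537777581988488805369560339327124,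
   421454904985233747660881626467866797611359847875400288975176345764,
   421454904985233700892829231833779665919994229794631854494506297524,
   421454904985233699435609337706391042641842720847873485032288954564,
   421454904985233698704858519019671935607441650523271062239837169876,
   205688099360902497885790601035957821513861317185977290024029220,
   7067388259319275634178728505445669519981124531813334791106352852100983028,
   7067388259319275633987166562837433391419597117715494252720727174228748548,
   35304924874613832927407995164360084351993477517795131393,
   205738315653976559865759434535521202494067102778901837823093028,
   1726279290769301993340673447047084072507389878735803811819653692401972,
   1726279290769300460845132581158204446512434812047856392575819023657284,
   1726279290769300460470988162001469833411602830089201050918808967981396,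
   1726279290769300460283915952423092992233598612847550363489885116967268,
   1726279290769300460190379847633893937820630224899741789318940948703604,
   1726279290769300457197224494380311099579146480766626469628413528254852,
   407228753579883713099739697996201821302057928740386102050817,
   5494242515227844878484271022867620945542231255396973019137,
   14141678264573869248020539412251421367780383132841450603318813207441713588,
   14141678264573869247828977469643185216621065893545438149540837827917392324,
   6901746346794611165592081268352064981285985078368387171362414632370177,
   4047379653903082701862849427516816245526549266663377731585,
   908828786209742319923686437893104762727604876879724554740,
   124191069286407224401678072599897546743863104887856310788,
   842498333471116070251888831715694759833047320946092389205309139476,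
   842498333471115696107469674981070929626192071185662548497709148708,
   842498333471115509035260096604229751621974829534975119573858134580,
   1684996666696974011170500669795674569360213381915527427271046466692,
   24578952657666448569430065150363819834198568140839849108,
   842704071659515108879728251342549204140672934531156936263560342116,
   842704071659514921807518672965796978367514282419438074653905529460,
   842704071659514828271413883766742566587548772343275711686606072452,
   842704071659511835116060630183826440650926616592167134829732702868,
   842704071659510338538384003318048436597977283584768795708971035300,
   205738312587585362420610975250046146707646412913371007503311428,
   205738312586088784743984129332577582296304213593610546882554564,
   205738311053593243878095251040678392034858208446080903640263380,
   205738311052844955039781827417330114257866745956386036769630948,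
   1698167131692306077487895321158759467896262518376926809272311873537,
   55219881426695192715987490412476926424667533729584046342725904752454404,
   55216511433361798886013157035591048521849650509706600574446230062508804,
   55216498269325340316366282011447217021562909001513217173541642294012708,
   277903130244989581180330617463453834028437140915448300193397816100388865,
   277903972743322928105328659941786423770768510672124756009402547659877188,
   3590742219202793546074014396838033351668726121020654460941325787294870356,
   3590634379416124943514835728777685271816803576676182313041813750194121572,
   3535581325823469988596629177622495056246379828645595190836921853760503809,
   3535474328535134734494947015909643107646504473996316626916520032220490628,
   3535420408641800433215357681879469047195393720026840012185346379162332052,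
   3535420408641800433215170609669890620292535554559241919350873656730332068,
   3535420408641800433215077073565101421238122586171294110776702712562068404,
   3535420408641800433214702929145944752626358307971426675245496722802092996,
   13506918521727429497841028243209137369811713735252408810692256211124,
   1739759675479799694556361861801654468590556162433771090322020868565988,
   40109224610685235520842369870854337847791490382317669018245276564,
   13781151693545938846362862928670091994599254928261904568421460996,
   1726279702146224380645704436174834480915536257061689678564088574127124,
   1726279702146224380458632226596430174933299133033288634858801231572004,
   1726279702146224380365096121807231120520330745085480060687857063308340,
   14136669611982117276384443864186576290344345865052636644981945514729668609,
   14136667926985450579469458160159757879615491853106883545693880943545155585,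
   14136560087198781976910279492099409848845116973424795362620252203214974052,
   14136506167305447675630690158069235788328325455211685450933538165571464308,
   14136506167305446204434970926815931716999639711961475647943969174960745604,
   14136506167305446204243408984207695565840322472665463194165993795436424340,
   1729649078371567577028978264347547768163273447015613263757000458633217,
   1729649078365290475293591583583690353496787288898314476033600520203444,
   823159701801336767640762124645955221146129058375731450112638977,
   407423141107913829547680021559905125019890554899493710462977,
   11965731778644285278337201682277312453538915451082573348865,
   14134776518227085155722368072829544195258591433560787254217154535921560820,
   842704031618608130154865498192596227700352618932565502430906749540,
   14134777360931106377688577798178226215165126110648876767167366711496158484,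
   842704031741022197792234878196212722594222110843695972048545251329,
   1726279290723104867324017522958257319732860304872274655893789407718708,
   1726279290719966316456324182576318162241102217886676365750006923144516,
   1726279290719966316269251972997916514714856663689781321985881917107540,
   1726279290770085050531266107010846562898944990556674822918076186497460,
   1726279290770085050437730002221647508487165025046598660573663161494900,
   1726279290770085050063585583064978896722886825178831087974346629590404,
   1726279290770085047070430229811353523185537963737653719249374271253908,
   6901746552532797984200834685511618391604764834043435211971086984937473,
   205742234198262656499861416420385663869010341811916198328139777,
   205739193727109578576366412191606000606521240583891219985214916,
   843115448681514717600249751775547505796949186075294241685167418836,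
   617115234977602940448624833616219516873706023227657046979652196,
   843115448583435002987688057103925266288068959151458236877874671092,
   3370199072587557270984162830666487245390721062006956494101169579492,
   6901746346806575304214998650403193274589629656277366745713350085181441,
   6901746346806379144832535869023869315273128637443800966827615951257601,
   6901746552532896064102522311976908899344574112418871638195948837940788,
   9538257158239895153596195137039354027492588804247443734529,
   205742332278164344126326706928125473147385944123729734745992788,
   205739193727296650785944767765765936755523871144862317114568292,
   842704072444105075618713279235733614961050705789428541405817475972,
   842704072444104701477149314850821224526940583154865155988427648644,
   842704072444101708321796061225369802725201119563068473571131010708,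
   842704072444100211744119434359591798672251786555670134450369343140,
   205739097177458568156042016793408220982149365059733043150061569,
   205739095644963027290153137172281039578062634712803246253027012,
   205739095643466449613526312517592629420497982429466092387708628,
   205739095642718160775212868960692188532369698410980704458387172,
   205738311005001238867365042316131611848707842129554493150342900,
   205738311004954470814970408228999920483089761361120012480294660,
   205738311004953009313333203515121306877489109072276377790590740,
   205738311004952278562514516878766503659317618246302444295302948,
   205738311004951913187105162890256798484331892063125979844849460,
   842909709514665118572609164778281964606149415596820843840396077348,
   842909709513132623031743275898671781871507978740814552046970613588,
   842909709512366375261310331448224960430016445385204677773393669988,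
   842909709512366188189100753069175005081237249925795341898366332788,
   842909709512366094652995963870120592112849302117221170954198069124,
   842909709512363101497642710287282350629105169001901480426777620372,
   842909709512361604919966083421426462123277813561628439787368099748,
   411426356203398794260426715388714695156684596848694527438883316,
   411426380723233912009859250067855349596121477032920143564386244,
   411426380720240758084550258223940537315613215501068905443504084,
   411426380718744180407923392450804262671156609004477124990480356,
   411426380717995891569609948893903821783028324985991737061158900,
   50242155064584721282217203843894062611079907785950981268036,
   50242154316295882968793580495616285619617570615337115725844,
   50241388068525450024344463206397438506578387067123425882148,
   50241387694381030867631986918262978690484350404175286251572,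
   13481207467485968114116905451497477959193785166747389485781422702593,
   13480384715207307511095827966903716680165581549587494221251762716673,
   411381631987613785156386502452033363855315432018981101388169217,
   14141678264985246954849509873624884147226452339224354521035850562692722804,
   6901746758172318186124485250399444730399471743873228075237064651571201,
   411381754398689729388122398010300430213048893776121627294040065,
   411378615847822036047740458521153245570204708351069042334773412,
   411377046572388189377549478472281459927572927099423396562219188,
   842909710395029697623515467229422353804880813467533355247268278468,
   842909760513763956714646205497664701485838015943039190737956640884,
   842909760513763866101544690960416126113242171299442867082538004708,
   842909760513766859256897944755925370671979856634170951526492680436,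
   842909760513765362679221317889986425698825547621958590966776475908,
   1691880364795966674667159852060075753060411739400301456980,
   122604930949296483686857532551676490252223344363103596836,
   50241339099450161670476427935914142107530867640492047210788,
   411427165304127651685529330420926355483850537298386379955253572,
   411427165308617384715409843000752373914199826050305299198259540,
   411427165307869095877096399443851933026071542031819911268938084,
   51025972703707889316880154904125622775874890643611321381188,
   51025977941729757510814951270213953508261253818023941255556,
   51025977567585338354082536866374221733719842976423203582356,
   50241339850664858450868153367693128185546984485596152476068,
   50241339803898233303926772195882820853435665546251865174452,
   50241339802436731666722057404560783088753355530170220425668,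
   50241339801705980848035421353993708972037585915445494428116,
   50241339801340605438681433148524678041086459098189813264868,
   50241339801157917733993802940052802837823965911050815025652,
   50241339801066573881639353857044599164616426908895637680644,
   50241339801020901955451495492922817634830242559818904646164,
   50241339801020188331709271283015360666412883539329918448164,
   50241339801019831519764827145112537440954060252581337248308,
   50241339801019653113781971252194846501241418152724803891780,
   50241339801019563910779909481769721704401866646314294456916,
   1646308099909113234503202973051521357528224957571245660930447556,
   803542587907557723643102832496788116363399561856212792383844,
   73565778062585872100518678274256448350050813513489848740,
   73565776605366674827015385027574624774071121968660230804,
   73565775874615856140379361209310314254976636824360858276,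
   73565775509240446786391174755038386727290842019227775668,
   73565775326552742098760985297922186888238677330777617092,
   73565775235208889744311923992392234318897842162053952212,
   411476573017281796407286558919634141227631802970511081987902308,
   411476597537116914156719093598793810444205975443249974454792948,
   411476597534123760231410101505728610941840403087717352252388100,
   411476597532627182554783235649516854211426764317295053525496596,
   411476597531878893716469792092616413323298480298809665596175140,
   100460501443127734030939026453368064101461028716645244207105,
   100458968947586868142060734858413946710231465421669965771588,
   100458968199298029828637111510136169718768975726803095139156,
   100458201951527596884187994220917322605729792178589405295460,
   100458201577383177727475517932782862789635755515641265664884,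
   56540899778599448039183963580605437243021265258475617744180013170286399556,
   56540899778599446469908529733935246282827758131282492591994337668348523412,
   56540899778599446469142281963502301852324548839552794459092098023471199140,
   1793705691147922476763401230546744893750105080349944886775108775973028,
   1739785797813621197174067200372685677366195192590667290019766964597700,
   1739759469740704057877392720865763430530119702034831543154330727101396,
   1726318988516504446925070932582636327410322553634866165715109903597569,
   1726292660443587307628396453075714085746261493876337918586950618461172,
   1726279496407128737980059213322232364162067378211865737526493362271236,
   1726279496407128737792987003743828058179830254181121957323844906660884,
   1726279496407128737699450898954629003766861866233313383152900738397220,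
   1726279496407128734706295545701046165525378122100198063462373317948468,
   13481207467485968114048431013365389680837700877159182802616827510785,
   13480384715207307511027353528771628401809496127811919328340526235649,
   411381631987613693845985287068396910837318145251885636873355265,
   14141678264985246170403354801587623582260807291985412528199766233490404468,
   14141678264985246170211792858979387452369137985248054040882703818451596420,
   6901746758171533548407470616053122472350429338341806260092231981473972,
   411481403394725212352504826735985003544981005049439818341166388,
   411478264843857519012122887573283201491051499412584440590775476,
   411476695568423672341931907358602717918851705860192019414004932,
   842909810044025733106479849658148038378212744379452154808028378324,
   842909809945946109104164477240075000397820485347857754274924598132,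
   842909809945946018491062962702826425025242774591556475722142856436,
   842909809945943025335709709119910299088620618858894642938979038468,
   842909809945941528758033082254132295035671285851496303818217370900,
   4830431232397606370571887634283962148690093216271434776577,
   1691880364704622800555906936732283789359673924928872133940,
   122604930857952609575604617223884526551480780001442280772,
   100458158968763015037698311912727101012854222423763381654820,
   411476597486280041203801072831225267484453829411995019560105316,
   411476597484783463527174207058088992839997222915403239107081588,
   411476597484035174688860763501188551951868938896917851177760132,
   100458154856097407588622565203037623379185450996324635784548,
   100458154107808569275179008606832879305676565660037559629220,
   100458153733664150118446594202993147531135154818436821956020,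
   100458153686897525668384891290640588380666618411518788646340,
   100458153685438878526565588322818431598245512298283492455892,
   100458153684708127707878952291266116485857074165621082568164,
   100458153684342752298524964104811844558329388370815949485556,
   100458153684160064593837333915354728358490336206127499326980,
   200891831962672347898222986595758611267473877570806696914884,
   200891830466094671271357130384001880853835184009524712322596,
   200891829717805832957913734443495956704979420568026285618740,
   200891829343661413801181324603198385752063855114557087299140,
   25723744159907510167825250000165522212874997269383872513,
   24957496389474565718707979796077412597453393794480223844,
   24957122245055409006231691661617596503416730846340593268,
   24573998359838936771703703978173009408522530654975440516,
   24573811287629358414800945915371780998712383666201310868,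
   200891780748730544604025771135129660162000502581901103469716,
   411577031108060008733367400216779739956456781247396516908250804,
   411577031106563431056740534355704958629051503176446001839879876,
   411577031105815142218427090871821192314069232684170718540216020,
   200891776636064937154950024444454941533360038911325888329396,
   200891775887776098841506467848250197459851153575038812174068,
   200891775513631679684774053444410465685309742733438074500868,
   24527274151065523276711911537456042810940427159455405348,
   24526528785230484495132759940087531345265822095092234020,
   24526154640811327762718375115114760227296002944902641460,
   24525967568601749385877216125656522018496340545309259588,
   24525920801977299345441951705656025996036192508209805140,
   24525919340475662140727084324582247730642551066630043492,
   24525918612579338839502972534383706377212949065217619828,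
   24525918247203929485514786080111778849527154260084537220,
   24525918064516224797884596622995579010474989571634378644,
   24525917973172372443435535317465626441134154402910713764,
   24525917927500446255577171191041820511505449314990176180,
   24525917926786822514144594140565078029655911070375622596,
   24525917926430010569783531719827809603106454840068290516,
   24525917926251604586932829831344804508310228056870500324,
   24525917926162401584871382657123065885702847379387987956,
   24525917926117800073206692493040343924584404216148146180,
   628846968180481322061117280075701663593807399228538881,
   245723082964009087533130789677693543007622674416416804,
   245536010754430730630372722252323873171519092391163956,
   53974068146194603397160595489100976779659337161259076,
   53880532041405424281167563893025149056813734818756692,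
   200965337918604198747762040273624076877662234347391500162196,
   200965336422026522120896179194089041587641085782843435530356,
   200965335673737683807452612233652218210642801357212412295300,
   200965335299593264650720275410029220403740762113847843633300,
   98081076724947256506735562763354172528525509807187170452,
   98080328436108943063178985573369102443158039464453879988,
   98079954291689786330764600748396331325188220314264287428,
   98079767219480207953923441758938093116388557914670905556,
   6693667503352684384499599386101342365244875201320404,
   6319523084195951970115962835767938360789588702673140,
   6132450874617575128958161799967443526191092268546308,
   6038914769828376074546381834457367363828124969089300,
   5992148145378356906929894392615292917848978645596452,
   5990686643741152192056571188514515064436362520312116,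
   5990688784612689921768397009161594309555886691989828,
   5989958033794004614966028883268001555615138333079892,
   5989957676982080109248062851914523583653731577641316,
   5989592301572727450290792769206695472510452263565684,
   5989592123166764532817811870138963681735937555970436,
   5989409435462078231857538943158824204222774924818836,
   5989409346259096108507050610233965504041706241145252,
   5989318002406742988674929269501095737858063336487348,
   5989317957805251262385687219647673582973717664774596,
   5989272285879064733250744985062402759611988459928020,
   5989272263578318205492126076744698877376004294195684,
   5989249427615214971714087710013740032375206464993780,
   5989249416464841043220780372463895286463403052251652,
   5989237998483279457121799756579324606097074745784852,
   5989237992908091828261148204413409428347361709537828,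
   3756437208920786959173523020209683636648524134751761483282510609188388865,
   222635239577551349343991711792438128468779030072205562235523277783040001,
   222635239577351266726176444030795508656375445815615957761451097596100609,
   222743079364019869282361956737889983073180578090519020360854868792982116,
   221017642777322229869542188632413128300387683519389374114568605559750657,
   221017642777322229868045610955786262522383630570056367100461593006193284,
   221021434019822517073629080005295561287271654676205695725061191494548116,
   221021434019822517072880791166982137927698491020391895396834830074264228,
   221021434019809962869410017805454510662709883372970104983614002165725876,
   221021434019803685767674631124690653605638743147900036167256573645699780,
   1987864707555697362944854086839758333041966211578910007806694910438932481,
   1988727425849039906316548044641779104249203691158260071547256625381260004,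
   1988727847098203441994427142973507899773441208651656075453557860140595956,
   221017643188878049896085282204004046495446794842838791965425874533089281,
   221017643188878049894588704527377180639558289015483352230303701958408980,
   221017643188878049893840415689063737077790069822478648863326900010892068,
   221018485275836043663613300696657180373359371862396821853512252186951681,
   221018485275836043660620145343403530193864525865332430425199140353882948,
   221018485275836043659123567666776664337976020037976990152158500944362324,
   221017642777502695203874896509465206650832643048092892234998216936914945,
   221017642777502695202378318832838340877696368403636286276357884623207284,
   221017642777502695201630029994524897320795927515508002257872496693885828,
   221017642777502695201255885575368164906087851639678612003695392348715924,
   221017642780517273309862616756596780607582574299543599232820579826728961,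
   221017642780517273309675544547018403766423584841305390735818616273386420,
   1988727847101417121923515892690817888957532265156247261296202073701891012,
   228782107420656559497650242121528482693040601644656866613338381597424276,
   228782528772717509892038792893618449516030509115409206139689785692797924,
   1987865128910971870867075273312621110775224931305364127690935732297269249,
   1988727847204314414238769231114641881977594632579837772083006033221401604,
   1988727847204311275687901537774259942810367317883099353542623496409988116,
   1988727847204311275496339595166023770388269919691034131545074240708426788,
   1988727847204311275496246059061234591272276892719099582294929305326599220,
   1767871964107013234298333872895617583547563280674335101715679593679043652,
   1767764124320344631739155204835269503695640741262280353184086810508147796,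
   1767710204427010330459565870805095443166645539347198668052642745312885860,
   1767710204427010330459565688117390725678718240464636373410122662151208052,
   1767710204427010330459565596773538371229637920175680362181520969169910916,
   1767710204427010330459565551101612183371273793751875373336763640436505748,
   842501803899355637390975776379384106261489122122158260937044262913,
   842501803899355263246556619642102773338634123702685245070931672244,
   842604403127220345615851268201250721540806668446705387369256714241,
   842604453344034041637087800510724948212679759057060948513913846996,
   842604453344032545059411173729939303962771834233510629306600013028,
   663019067647054715336197362231408753978893615066383068954625,
   262853832016359340352926637634731187308849512037976771657729,
   106069680683881322505147368667154149970452525678330484630749185,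
   106119897497577343741679678141380821843543117582925430927670564,
   106119995575799765986851824994180616620212987359919875571072308,
   106119995575051477148538381437280175732084703341434487641750852,
   14134776518333194705798224289301298062528006583166461346098633244555623764,
   14134776518333194705606662346693061849432574009921316365891161011262602596,
   53005573755687690395182040497933423888755308708044930986504242305849884673,
   53005465915901021792622861829873075808903386163682324951771620984478514564,
   53005465863244875958344268480914061965738942008449861378593258297042681236,
   24735858959582463102807174308915960834933691252714809165574919695761408001,
   24735912826819651569808170293987121031041565887734299868310509440562380212,
   24735912826793940561100026449578449636234898305068032189393944219174845892,
   3534611188992829578061745570445232357530040487761434689982168711974354945,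
   3534611188992630280081647043330980549959196243096466890737720927889391617,
   17669387707222918786706562866718669176906671330989329440261828720771218932,
   106119922021345181136712806572978632556861823919289780601618433,
   14135693577769044403706354992308721676940187865338301408974764592281435668,
   14135639657875710102426765658278547622549049220086227042037840322382282276,
   14135639657875710102235203715670311425375035541005038388689085464673533492,
   14135639657875710102235110179565522246259042514033103839438940529291705924,
   3533694972058337167012366430686862089816123568211216419915731679357960193,
   3533694972058337167012179358477283712974945563993974769679300700700425828,
   3533694972058337167010682780800656932189648788401235195249911919232958068,
   13810232683730922061411811228711701500879014282370390923660302586216449,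
   6739990156071589774263861722622887148204220482202784734732443713537,
   3489283929825597107950846711831862375722619631667690415849473,
   3533694129560258041175763992594792737824209420677361959005019784061402804,
   106082234692798435302504608215856955949506842622859388964044801,
   3533694129662901208752806996445035546085097566563288553522084056390450900,
   3533694129662901208751310418768408765294933012665672485957227566066581220,
   3533694129662901208750562129930095321738032571777544201938742178137259764,
   1726279085049134154553859298630082115246953078784422721272053199011841,
   842498357770309430648357851283978041406610190057366710771694698497,
   24421851937065370441716523424893155344397313581381225283585,
   106132549583967129701462843185524522747690483811859674099105588,
   3489284120639274976616354155918176914336936003345040932880052,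
   3533694972058591291743234205133322646510401393465592708788250376787738452,
   3533694129560257943285740621789101156759539226954650567147767334718947156,
   3534611188996107788313069102081025934652392493739721888100748881873092468,
   3533694129662850894048806996094019286337645999497860180089246588274212865,
   3534611189098750955890112105931268742044026853719571534484901132361547668,
   917059541982321243445759726901221899163105666182428328149826457845268,
   863139648648019963856425696727167508024460414107581775879640110350260,
   863139648648019772294483088490970334010781332919481829446993688149956,
   863139648648019772200946983701791218017754360984914132557984596770772,
   863139648635465568730173622174228635866993391254010832686893872725988,
   863139648629188466994786941410371567697274267506573628332373779169268,
   863139648626049916127093601028432405337742808061918464128283787149316,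
   863139648626049916126910913323739917995304191765976183363923715571732,
   863139648626049916126819569471385468914983902809964954762230734274596,
   113133427380348068747046331194702079933096888023146977861647915372113821697,
   113133427380341640994869295233599912083398295376951973177076422847279153220,
   113133427380341637856318427540259530164174355777333849252994893554981552212,
   113134292626133198245872948400633572005828202475065011563038173505285274148,
   113134292626126770493695912439531404156129609828870006878390120938040475764,
   113134289256143084220595510785544845373093235398058975324334803600232415233,
   113134289256136656468418474824442677523749103656983051031056228947806142612,
   113134289256136653329867607131102295604525165245787364839386507632377348260,
   113134289256136653328335111590236406744837590218209864598650297271622582452,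
   113134289256136653328334363301398093321214241940432873136160602404751950020,
   277040833204022880295202780710052452228893978818169456357268079853764609,
   277040833204022880293706203033425606228348632483829012383381819996782820,
   277040833204022878761210662167536728019526224145381233818739117980139764,
   277040833204022878760462373329223304313101164445391526299413236174307588,
   56184950106724837562550185736358540921998984847371570069877592865915156,
   56077110320056235003371517676010461074944218789641935777893458453217572,
   842501803899164075471203503355384670980027908985326064614381715457,
   842501803899162578893526876527197453492338692393487555035560689988,
   53919896811129087158320088892503802615739429005031063636345931956225,
   53919896811129086410031250579060245715298540876747362145923813622116,
   53919896811129086035887545046174173942151941690413712985109493203316,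
   53919999404079849382869445132825737424379469408607064727056368533505,
   53919999454296663078891395288981564630991871642202280143757786497428,
   14134830438226529154005823626673379107591965345455327506865856356992172452,
   14134830438226522876904088239992615252401725194354766362882691403667751348,
   14134830438226519738353220546652233313239365657962904345244056207164981700,
   14134779888326518634941722857221778504919658721763848568453877179271430164,
   3533748049450313341625646221645143500864250738428862333249180263710270996,
   3533748049453328704371971269144435532526853378000056633707731251918536705,
   3533748049453328704371784196934857155711297272161853256348612784527786500,
   53919999454296851647701497384940648158362465987304800825682416385364,
   14134830438226522680942207286748642915788640334819084296321970423064445476,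
   14134830438226519542391339593408260976786983542935050367579916619480056372,
   14134830438226519542199777650800024804360018371080383928894284201760670276,
   14135801838708409994960592525415130670883926546665569352357571505921458177,
   14135805629944482310842277689361959433403649611876897958363351260440052324,
   14135805629944482309309782148496070572636461466793120203512279762438472308,
   14135804787446148960853083622416094596562195902130384193689524752970285057,
   14135804787446148960852335333577781172938847624353392750030242018552201876,
   14135696947659480358293156665517433143519639594915098454706574645938635428,
   14135696947762368332843868983627247582936787688550522917914408344886461108,
   14134830438226528859964321548444685948311352719631219005258056233926016532,
   14135693577769038077564762343590743623372862181460272223958251665305387732,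
   14135693577769034939013894650250361684215370423373286625668107882820813540,
   14135693577769034938822332707642822410075859328849517901731111179559912180,
   14135693577769034938822239171538033230959866301877583352480966244178084612,
   917059567683865067473783364884281051430398174873833582326118209290241,
   917059541972856359329938956212886244764003931043850630856546530116388,
   917059541960302155859165594685213336690781235733486981224461340001076,
   863139648626000876269831564511156795379561742981504684448259188474692,
   863139648626000876269648876806439921829554851695061391858927905293140,
   863139648626000876269557532954085472769437744180206016087662340883300,
   863139648626000876269511861027897614406499742812949583138310476284788,
   863139648626000876268050359390673049727958851249014140271275526865796,
   3533694550815681465795915394728735370608564843711960841844086354680676353,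
   421258926930108225013988240879713911695035760524492789786503806977,
   6902167605717518414091846028112773038486692937414043199011888707945396,
   6902167605717518222529903419876581127625302533708600509798745428214724,
   6901746459444997560620503516464350403611469459444294224996696183618900,
   6902167708611671789273759083785905969651954230080009661261805419250660,
   6902167708599117585802985722258343226799637174958473175456193002357748,
   421361814830900103616540745133786052166758419346364478452242841601,
   421361808553798368229859981296667402151729525085386708552757822484,
   421355380801621332268757813428358239315576154246848847303131808804,
   421355377663070464575417431509135288488376760163318202268461843508,
   421355377663070464392729726816637236952345016628924901132210291780,
   113133429907833427948983425998681961576013255678044828540936926654944837633,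
   113133429907833427948982677709843648152389907395625561931438667321419252836,
   55217762016845763768260850567165816826851756198132420215900671046716516,
   166393420855985529325901789844710257491475667286750433824246632284161,
   165550922522637071925854555987604170432433078623433461439827152994305,
   57711135855603788182677355172530964019971398476581073606876060468388,
   3791242521302508640111377393059406699820672009255560437453955286196,
   3791242521326837006822623378595457606162751683328767495439364670660,
   3791242521326836913286518589415754202963482991826729358224847291604,
   3791348616900374408199926712225386942982519503365804726956596413668,
   3791348610623272672813245948368407756295172456707540506953330476276,
   3533694129662894858287429972038251617224481676871976406242388172916932116,
   3533694129662894858286681683199938173745465688861870555166158298046022932,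
   106126199123081298568992206112305554760982033188807639770136577,
   106126199120088143215738515606596417080938360431861769970926900,
   6901746452916811755818446865927462507327667401164255824554892846974276,
   6901746452916811755724910761138283391334640429229706574409957465146708,
   6901746452904257552254137399610720726366776252132466084457308360820068,
   106132476030168233871181626261201870313582081454563613753820484,
   106119970866554768218097531146155978153747138512479273308145028,
   106113693764819381537333674166969290806699502570823363435971988,
   421355277229442698479869062469686339029995218958001424668210251172,
   421355277229442698297181357778068123319862209638491761730829436340,
   421355277229442698205837505423619062014332257069150926562105771460,
   6901746452916762715867648724620982587896579610728995914154902519104836,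
   6901746452913624164999955384239131159453731750628022268344592896116196,
   6901746452901069961529182022711501955266497474182557615107511031973364,
   118984841833372508407061682021858222891284387079570627128983553,
   106129337479300586202725964093365442390475230003066798401930772,
   106116783275829812841198312375055699375796399939646159049475620,
   106110506174094426160434455395869012028748763997990249177302580,
   421355277180402841035144840477191732268072591781420940074203235908,
   421355277180402840943800988122742672150965076926045168808638826068,
   421355277180402840898129061934884309212963709669612219456774227556,
   421355277180402839436627424710241746219194123688676276451077539444,
   421355277180402838705876606023600523637671075796948555177273607812,
   106110507708833417711552414990279109950076797161557543803486209,
   106110506176337876845663535369151928545990066737785073768089252,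
   106110506174841299169036710714463518678567611161958921832253108,
   106110506174093010330723267157563077790439327143473533902931652,
   106110506174092279579904621639656134707026839918089198053115604,
   106110506174091914204495267651146429532041113734912733602662116,
   102896630085573933653411327515663271169042704375325710338770676,
   102895060810140086983220367239079478418074055651308078181140228,
   102894276172423163648124866497753649833535438870395662202062612,
   102894276172423162934501099018274013046711478336764387617949476,
   102894276172423162577689154574136110223486019513477639036749620,
   102894276172423162399283171718243192532546306871377782503393092,
   3371639710492812327778101463947301122626623026919931393162111631492,
   3371639697938608857004739936386048199861438212166395016559488681828,
   3371639691661507121618059172528991128721213142097578659130968655732,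
   4982383617414978624468520622990718090595732984105649533051341300,
   4982383617414978533124668288480048759566649694891378514267752340,
   4956672608706834688715996985573186003449999306624041893602805668,
   4943817104352762766511661267649561001254066549989315445391378356,
   4937389352175726805409493398017416196590200190901762723582855108,
   6741674827390015864389642395961910634300565521674926011440133701633,
   6741674827414535605971287039338555524147539784721112192292892985316,
   6741674827414535605879943187004044854816818977515899576890279610356,
   6741649116405827462035534515701049743296518047635437260408443914244,
   6741636260901473390113330179983126118294322114878802533960232486932,
   49184255359206529478478772073955884539565891763213426027999524,
   48230111381719363958405027665038039920168186707637643346575361,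
   48230111381535214752101332568117568268767776411321270849783876,
   49083821737476367273600091858629834663949168353925444465084500,
   1668877370350538565020594869525859523866006863170196636125120612,
   1656021865996466642816259151602234521670074106535470187913693300,
   1649594113819430681714091281970089717006207747447917466105170052,
   1646380237730912701163007336517759459242509282765718547401296020,
   1646380237539350758554771184029127643022463348345868427979671716,
   1646380237539257222449982004647384588306474452013435951011350708,
   1646380237539257176778055836727431451142542185182934473095792836,
   1646367683335786403416528275652734228224714246725656076782422228,
   1646361406234051016735764418678415319182543011685747507218893028,
   1646358267683183323395382479520923561095557413395603724734318836,
   250705923081803894566761260764796110364314737861203661467680769,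
   250705923081803529191351906786326197943136588922447638293399828,
   48231729505170937517581272613133253793684781087519904250200065,
   48231729505170754829876585060809234796503933410815003939850548,
   49085390821348271336251823189454393948556089315826913820821604,
   49085390821254735231462644073461367266763718403238798742800724,
   49085390821254689559536476153517177906839019823098376144046436,
   23374382113110845150865194242676315857039711349564583338592628,
   23361827909640071789337521334603093161729347699932498148477316,
   10506323555568149585001804740509134472329525060308415827429780,
   10500046453832762904237967621859119443435263766120794671827364,
   4072294276796801802070099319245358286101838673670438753683892,
   4069155725929108461688180095306947090415628557205049615337924,
   855279637411127910604235972507732833250208550572939059153364,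
   853710361977281240413275695925123554168024022968665929435620,
   421454905769871464494303601794313640185002687705644461951028308132,
   421454905769871464448631675606129459351477659787291822457801951748,
   421454905769871462987130038381538861317219555343716383794654104084,
   421454905769871462256379219695155935221999011474837630765977586212,
   205739144682575421387270051671726354545567040106449561893016804,
   205739144682575330043417693234981061660866003504021750248655428,
   205739095642718068006900392358591198311820264201315170933354228,
   205739095642718022334974204500228260310453007768368146405149284,
   205739095642716560833336979847929709931114833771484892506376820,
   205739095642715830082518293211574906712943342945510959011089028,
   205739095642715464707108939223065201537957616762334494560635540,
   51026744935461191266355770496408526826139726617706836066305,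
   51025978687690758321905323979198537072375262076776121125556,
   51025977939401920008502967974617464822282437702593186646724,
   51025977565257500851770553570777733047741026860992448973524,
   51025977564892125442457765956927731665058717619702121646820,
   51025977564709437737770135748455856461796224432563123407604,
   50241339847786102642273382106609694253232766325410669546244,
   50241339847785389018506694273698340122250765988390505564948,
   50241339847785032206562333192262843850400775509709650152228,
   50241339847784853800579482471359601841882538260475904281396,
   50241339847784764597577421005170621099836489857347873688388,
   100458153733619908924420282193229286179690760679444655912388,
   100458153732158407287195302136089542394042128472558879656804,
   100458153731427656468508977642348739370407511710064454945652,
   100458153731062281059155004059229382072082531157280247794564,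
   100458153730879593354467374478244553981793591711009336216468,
   24525967522929823196689624003447799828582202849207793492,
   24525966062858918156179566976524441958226122167207087028,
   24525965332108099469543535424209328665897529893029170116,
   24525964966732690115555348969937401138211735087896087508,
   24525964784044985427925159512821201299159570399445928932,
   24525964692701133073476098207291248729818735230722264052,
   24525964691987509310775873224255852336848516242750852100,
   24525964691630697366414810803518583910299060012443520020,
   24525964691452291383564108915035578815502833229245729828,
   24525964691363088381502661740813840192895452551763217460,
   24525964691318486869837971576731118231777009388523375684,
   6036723948104647599225053103183909967162350683306308,
   6036358572695293611039787253694096246431448709483620,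
   6036175884990605980851518559931971159330663418580084,
   6036084541138251531791401452417115783559397854170244,
   6036038869212063673428463451049859350610045989571732,
   6036038155588322240845470880252824097180239166196900,
   6036037798776377879784238565422111512787912018119860,
   6036037620370395029083538504854730681625031979584708,
   6036037531167392967637552705553822039308257656327380,
   6036037486565881302948577045269574885928997575740644,
   6036037464265114836771209767517622564175648453053684,
   5989269411870507334196740382656201452655199376133380,
   5989246575907422709610652615716067125576501103185172,
   5989235157925859794283676523191707543133552066448676,
   5989235146775507133438297102020700384702755977055540,
   5989235141200299566157713690400148383314733916245316,
   5989235138412685148693453529196432292575799881518420,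
   5989235138064403936677560018225623749100618204073316,
   5989235137890158097166106966278409489182588394294644,
   5989235137803024543586414160977819128767091246648708,
   5989235137759447132972601479000540718102860430069140,
   5989235137737647793841728858684918282314262779022756,
   5989235137726737490452326269200123833963481710742964,
   823154209332266863378768596537954264199085153203357336143396865,
   401930671663842301283983993361797231697595574734310039617537,
   196160786166941976827776158645681000781038668665769164801,
   1450517884918281017572467577216194322995510214918145,
   722690070224451417766854480996838079543373240225284,
   722328976558195563441182132629509783171593371930132,
   348184557401464747889170043537138131493797959323172,
   348001869696797056120838123513088154754843164036660,
   160929660118421876133101621728752834259073528516164,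
   160838316266087365797157432006747625208847229013588,
   67302211476889661036645247426596706141277523037796,
   67256539550721741416894922855613880935415471427188,
   20488487156112911284152308205263750685840823570052,
   20465651193028286698059900123331612575752820641428,
   98082532316346322193266862874278664127581473324118593028,
   98081035738669695327883472114927377792104255916623285940,
   98080287449831381884346366038161813310190141549245910724,
   98079913305412225151932893921621206517389400025364188884,
   98079726233203343673378533491789875458700266162621533924,
   1414705029523737347163230170932156009083901341355524,
   666416191210293790587228608299784475261834336685828,
   292271772053561376203592057966380470506587306348308,
   105199562475184535045791022165885635908090872221476,
   11663458382883768088093029828800669565384869826356,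
   23955444782775171197415484986931174583709400053075780,
   23954714031956484440424777376673745825171421434761044,
   23954348656547130363971811810854604913161172111347556,
   23954165968842442589565406334600150408547790801096564,
   23954074624990088472467561157626719049158545462284164,
   23954028953063900634548098333714652361783884618157972,
   9494041890054444894198943096478168534727858868036,
   9128666480700456709007370009021647481723121848244,
   8945978776012826520812952649253683197431778398148,
   8854634923658377460770121536755430242660161441748,
   8808962997470519097906396571856120109802244296676,
   8786127034365956091951181744754036835223291842548,
   8774709052803040764970156802736832055988391530500,
   8773995429104143477397025617239310513068517117972,
   8773638617159167863418081687801234807230049570852,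
   8773460211176311971688813185821004515350385020980,
   8773371008174515587181133267297337231092726386756,
   8773326406663183164713547579249256593061640687700,
   8773304105896737735057591337261736773612307763300,
   8773292955502872490337441889093865685190181933172,
   200916300677338738055410031107416768007301854335538915580180,
   411577055630935004227677756905417992132600062631013956354855060,
   411577055627941848874424195583369137803911168963673248393875620,
   411577055626445271197797329888441829639375246480300969303232692,
   411577055625696982359483886325979969197894687728066272024350916,
   49057444962733041073229195859500174382731317230230902052,
   200916309987104167853367869790774508350660624105536836620516,
   200916308490526491226502096958736007948829183872965152887028,
   200916307742237652913058540362531263875320221746785992855812,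
   200916307368093233756326125958765826637023227941116823228692,
   49053145224916362112408889192358747285840255087394443492,
   49052396936078048668852312002373677200396007221564035380,
   49052022791658891936437927177400906082426188071374442820,
   49051835719449313559596768187942667873626525671781060948,
   49051834262229419390464476850875635703620792157926871396,
   49051833531479297601994941571806619113680362000056602996,
   49051833166103888247918488606240799972768351750733189508,
   49051832983416183560138910107088660753860908855975760276,
   49051832892072331206021812261911687322501519610636947876,
   98091693072829683193565974085873022844555242946557916948,
   13378575981359327253246336056859580497144821251591684,
   12633210146320545762343497922076375564197520710062548,
   12259065727163813348283186551203527179640426944549348,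
   12071993517585436507144474550808812908880875005956596,
   11978457412796237452731580439271238217245898763686404,
   11976995911159011470210324694650565664580492868997652,
   11976269442083402952059603976832895649537530998575652,
   11975904067370947251328420100516073124826890321809972,
   11975721379666259621140151406753948037726105030906436,
   11975630035813905172080034299239092661954839466496596,
   11975584363887717313717096297871836229005487601898084,
   11975561527924612750711062126965699776785245837218420,
   11975560814300892585775482198133525164858437725606532,
   11975560457488948108621684451327875781062771958895252,
   11975560279082965169653284674431167758620544570774180,
   11975560189879962959122572210199242762107737078780596,
   11975560145278451626395868480456419625110497223791300,
   11975560122977685180661976380159657048931839121576660,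
   98127610937079856058300140003620796051394872627331872932,
   47896321662990880169770650458874819332771613749819620,
   707356796850750549061987568129025908707743142792708,
   333212377694018135002864619693891489214552536535828,
   146140168115641293865341041736891183518903757198116,
   52604063326442239454823775066886109036333564449588,
   5836010931832078424373301773709330517189830136644,
   4374509294627363550604439258807186949683729683284,
   4378078110756086676393291364865524328679290721124,
   3647327292070779874099441873629893204424879264628,
   3646970480146274156133410520151921243018123826052,
   3281595070793615198937604214680932916232757203860,
   3281416664830697725956705146949142141718049608612,
   3098728960144396765758054569166787445049365910452,
   3098639757162273415269721644308087263980682236868,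
   3007295904809153583222657313795443896831725032404,
   3007251303317427293980607460373289012486053319652,
   2961579377130898159112649277459588467250795926516,
   2961557076384370400493740959755706231266630194180,
   2938721113281136622534292914639232544310337491988,
   2938709962907208129226955364794486632506924749860,
   2927291981345622030241697204357063071273074054196,
   2927286406157993169590145038441885321560037807172,
   100444211569077943190100474686065694370617873524828526349460,
   209002413730891318597937213801182227127956203191087883908830308,
   1685205669110262754600069907916670865828525689082023078184721863796,
   1685205669110214864114417848845982723400560837354066546074952216196,
   1685205669104084881950954293541406486652682598544742010142875210900,
   1685205669101019890869222515803500029118701348643918320452670346404,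
   209005547253258018474908952217120950296106266983293215183994881,
   209002408702390325134527013059629192209120669077380586280080580,
   209002405637399243402749316276487370653766333171333326047302868,
   209002404104903702536860436655360189249679602440172653396382948,
   205788528016385723413024186567402529856540281959133351624332532,
   205788528016385677741097972124456810739418718099727179479799044,
   205788528016385654905134867151664977596668151874603995930580244,
   205788528016384193403497663823480603316001394506199723750216996,
   205788528016383462652678977523327016736199835486054327975433524,
   205788528016383097277269623550962104653960681818818775952151876,
   100458375180370822121009588479181008808806972100678875420036,
   100458375180325150194819071658772365224841916875564437755236,
   100458351235105160128388955171732026509441646473245194532292,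
   100458351235082324165284392165776811682339563198799118620036,
   100458351233620822528081006602450558833788411406809687938452,
   100458351232890071709394370551883484717072641792084961940900,
   100458351232524696300040382346414453786121514974829280777652,
   100458351232342008595352752137942578582859021787690282538436,
   24726275069919471707392284730648886286349952443223133700,
   24724778492242844841619471706907487878732947811036321252,
   24724030203404531398062894516922417793211844082424370676,
   24723656058985374665648509691949646675242024932234778116,
   24723468986775796288807350702491408466442362532641396244,
   24723467525274159041557187456590464630855102827406054948,
   24723466794523340354921155904275351338526510553228138036,
   24723466429147931000932969450003423810840715748095055428,
   24723466246460226313302779992887223971788551059644896852,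
   24723466155116373958853718687357271402447715890921231972,
   24531904212508137832949733198748090456615048150053312116,
   24531904211794514088858691245056478062259941900358276740,
   24531904211437702144497630087018049762138598288286307988,
   24531904211259296161646929461233884738430251902195226276,
   24531904211170093159585483549710986186910751621819422388,
   24531904211125491647920794648327104296880188855686289092,
   49051835698044082616580116521013887181164337844674646372,
   49051834236542445412784625815354207558217821469075855076,
   49051833505791626726538017715851644051994080322748700404,
   49051833140416217372569303563221659841880338782009448196,
   49051832957728512684940028002960062041962315623026415380,
   49051832866384660330491005915370554033468589258558166820,
   196195349986661295600186349956450205461007111189849788132,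
   35920755827532598086028207252630332316128143900495668,
   11978436004777722553911518194586490066341649703784980,
   11976974505928112318082518686227603215733240053651300,
   11976243755109425682052154793552024852204869034989428,
   11975878379700071693866888944062211131473967061161860,
   11975695691995384063678620250300086044373181770258324,
   11975604348143029614618503142785230668601916205848484,
   11975558676216841756255565141417974235652564341249972,
   11975557962593100323672572552486941007538877639972804,
   11975557605781155962611340237656228423146550491895764,
   11975557427375173111910640177088847591983670453360612,
   11975557338172171050464654377787938949666896130103284,
   11975557293570659385775678717503691796287636049516548,
   11975557271269892919598311439751739474534286926829588,
   3645189208124870750605747138190029544957095727972,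
   3279813798770882565414174050733431630549069355060,
   3097126094083252377219756690965467346257725904964,
   3005782241728803317176925578467214391486108948564,
   2960110315540944954313200613567904258628191803492,
   2937274352436381948357985786465820984049239349364,
   2936560728716217012852315229235844824169507215492,
   2936203916771855951694276800880383248336306591892,
   2936025510789005251068492635856674901950215510180,
   2935936307786943805156969737305155401669839706292,
   2935891706275279116255585855415124838903706572996,
   2935869405508812938962584505819925902048531339476,
   2935858255114946025792731486369898225470949841124,
   2924440273553359926806893041077891040390501390580,
   2924434698365731066155631017377867545753104177412,
   2924431910751313601895469813661776806819069450516,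
   2924431562470893215154440985029646863128727673124,
   2924431388225136780446173834918748656014298470708,
   2924431301091588393045275309017321993987593099588,
   2924431257514178103746195230026943335886910150996,
   2924431235714838993151032757917483194210623445348,
   2924431224804535605011142113212569467900371425652,
   2924431219338750086417844446207684396595251534212,
   98130412635361832061330242659287218771011420365648893076,
   98128916057685205195557430902886935581573989028886239652,
   98128167768846891752000854980242980714460941728252713396,
   98127793624427735019586471422611324814899179006041545156,
   98127606552218156642745313700494201824507573034426587604,
   239734487723873349795424657808042066328704162972303361,
   239547415514294992892666595006813656821495919759350260,
   47985472906058865659454463619449500403679571278322180,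
   47891936801269686543461436647514932706790562186942996,
   702971935129556923098530409749348966249131691494916,
   328827515972824508714968135818283637566304899062324,
   141755306394447667557241376420127479040228702837316,
   48219201605248613145535687312389992749681641282132,
   1451149210638452115159490413878044768294971398756,
   1455074838816539775320932348257266861954485475956,
   724324020131232973031724000239846062765439474308,
   723967208206727255065693780129829990073535322772,
   358591798854068297874528616438205950604189129380,
   358413392891150824893630682074371064804332821172,
   175725688204849864699621246071380655451669551812,
   175636485222726514211289454580636363097837165268,
   84292632869606682168866265847357283264900389604,
   84248031377880392926817545793158287634079963892,
   38576105191351258063500504658822029714842999556,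
   38553804444823499444593320322895682445528554260,
   15717841341589721489786416985786282805256280868,
   15706690967661228182450000508996259716694825780,
   4288709406075129201832982570360004673537071940,
   4283134218446268550281950023138143675352111956,
   23953969010754181571275785374022640706153660154991124,
   23952507509116998960355863320119922636245867053472628,
   23951776758298312791632295614256335283454690483788676,
   23951411382888958827786000207826030514453014872349588,
   23951228695184271198814755008960510095781589477776292,
   23951137351331916749811761097133429486070200376777652,
   23951091679405728891451278859319105426241179649858500,
   8749018597056503807281392883578867358983635686228,
   7287519747467624240966007247841321152205223386084,
   6556768928780988210676390974620080440328152177652,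
   6191393519427000025484817887163482525920125803524,
   6008705814739369837290400527395518241628782353428,
   5917361962384920777247569414897265286857165397028,
   5871690036197062414383844449997955153999248251956,
   5848854073092499408428629622895871879420295797828,
   5848140449372334472885511454315953673264516062292,
   5847783637427973411732115301144705761609606257764,
   5847605231445122711110973411268317591254386891892,
   5847516028443061265204092787864118267004882803844,
   5847471426931396576307351181121407880269621386388,
   5847449126164930399018992106673529119445317868708,
   5847437975771063485853781362370821618898608086196,
   721829124262147359567766959434789252510847621748,
   356453714908159174380836147125511514133692964052,
   173766010220528986191061062504867405873221229796,
   82422157866079926152872225153934627132475989236,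
   36750231678221563293789535401944670305430560004,
   13914268573658557343216983447181571757349821716,
   2496287010743230366834316890891617806383602980,
   2139475235022432731491059070050768385421106484,
   1782663290661371578094905861909368583092198724,
   1604257307810670956953015985521198227872832852,
   1515054305749225050072392581321873978368744804,
   1470452794084536153330785838611487243107327348,
   1448152027618358864971711390732726418803809668,
   1437001633751445699760967088025225872094027156,
   1431426426184165116059204357763070921813286308,
   1428638811766700855607858020689707290529390004,
   1428290531346314082083104740824336912301972932,
   1428116285589879378458229777246305828744486356,
   1428029152041491982201979023139819832910831076,
   1427985574631202687764175180081337763099598324,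
   1427963775292092097243978217941372117684608516,
   1427952864988703961995608660347821838304304660,
   1427947399203185373340216802782926564056129060,
   1427944655676602077916130295092074250006191668,
   713921065281476978735472097401711261675061809008132,
   713555692661097203061937038956845525512574657912404,
   339411273504366117906375481225647619179199805283940,
   339228585799698425813604236839053135883397384658548,
   152156376221322913883878193640764399706773128240772,
   152065032368988403223494679556214684099699203399316,
   58528927579790678039789706648344620158604081651364,
   58483255653622758095600057714817288395894404701876,
   11715203259013926293224577016154316019885965074116,
   11692367295929301707131860658138176179358412070612,
   720757992955459903258772060426721778936629451380,
   355382583601471718071841248098997296485765242612,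
   172694878913841529882066163459906444151583956740,
   81351026559392469843877326090526921337129164564,
   35679100371534106984794636320090220436374183716,
   12843137266971101034222084346880377814583893812,
   1425155704055774057839417790590423863617675076,
   712228903368056078986333856310185832819482452,
   711880452972985495093987436212911465066159972,
   355068509941152337771758929726941010095791988,
   354894284040060821494683176980017599342468996,
   176488302518588196426718002247276591481642900,
   176401188903428440396288873399855713390452644,
   87198188171210529589590170855960811244904372,
   87154630699016653682484353958291199484780484,
   42553120363555753014802312903333811581902804,
   42531340962844817169358151980539832987312100,
   20230575825895524884208405757208356042334196,
   20219685460926059069595072821852194030510084,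
   9069292923240889932775471769780994679267348,
   9063847076142159133577552828143740958826532,
   3488640838089571505739524221418138036625460,
   3485917249926208214249312276640338461876292,
   698304161689943836828101133819749856206932,
   696941702994264299191742687471677354303588,
   711532685723220291586772237239603115559247700,
   354720741362159138498895094653189679070863492,
   176314758511458517665281283820005689692020884,
   87111756450012611092933945175667806028456100,
   42510244785323714659603268020267436607561908,
   20209478319146426608804885696492978144567492,
   9059084452233261706336648543978797275308244,
   3483876884952678312849983836810212835090660,
   696262467488418169780155040290716420956404,
   347982047101642198086140940715701518229764,
   173736290666938881487242917670983801266452,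
   86602742279542933512554366171353808134436,
   43025331990248803984776862675649837424948,
   21225992879658592063880277696370262958404,
   10315689491523651970388239132456723177812,
   4849903972935304854596229223548315525476,
   2106377389640189044154093357600106111348,
   723980274024184812418135745348097827204,
   22147892249767365430666581031406035348]

theorem certCheck_eleven :
    certCheck 11 [] (assemble blocksEleven) 1563 = true := by
  decide +kernel

end CliqueMinor

namespace CliqueMinor

noncomputable section

open Classical

variable {V : Type} {G : SimpleGraph V}

/-! ### Counting edges -/

/-- The number of neighbours of `a` in `B`. -/
def dg (G : SimpleGraph V) (B : Finset V) (a : V) : ℕ := (B.filter (G.Adj a)).card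

/-- The number of ordered adjacent pairs in `A × B`. -/
def ee (G : SimpleGraph V) (A B : Finset V) : ℕ := ∑ a ∈ A, dg G B a

theorem dg_union {A B : Finset V} (h : Disjoint A B) (v : V) :
    dg G (A ∪ B) v = dg G A v + dg G B v := by
  rw [dg, Finset.filter_union, Finset.card_union_of_disjoint (Finset.disjoint_filter_filter h)]
  rfl

theorem dg_le_card (B : Finset V) (v : V) : dg G B v ≤ B.card := Finset.card_filter_le _ _

theorem dg_lt_card {B : Finset V} {v : V} (hv : v ∈ B) : dg G B v < B.card :=
  Finset.card_lt_card ⟨Finset.filter_subset _ _, fun h => by simpa using h hv⟩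

theorem dg_singleton_of_adj {u v : V} (h : G.Adj v u) : dg G {u} v = 1 := by
  rw [dg, Finset.filter_singleton, if_pos h, Finset.card_singleton]

theorem ee_union_left {A B C : Finset V} (h : Disjoint A B) :
    ee G (A ∪ B) C = ee G A C + ee G B C := Finset.sum_union h

theorem ee_union_right {A B C : Finset V} (h : Disjoint A B) :
    ee G C (A ∪ B) = ee G C A + ee G C B := by
  simp only [ee, dg_union h, Finset.sum_add_distrib]

theorem ee_comm (A B : Finset V) : ee G A B = ee G B A := by
  simp only [ee, dg, Finset.card_filter]
  rw [Finset.sum_comm]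
  simp only [G.adj_comm]

theorem ee_self_union {A B : Finset V} (h : Disjoint A B) :
    ee G (A ∪ B) (A ∪ B) = ee G A A + 2 * ee G A B + ee G B B := by
  rw [ee_union_left h, ee_union_right h, ee_union_right h, ee_comm B A]
  ring

theorem ee_le (A B : Finset V) : ee G A B ≤ A.card * B.card := by
  rw [ee, ← smul_eq_mul]
  exact Finset.sum_le_card_nsmul _ _ _ fun a _ => dg_le_card B a

theorem ee_self_le (A : Finset V) : ee G A A ≤ A.card * (A.card - 1) := by
  rw [ee, ← smul_eq_mul]
  exact Finset.sum_le_card_nsmul _ _ _ fun a ha => Nat.le_sub_one_of_lt (dg_lt_card ha)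

theorem le_ee {A B : Finset V} {k : ℕ} (h : ∀ a ∈ A, k ≤ dg G B a) : A.card * k ≤ ee G A B := by
  rw [ee, ← smul_eq_mul]
  exact Finset.card_nsmul_le_sum _ _ _ h

theorem ee_mono_graph {G' : SimpleGraph V} {A B : Finset V}
    (h : ∀ a ∈ A, ∀ b ∈ B, G.Adj a b → G'.Adj a b) : ee G A B ≤ ee G' A B :=
  Finset.sum_le_sum fun a ha => Finset.card_le_card fun b hb => by
    rw [Finset.mem_filter] at hb ⊢
    exact ⟨hb.1, h a ha b hb.1 hb.2⟩

theorem ee_clique {S : Finset V} (h : ∀ a ∈ S, ∀ b ∈ S, a ≠ b → G.Adj a b) :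
    ee G S S = S.card * (S.card - 1) := by
  refine le_antisymm (ee_self_le S) (le_ee fun a ha => ?_)
  rw [← Finset.card_erase_of_mem ha]
  refine Finset.card_le_card fun b hb => ?_
  rw [Finset.mem_erase] at hb
  exact Finset.mem_filter.2 ⟨hb.2, h a ha b hb.2 hb.1.symm⟩

/-! ### The central hypotheses -/

/-- The subgraph of `G` induced on `Y`, with `S` made a clique. -/
def fill (G : SimpleGraph V) (S Y : Finset V) : SimpleGraph V where
  Adj a b := a ≠ b ∧ a ∈ Y ∧ b ∈ Y ∧ (G.Adj a b ∨ a ∈ S ∧ b ∈ S)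
  symm := ⟨fun _ _ ⟨h1, h2, h3, h4⟩ =>
    ⟨h1.symm, h3, h2, h4.imp (fun h => h.symm) fun h => ⟨h.2, h.1⟩⟩⟩
  loopless := ⟨fun _ h => h.1 rfl⟩

/-- The common neighbours of `a` and `b`. -/
def common (G : SimpleGraph V) (X : Finset V) (a b : V) : Finset V :=
  X.filter fun w => G.Adj a w ∧ G.Adj b w

/-- A set of at most five vertices separating `G`, such that neither side gets a `K₈` minor after
turning the separator into a clique, does not exist. -/
def NoSep (G : SimpleGraph V) (X : Finset V) : Prop :=
  ∀ T S' : Finset V, T.Nonempty → Disjoint T S' → T ∪ S' ⊆ X → S'.card ≤ 5 →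
    (X \ (T ∪ S')).Nonempty → (∀ a ∈ T, ∀ b, G.Adj a b → b ∈ T ∪ S') →
    HasK8 (fill G S' (T ∪ S')) ∨ HasK8 (fill G S' (X \ T))

/-- The situation studied in the main argument: a graph on `X` without a `K₈` minor in which all
edges outside a small clique `S` lie in at least six triangles. -/
structure Setup (G : SimpleGraph V) (X S : Finset V) : Prop where
  no_K8 : ¬ HasK8 G
  supp : ∀ a b, G.Adj a b → a ∈ X
  sparse : ∀ Y ⊆ X, 5 ≤ Y.card → ee G Y Y + 38 ≤ 12 * Y.card
  clique : ∀ a ∈ S, ∀ b ∈ S, a ≠ b → G.Adj a b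
  sub : S ⊆ X
  card_le : S.card ≤ 5
  ne : (X \ S).Nonempty
  tri : ∀ a b, G.Adj a b → ¬ (a ∈ S ∧ b ∈ S) → 6 ≤ (common G X a b).card
  pos : ∀ v ∈ X, v ∉ S → ∃ w, G.Adj v w
  noSep : NoSep G X
  big : S = ∅ ∨ ∀ v ∈ X, v ∉ S → 9 ≤ dg G X v

variable {X S : Finset V}

theorem Setup.supp' (h : Setup G X S) {a b : V} (hab : G.Adj a b) : b ∈ X := h.supp b a hab.symm

theorem Setup.common_le (_ : Setup G X S) (a b : V) :
    (common G X a b).card ≤ dg G (X.filter (G.Adj a)) b := by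
  refine Finset.card_le_card fun w hw => ?_
  rw [common, Finset.mem_filter] at hw
  rw [Finset.mem_filter, Finset.mem_filter]
  exact ⟨⟨hw.1, hw.2.1⟩, hw.2.2⟩

theorem Setup.seven_le (h : Setup G X S) {v : V} (hv : v ∈ X) (hvS : v ∉ S) : 7 ≤ dg G X v := by
  obtain ⟨w, hw⟩ := h.pos v hv hvS
  have h1 := (h.tri v w hw fun h => hvS h.1).trans (h.common_le v w)
  have h2 : dg G (X.filter (G.Adj v)) w < dg G X v :=
    dg_lt_card (Finset.mem_filter.2 ⟨h.supp' hw, hw⟩)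
  omega

theorem Setup.eight_le_card (h : Setup G X S) : 8 ≤ X.card := by
  obtain ⟨v, hv⟩ := h.ne
  rw [Finset.mem_sdiff] at hv
  have h1 := h.seven_le hv.1 hv.2
  have h2 := dg_lt_card (G := G) hv.1
  omega

theorem Setup.exists_low (h : Setup G X S) : ∃ v ∈ X, v ∉ S ∧ dg G X v ≤ 11 := by
  by_contra! hcon
  have hX : S ∪ X \ S = X := Finset.union_sdiff_of_subset h.sub
  have hd : Disjoint S (X \ S) := Finset.disjoint_sdiff
  have hc : S.card + (X \ S).card = X.card := by
    rw [← Finset.card_union_of_disjoint hd, hX]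
  have h1 : (X \ S).card * 12 ≤ ee G (X \ S) X := le_ee fun a ha => by
    rw [Finset.mem_sdiff] at ha
    exact hcon a ha.1 ha.2
  have h2 := ee_union_right (G := G) (C := X \ S) hd
  rw [hX] at h2
  have h3 := ee_self_union (G := G) hd
  rw [hX, ee_clique h.clique] at h3
  have h4 := h.sparse X subset_rfl (by have := h.eight_le_card; omega)
  rw [ee_comm (X \ S) S] at h2
  obtain ⟨v, hv⟩ := h.ne
  rw [Finset.mem_sdiff] at hv
  have h5 := hcon v hv.1 hv.2
  have h6 := dg_lt_card (G := G) hv.1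
  have h8 := h.card_le
  have h7 := h.sparse (X \ S) Finset.sdiff_subset (by omega)
  generalize S.card = s at *
  interval_cases s <;> omega

/-- The closed neighbourhood of `v`. -/
def cnb (G : SimpleGraph V) (X : Finset V) (v : V) : Finset V := insert v (X.filter (G.Adj v))

theorem mem_cnb {v w : V} : w ∈ cnb G X v ↔ w = v ∨ w ∈ X ∧ G.Adj v w := by
  simp [cnb]

/-- Components of the complement of a closed neighbourhood contain a vertex of degree at most 11
if the centre has degree at most 11. -/
theorem Setup.exists_low_of_isComp (h : Setup G X S) {u : V} (hu : u ∈ X) (huS : u ∉ S)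
    (hlow : dg G X u ≤ 11) {C : Finset V} (hC : IsComp G (X \ cnb G X u) C) :
    ∃ c ∈ C, dg G X c ≤ 11 := by
  by_contra! hcon
  set Y := (X.filter (G.Adj u)).filter fun y => ∃ c ∈ C, G.Adj c y with hY
  have hYX : Y ⊆ X := (Finset.filter_subset _ _).trans (Finset.filter_subset _ _)
  have hCX : C ⊆ X := hC.1.trans Finset.sdiff_subset
  have hCu : ∀ c ∈ C, c ≠ u ∧ ¬ G.Adj u c := fun c hc => by
    have := hC.1 hc
    rw [Finset.mem_sdiff, mem_cnb] at this
    exact ⟨fun h => this.2 (Or.inl h), fun h => this.2 (Or.inr ⟨this.1, h⟩)⟩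
  have hYu : ∀ y ∈ Y, G.Adj u y := fun y hy => by
    rw [hY, Finset.mem_filter, Finset.mem_filter] at hy
    exact hy.1.2
  have hCY : Disjoint C Y := Finset.disjoint_left.2 fun c hc hcY => (hCu c hc).2 (hYu c hcY)
  have hk : Y.card ≤ dg G X u := Finset.card_le_card (Finset.filter_subset _ _)
  have hnb : ∀ c ∈ C, dg G X c ≤ dg G (C ∪ Y) c := fun c hc =>
    Finset.card_le_card fun w hw => by
      rw [Finset.mem_filter] at hw
      rw [Finset.mem_filter, Finset.mem_union]
      refine ⟨?_, hw.2⟩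
      by_cases hwu : w ∈ X \ cnb G X u
      · exact Or.inl (hC.2.2 c hc w hwu hw.2)
      · right
        rw [Finset.mem_sdiff, mem_cnb, not_and_not_right] at hwu
        rcases hwu hw.1 with rfl | hwu
        · exact absurd hw.2.symm (hCu c hc).2
        · rw [hY, Finset.mem_filter, Finset.mem_filter]
          exact ⟨hwu, c, hc, hw.2⟩
  have h1 : C.card * 12 ≤ ee G C (C ∪ Y) := le_ee fun c hc => (Nat.succ_le_of_lt (hcon c hc)).trans (hnb c hc)
  rw [ee_union_right hCY] at h1
  have h2 : Y.card * (Y.card - 5) ≤ ee G Y Y := le_ee fun y hy => by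
    have h3 := (h.tri u y (hYu y hy) fun h => huS h.1).trans (h.common_le u y)
    have h4 : Y ∪ (X.filter (G.Adj u)) \ Y = X.filter (G.Adj u) :=
      Finset.union_sdiff_of_subset (Finset.filter_subset _ _)
    have h5 := dg_union (G := G) (A := Y) (B := (X.filter (G.Adj u)) \ Y)
      Finset.disjoint_sdiff y
    rw [h4] at h5
    have h6 := dg_le_card (G := G) ((X.filter (G.Adj u)) \ Y) y
    have h7 : Y.card + ((X.filter (G.Adj u)) \ Y).card = dg G X u := by
      rw [← Finset.card_union_of_disjoint Finset.disjoint_sdiff, h4]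
      rfl
    omega
  have hdu : Disjoint (C ∪ Y) {u} := by
    rw [Finset.disjoint_singleton_right, Finset.mem_union]
    rintro (hc | hy)
    · exact (hCu u hc).1 rfl
    · exact (hYu u hy).ne rfl
  have h3 := ee_self_union (G := G) hdu
  rw [ee_self_union hCY, ee_union_left hCY] at h3
  have h4 : Y.card * 1 ≤ ee G Y {u} :=
    le_ee fun y hy => (dg_singleton_of_adj (hYu y hy).symm).ge
  have hcard : (C ∪ Y ∪ {u}).card = C.card + Y.card + 1 := by
    rw [Finset.card_union_of_disjoint hdu, Finset.card_union_of_disjoint hCY,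
      Finset.card_singleton]
  obtain ⟨c, hc⟩ := hC.2.1.1
  have h6 : 12 ≤ C.card + Y.card := by
    rw [← Finset.card_union_of_disjoint hCY]
    exact (Nat.succ_le_of_lt (hcon c hc)).trans ((hnb c hc).trans (dg_le_card _ _))
  have h5 := h.sparse (C ∪ Y ∪ {u}) (Finset.union_subset (Finset.union_subset hCX hYX)
    (by simpa using hu)) (by omega)
  have h7 := ee_self_le (G := G) C
  have h8 := ee_le (G := G) C Y
  have h9 : 5 ≤ C.card → ee G C C + 38 ≤ 12 * C.card := h.sparse C hCX
  rw [hcard] at h5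
  have hk' : Y.card ≤ 11 := hk.trans hlow
  generalize Y.card = k at *
  generalize C.card = c at *
  by_cases hc5 : 5 ≤ c
  · have := h9 hc5
    interval_cases k <;> omega
  · interval_cases c <;> interval_cases k <;> omega

end

end CliqueMinor

namespace CliqueMinor

noncomputable section

open Classical

variable {V : Type} {G : SimpleGraph V} {X S : Finset V}

theorem adj_of_nbrs_subset {v w : V} (hw : w ∈ X) (hvw : G.Adj v w)
    (hsub : ∀ x ∈ X, G.Adj w x → x ∈ cnb G X v) (hle : dg G X v ≤ dg G X w) :
    ∀ x ∈ X, G.Adj v x → x ≠ w → G.Adj w x := by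
  have h1 : X.filter (G.Adj w) ⊆ (cnb G X v).erase w := fun x hx => by
    rw [Finset.mem_filter] at hx
    exact Finset.mem_erase.2 ⟨hx.2.ne', hsub x hx.1 hx.2⟩
  have h2 : ((cnb G X v).erase w).card = dg G X v := by
    rw [Finset.card_erase_of_mem (mem_cnb.2 (Or.inr ⟨hw, hvw⟩)), cnb,
      Finset.card_insert_of_notMem (by simp)]
    rfl
  have h3 := Finset.eq_of_subset_of_card_le h1 (h2.trans_le hle)
  intro x hx hvx hxw
  have : x ∈ X.filter (G.Adj w) := by
    rw [h3]
    exact Finset.mem_erase.2 ⟨hxw, mem_cnb.2 (Or.inr ⟨hx, hvx⟩)⟩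
  exact (Finset.mem_filter.1 this).2

theorem hasK8_of_complete {Y : Finset V} (h8 : 8 ≤ Y.card)
    (h : ∀ a ∈ Y, ∀ b ∈ Y, a ≠ b → G.Adj a b) : HasK8 G := by
  obtain ⟨Z, hZ, hZc⟩ := Finset.exists_subset_card_eq h8
  let e := (Finset.equivFinOfCardEq hZc).symm
  have hne : ∀ i j, i ≠ j → (e i : V) ≠ e j := fun i j hij h' =>
    hij (e.injective (Subtype.ext h'))
  refine ⟨fun i => {(e i : V)}, fun i => conn_singleton _, fun i j hij => ?_, fun i j hij => ?_⟩
  · simpa using hne i j hij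
  · exact ⟨e i, by simp, e j, by simp, h _ (hZ (e i).2) _ (hZ (e j).2) (hne i j hij)⟩

/-- There is a vertex `v` of degree at most 11 with a component `K` of `G - N[v]` such that all
neighbours of `v` are attached to `K` or adjacent to all other neighbours of `v`. -/
theorem Setup.exists_centre (h : Setup G X S) : ∃ v ∈ X, v ∉ S ∧ dg G X v ≤ 11 ∧
    ∃ K, IsComp G (X \ cnb G X v) K ∧ ∀ w ∈ X, G.Adj v w →
      Touch G {w} K ∨ ∀ x ∈ X, G.Adj v x → x ≠ w → G.Adj w x := by
  let pairs := (X ×ˢ X.powerset).filter fun p => p.1 ∉ S ∧ dg G X p.1 ≤ 11 ∧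
    IsComp G (X \ cnb G X p.1) p.2 ∧ Disjoint p.2 S
  by_cases hne : pairs.Nonempty
  · obtain ⟨⟨u, C⟩, hp, hmin⟩ := Finset.exists_min_image pairs (fun p => p.2.card) hne
    obtain ⟨hp, huS, hulow, hC, hCS⟩ := Finset.mem_filter.1 hp
    have hu : u ∈ X := (Finset.mem_product.1 hp).1
    dsimp only at huS hulow hC hCS hmin
    obtain ⟨c, hc, hclow⟩ := h.exists_low_of_isComp hu huS hulow hC
    obtain ⟨v, hv, hvmin⟩ := Finset.exists_min_image C (dg G X) ⟨c, hc⟩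
    have hCX : C ⊆ X := hC.1.trans Finset.sdiff_subset
    have hvS : v ∉ S := Finset.disjoint_left.1 hCS hv
    have hvu : v ∉ cnb G X u := (Finset.mem_sdiff.1 (hC.1 hv)).2
    have huv : u ∈ X \ cnb G X v := by
      rw [Finset.mem_sdiff, mem_cnb]
      refine ⟨hu, fun h' => hvu (mem_cnb.2 ?_)⟩
      exact h'.imp (fun h => h.symm) fun h => ⟨hCX hv, h.2.symm⟩
    obtain ⟨K, hK, huK⟩ := exists_isComp (G := G) huv
    refine ⟨v, hCX hv, hvS, (hvmin c hc).trans hclow, K, hK, fun w hw hvw => ?_⟩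
    by_contra! hcon
    obtain ⟨hwK, x₀, hx₀, hvx₀, hx₀w, hwx₀⟩ := hcon
    have hwu : w ∉ cnb G X u := by
      rw [mem_cnb]
      rintro (rfl | hwu)
      · exact hvu (mem_cnb.2 (Or.inr ⟨hCX hv, hvw.symm⟩))
      · exact hwK ⟨w, by simp, u, huK, hwu.2.symm⟩
    have hwC : w ∈ C := hC.2.2 v hv w (Finset.mem_sdiff.2 ⟨hw, hwu⟩) hvw
    have hsub : ¬ ∀ x ∈ X, G.Adj w x → x ∈ cnb G X v := fun hsub =>
      hwx₀ (adj_of_nbrs_subset hw hvw hsub (hvmin w hwC) x₀ hx₀ hvx₀ hx₀w)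
    push Not at hsub
    obtain ⟨x, hx, hwx, hxv⟩ := hsub
    have hxK : x ∉ K := fun hxK => hwK ⟨w, by simp, x, hxK, hwx⟩
    have hx' : x ∈ X \ cnb G X v := Finset.mem_sdiff.2 ⟨hx, hxv⟩
    obtain ⟨K', hK', hxK'⟩ := exists_isComp (G := G) hx'
    have hKK' : ∀ y ∈ K', y ∉ K := fun y hy hyK =>
      hxK (hK.subset_of_conn hK'.2.1 hK'.1 hy hyK hxK')
    have hK'u : K' ⊆ X \ cnb G X u := fun y hy => by
      have hyX := hK'.1 hy
      refine Finset.mem_sdiff.2 ⟨(Finset.mem_sdiff.1 hyX).1, ?_⟩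
      rw [mem_cnb]
      rintro (rfl | hyu)
      · exact hKK' _ hy huK
      · exact hKK' y hy (hK.2.2 u huK y hyX hyu.2)
    have hxC : x ∈ C := hC.2.2 w hwC x (hK'u hxK') hwx
    have hK'C : K' ⊆ C := hC.subset_of_conn hK'.2.1 hK'u hxK' hxC
    have hlt : K'.card < C.card := Finset.card_lt_card
      ⟨hK'C, fun h' => (Finset.mem_sdiff.1 (hK'.1 (h' hv))).2 (mem_cnb.2 (Or.inl rfl))⟩
    refine absurd (hmin (v, K') ?_) (not_le.2 hlt)
    refine Finset.mem_filter.2 ⟨Finset.mem_product.2 ⟨hCX hv, ?_⟩, hvS,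
      (hvmin c hc).trans hclow, hK', hCS.mono_left hK'C⟩
    exact Finset.mem_powerset.2 (hK'.1.trans Finset.sdiff_subset)
  · obtain ⟨v, hv, hmin⟩ := Finset.exists_min_image (X \ S) (dg G X) h.ne
    obtain ⟨v₀, hv₀, hv₀S, hlow⟩ := h.exists_low
    have hvlow := (hmin v₀ (Finset.mem_sdiff.2 ⟨hv₀, hv₀S⟩)).trans hlow
    rw [Finset.mem_sdiff] at hv
    have hS : ∀ K, IsComp G (X \ cnb G X v) K → ∃ s ∈ K, s ∈ S := by
      intro K hK
      by_contra! hcon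
      refine hne ⟨(v, K), Finset.mem_filter.2 ⟨Finset.mem_product.2 ⟨hv.1, ?_⟩, hv.2, hvlow, hK,
        Finset.disjoint_left.2 hcon⟩⟩
      exact Finset.mem_powerset.2 (hK.1.trans Finset.sdiff_subset)
    have hempty : (X \ cnb G X v).Nonempty := by
      by_contra hempty
      rw [Finset.not_nonempty_iff_eq_empty, Finset.sdiff_eq_empty_iff_subset] at hempty
      refine h.no_K8 (hasK8_of_complete h.eight_le_card fun a ha b hb hab => ?_)
      have hadj : ∀ w ∈ X, w ∉ S → ∀ x ∈ X, x ≠ w → G.Adj w x := by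
        intro w hw hwS x hx hxw
        have hvx := mem_cnb.1 (hempty hx)
        rcases mem_cnb.1 (hempty hw) with rfl | hvw
        · rcases hvx with rfl | hvx
          exacts [absurd rfl hxw, hvx.2]
        · rcases hvx with rfl | hvx
          · exact hvw.2.symm
          · exact adj_of_nbrs_subset hw hvw.2 (fun y hy _ => hempty hy)
              (hmin w (Finset.mem_sdiff.2 ⟨hw, hwS⟩)) x hx hvx.2 hxw
      by_cases haS : a ∈ S
      · by_cases hbS : b ∈ S
        · exact h.clique a haS b hbS hab
        · exact (hadj b hb hbS a ha hab).symm
      · exact hadj a ha haS b hb hab.symm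
    obtain ⟨k, hk⟩ := hempty
    obtain ⟨K, hK, hkK⟩ := exists_isComp (G := G) hk
    obtain ⟨s, hsK, hsS⟩ := hS K hK
    refine ⟨v, hv.1, hv.2, hvlow, K, hK, fun w hw hvw => ?_⟩
    by_contra! hcon
    obtain ⟨hwK, x₀, hx₀, hvx₀, hx₀w, hwx₀⟩ := hcon
    have hwS : w ∉ S := fun hwS => hwK ⟨w, by simp, s, hsK, h.clique w hwS s hsS (by
      rintro rfl
      exact (Finset.mem_sdiff.1 (hK.1 hsK)).2 (mem_cnb.2 (Or.inr ⟨hw, hvw⟩)))⟩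
    refine hwx₀ (adj_of_nbrs_subset hw hvw (fun x hx hwx => ?_)
      (hmin w (Finset.mem_sdiff.2 ⟨hw, hwS⟩)) x₀ hx₀ hvx₀ hx₀w)
    by_contra hxv
    obtain ⟨K', hK', hxK'⟩ := exists_isComp (G := G) (Finset.mem_sdiff.2 ⟨hx, hxv⟩)
    obtain ⟨s', hs'K', hs'S⟩ := hS K' hK'
    have hs'K : s' ∈ K := by
      by_cases hss : s = s'
      · exact hss ▸ hsK
      · exact hK.2.2 s hsK s' (hK'.1 hs'K') (h.clique s hsS s' hs'S hss)
    exact hwK ⟨w, by simp, x, hK.subset_of_conn hK'.2.1 hK'.1 hs'K' hs'K hxK', hwx⟩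

end

end CliqueMinor

namespace CliqueMinor

noncomputable section

open Classical

variable {V : Type} {G : SimpleGraph V} {X S : Finset V}

/-! ### The neighbourhood of the centre -/

theorem exists_enumerates {Y : Finset V} (hY : Y.Nonempty) : ∃ σ, Enumerates Y Y.card σ := by
  obtain ⟨y, _⟩ := hY
  refine ⟨fun i => if hi : i < Y.card then (Y.equivFin.symm ⟨i, hi⟩ : V) else y, fun i hi => ?_,
    fun i hi j hj hij => ?_⟩
  · simp only [dif_pos hi]
    exact (Y.equivFin.symm ⟨i, hi⟩).2
  · simp only [dif_pos hi, dif_pos hj] at hij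
    simpa using Y.equivFin.symm.injective (Subtype.ext hij)

theorem Enumerates.exists_eq {Y : Finset V} {σ : ℕ → V} (h : Enumerates Y Y.card σ) {y : V}
    (hy : y ∈ Y) : ∃ i < Y.card, σ i = y := by
  have h1 : (Finset.range Y.card).image σ = Y := by
    refine Finset.eq_of_subset_of_card_le (fun x hx => ?_) ?_
    · obtain ⟨i, hi, rfl⟩ := Finset.mem_image.1 hx
      exact h.1 i (Finset.mem_range.1 hi)
    · rw [Finset.card_image_of_injOn, Finset.card_range]
      intro i hi j hj hij
      exact h.2 i (by simpa using hi) j (by simpa using hj) hij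
  rw [← h1] at hy
  obtain ⟨i, hi, hiy⟩ := Finset.mem_image.1 hy
  exact ⟨i, Finset.mem_range.1 hi, hiy⟩

theorem Setup.card_nonadj_le (h : Setup G X S) {v : V} (hvS : v ∉ S) {σ : ℕ → V}
    (hσ : Enumerates (X.filter (G.Adj v)) (dg G X v) σ) {i : ℕ} (hi : i < dg G X v) :
    ((Finset.range (dg G X v)).filter fun j => i ≠ j ∧ ¬ G.Adj (σ i) (σ j)).card
      ≤ dg G X v - 7 := by
  have hvi := (Finset.mem_filter.1 (hσ.1 i hi)).2
  have h1 := (h.tri v _ hvi fun h => hvS h.1).trans (h.common_le v (σ i))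
  set Y := X.filter (G.Adj v) with hY
  have h2 : (((Finset.range (dg G X v)).filter fun j => i ≠ j ∧ ¬ G.Adj (σ i) (σ j)).image σ).card
      = ((Finset.range (dg G X v)).filter fun j => i ≠ j ∧ ¬ G.Adj (σ i) (σ j)).card := by
    refine Finset.card_image_of_injOn fun a ha b hb hab => ?_
    simp only [Finset.coe_filter, Finset.mem_range, Set.mem_ofPred_eq] at ha hb
    exact hσ.2 a ha.1 b hb.1 hab
  have h3 : (((Finset.range (dg G X v)).filter fun j => i ≠ j ∧ ¬ G.Adj (σ i) (σ j)).image σ)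
      ⊆ (Y.filter fun x => ¬ G.Adj (σ i) x).erase (σ i) := by
    intro x hx
    obtain ⟨j, hj, rfl⟩ := Finset.mem_image.1 hx
    rw [Finset.mem_filter, Finset.mem_range] at hj
    exact Finset.mem_erase.2 ⟨fun hji => hj.2.1 (hσ.2 j hj.1 i hi hji).symm,
      Finset.mem_filter.2 ⟨hσ.1 j hj.1, hj.2.2⟩⟩
  have h4 := Finset.card_le_card h3
  rw [Finset.card_erase_of_mem (by simpa using hσ.1 i hi)] at h4
  have h5 := Finset.card_filter_add_card_filter_not (s := Y) (G.Adj (σ i))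
  change dg G Y (σ i) + _ = dg G X v at h5
  omega

/-- A star model of `K₆` in the neighbourhood of `v` missing one vertex extends to a `K₈` minor. -/
theorem hasK8_of_starModel {v : V} {K : Finset V} (hK : IsComp G (X \ cnb G X v) K)
    (hdom : ∀ w ∈ X, G.Adj v w → Touch G {w} K ∨ ∀ x ∈ X, G.Adj v x → x ≠ w → G.Adj w x)
    {m : ℕ} {σ : ℕ → V} (hσ : Enumerates (X.filter (G.Adj v)) m σ) {a : ℕ → ℕ}
    (ha : ∃ y < m, 6 ≤ a y) (hs : StarModel m 6 (fun i j => G.Adj (σ i) (σ j)) a) : HasK8 G := by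
  obtain ⟨y, hy, hay⟩ := ha
  have hσX : ∀ i < m, σ i ∈ X ∧ G.Adj v (σ i) := fun i hi => Finset.mem_filter.1 (hσ.1 i hi)
  have hKv : ∀ w ∈ K, w ≠ v ∧ ∀ i < m, w ≠ σ i := fun w hw => by
    have := (Finset.mem_sdiff.1 (hK.1 hw)).2
    rw [mem_cnb] at this
    refine ⟨fun h => this (Or.inl h), ?_⟩
    rintro i hi rfl
    exact this (Or.inr (hσX i hi))
  let f : ℕ → Finset V := fun i => if i = m then {v} else
    if i = y ∧ Touch G {σ y} K then {σ y} ∪ K else {σ i}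
  let a' : ℕ → ℕ := fun i => if i = m then 7 else if i = y then 6 else
    if 6 ≤ a i then a i + 2 else a i
  have hfm : f m = {v} := if_pos rfl
  have hsub : ∀ i < m, σ i ∈ f i := by
    intro i hi
    simp only [f, if_neg hi.ne]
    split_ifs with h
    · simp [h.1]
    · simp
  have hmem : ∀ i < m, ∀ x ∈ f i, x = σ i ∨ i = y ∧ x ∈ K := by
    intro i hi x hx
    simp only [f, if_neg hi.ne] at hx
    split_ifs at hx with h
    · rw [Finset.mem_union, Finset.mem_singleton] at hx
      rcases hx with hx | hx
      · exact Or.inl (h.1 ▸ hx)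
      · exact Or.inr ⟨h.1, hx⟩
    · exact Or.inl (Finset.mem_singleton.1 hx)
  have ha'm : a' m = 7 := if_pos rfl
  have ha'y : a' y = 6 := by simp [a', hy.ne]
  have ha'lt : ∀ i < m, ∀ c < 6, a i = c → a' i = c := by
    intro i hi c hc hic
    have : i ≠ y := by
      rintro rfl
      omega
    simp only [a', if_neg hi.ne, if_neg this]
    rw [if_neg (by omega), hic]
  have ha'rev : ∀ i < m + 1, ∀ c < 6, a' i = c → i < m ∧ a i = c := by
    intro i hi c hc hic
    simp only [a'] at hic
    split_ifs at hic <;> omega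
  have htouch : ∀ i < m, ∀ j < m, G.Adj (σ i) (σ j) → Touch G (f i) (f j) :=
    fun i hi j hj hij => ⟨_, hsub i hi, _, hsub j hj, hij⟩
  have hv : ∀ i < m, Touch G (f m) (f i) := fun i hi =>
    ⟨v, by simp [hfm], _, hsub i hi, (hσX i hi).2⟩
  refine StarModel.hasK8 (m := m + 1) (a := a') (f := f) ⟨fun c hc => ?_, fun c hc d hdc => ?_⟩
    (fun i hi => ?_) (fun i hi j hj hij => ?_)
  · by_cases hc6 : c < 6
    · obtain ⟨i, hi, hic, hstar⟩ := hs.1 c hc6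
      refine ⟨i, by omega, ha'lt i hi c hc6 hic, fun j hj hjc => ?_⟩
      obtain ⟨hjm, hjc⟩ := ha'rev j hj c hc6 hjc
      exact (hstar j hjm hjc).imp id fun h => htouch i hi j hjm h
    · obtain rfl | rfl : c = 6 ∨ c = 7 := by omega
      · refine ⟨y, by omega, ha'y, fun j hj hj6 => Or.inl ?_⟩
        simp only [a'] at hj6
        split_ifs at hj6 <;> omega
      · refine ⟨m, by omega, ha'm, fun j hj hj7 => Or.inl ?_⟩
        simp only [a'] at hj7
        split_ifs at hj7 <;> omega
  · by_cases hc6 : c < 6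
    · obtain ⟨i, hi, j, hj, hic, hjd, hij⟩ := hs.2 c hc6 d hdc
      exact ⟨i, by omega, j, by omega, ha'lt i hi c hc6 hic, ha'lt j hj d (by omega) hjd,
        htouch i hi j hj hij⟩
    · obtain rfl | rfl : c = 6 ∨ c = 7 := by omega
      · obtain ⟨i, hi, hid, -⟩ := hs.1 d hdc
        refine ⟨y, by omega, i, by omega, ha'y, ha'lt i hi d hdc hid, ?_⟩
        have hiy : i ≠ y := by
          rintro rfl
          omega
        have hne : σ i ≠ σ y := fun h => hiy (hσ.2 i hi y hy h)
        by_cases hyK : Touch G {σ y} K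
        · rcases hdom (σ i) (hσX i hi).1 (hσX i hi).2 with hiK | hi'
          · refine (hiK.mono (by simpa using hsub i hi) ?_).symm
            simp only [f, if_neg hy.ne]
            rw [if_pos ⟨trivial, hyK⟩]
            exact Finset.subset_union_right
          · exact htouch y hy i hi (hi' _ (hσX y hy).1 (hσX y hy).2 hne.symm).symm
        · have := (hdom (σ y) (hσX y hy).1 (hσX y hy).2).resolve_left hyK
          exact htouch y hy i hi (this _ (hσX i hi).1 (hσX i hi).2 hne)
      · by_cases hd6 : d < 6
        · obtain ⟨i, hi, hid, -⟩ := hs.1 d hd6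
          exact ⟨m, by omega, i, by omega, ha'm, ha'lt i hi d hd6 hid, hv i hi⟩
        · obtain rfl : d = 6 := by omega
          exact ⟨m, by omega, y, by omega, ha'm, ha'y, hv y hy⟩
  · by_cases him : i = m
    · rw [him, hfm]
      exact conn_singleton v
    · simp only [f, if_neg him]
      split_ifs with h
      · exact (conn_singleton _).union hK.2.1 h.2
      · exact conn_singleton _
  · have key : ∀ i < m, v ∉ f i := by
      intro i hi hvi
      rcases hmem i hi v hvi with h | h
      · exact (hσX i hi).2.ne h
      · exact (hKv v h.2).1 rfl
    rw [Finset.disjoint_left]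
    intro x hxi hxj
    by_cases him : i = m
    · rw [him, hfm, Finset.mem_singleton] at hxi
      exact key j (by omega) (hxi ▸ hxj)
    · by_cases hjm : j = m
      · rw [hjm, hfm, Finset.mem_singleton] at hxj
        exact key i (by omega) (hxj ▸ hxi)
      · rcases hmem i (by omega) x hxi with h | h <;> rcases hmem j (by omega) x hxj with h' | h'
        · exact hij (hσ.2 i (by omega) j (by omega) (h.symm.trans h'))
        · exact (hKv x h'.2).2 i (by omega) h
        · exact (hKv x h.2).2 j (by omega) h'
        · exact hij (h.1.trans h'.1.symm)

/-- The pair `(i, j)` occurs in the list `F`, in one of the two orders. -/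
def inPairs (F : List (ℕ × ℕ)) (i j : ℕ) : Bool :=
  F.any fun e => Nat.beq e.1 i && Nat.beq e.2 j || Nat.beq e.1 j && Nat.beq e.2 i

theorem inPairs_iff {F : List (ℕ × ℕ)} {i j : ℕ} :
    inPairs F i j = true ↔ (i, j) ∈ F ∨ (j, i) ∈ F := by
  simp only [inPairs, List.any_eq_true, Bool.or_eq_true, Bool.and_eq_true, Nat.beq_eq, Prod.exists]
  constructor
  · rintro ⟨a, b, h, ⟨rfl, rfl⟩ | ⟨rfl, rfl⟩⟩
    exacts [Or.inl h, Or.inr h]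
  · rintro (h | h)
    exacts [⟨i, j, h, Or.inl ⟨rfl, rfl⟩⟩, ⟨j, i, h, Or.inr ⟨rfl, rfl⟩⟩]

/-- The non-edges of `K₂,₂,₂,₂`. -/
def pairsEight : List (ℕ × ℕ) := [(0, 1), (2, 3), (4, 5), (6, 7)]

/-- The non-edges of `K₃,₃,₃`. -/
def pairsNine : List (ℕ × ℕ) :=
  [(0, 1), (0, 2), (1, 2), (3, 4), (3, 5), (4, 5), (6, 7), (6, 8), (7, 8)]

/-- The edges of the Petersen graph. -/
def pairsTen : List (ℕ × ℕ) :=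
  [(0, 1), (1, 2), (2, 3), (3, 4), (0, 4), (0, 5), (1, 6), (2, 7), (3, 8), (4, 9), (5, 7), (7, 9),
    (6, 9), (6, 8), (5, 8)]

/-- `v` is a vertex with neighbours `σ 0, …, σ (m - 1)`, the non-edges between which are the pairs
in `F`, and `K` is a component of `G - N[v]` to which all neighbours of `v` are attached. -/
structure Exceptional (G : SimpleGraph V) (X S : Finset V) (m : ℕ) (F : List (ℕ × ℕ))
    (v : V) (K : Finset V) (σ : ℕ → V) : Prop where
  mem : v ∈ X
  not_mem : v ∉ S
  dg_eq : dg G X v = m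
  comp : IsComp G (X \ cnb G X v) K
  enum : Enumerates (X.filter (G.Adj v)) m σ
  adj_iff : ∀ i < m, ∀ j < m, i ≠ j → (G.Adj (σ i) (σ j) ↔ inPairs F i j = false)
  touch : ∀ i < m, Touch G {σ i} K
  loopless : ∀ i < m, inPairs F i i = false

theorem Setup.exceptional_of_pairs (h : Setup G X S) {v : V} (hv : v ∈ X) (hvS : v ∉ S)
    {K : Finset V} (hK : IsComp G (X \ cnb G X v) K)
    (hdom : ∀ w ∈ X, G.Adj v w → Touch G {w} K ∨ ∀ x ∈ X, G.Adj v x → x ≠ w → G.Adj w x)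
    {m : ℕ} (hm : dg G X v = m) {F : List (ℕ × ℕ)} (hm7 : 7 < m)
    (hF : (allLT (fun i => !inPairs F i i && Nat.ble (m - 7) (countLT (inPairs F i) m)) m) = true)
    {σ : ℕ → V} (hσ : Enumerates (X.filter (G.Adj v)) m σ)
    (hσF : ∀ e ∈ F, ¬ G.Adj (σ e.1) (σ e.2)) : Exceptional G X S m F v K σ := by
  subst hm
  simp only [allLT_iff, Bool.and_eq_true, Bool.not_eq_true', Nat.ble_eq] at hF
  have hnon : ∀ i j, inPairs F i j = true → ¬ G.Adj (σ i) (σ j) := by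
    intro i j hij
    rcases inPairs_iff.1 hij with h' | h'
    · exact hσF _ h'
    · exact fun hadj => hσF _ h' hadj.symm
  have hcard : ∀ i < dg G X v, dg G X v - 7 ≤
      ((Finset.range (dg G X v)).filter fun j => inPairs F i j = true).card := fun i hi =>
    (hF i hi).2.trans (countLT_le fun _ _ h => h)
  refine ⟨hv, hvS, rfl, hK, hσ, fun i hi j hj hij => ?_, fun i hi => ?_, fun i hi => (hF i hi).1⟩
  · refine ⟨fun hadj => ?_, fun hij' => ?_⟩
    · rw [← Bool.not_eq_true]
      exact fun h' => hnon i j h' hadj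
    · by_contra hcon
      have h1 : (Finset.range (dg G X v)).filter (fun j => inPairs F i j = true) ⊆
          (Finset.range (dg G X v)).filter fun j => i ≠ j ∧ ¬ G.Adj (σ i) (σ j) := by
        intro k hk
        rw [Finset.mem_filter] at hk ⊢
        refine ⟨hk.1, ?_, hnon i k hk.2⟩
        rintro rfl
        simp [(hF i hi).1] at hk
      have h2 := Finset.eq_of_subset_of_card_le h1
        ((h.card_nonadj_le hvS hσ hi).trans (hcard i hi))
      have h3 : j ∈ (Finset.range (dg G X v)).filter fun j => i ≠ j ∧ ¬ G.Adj (σ i) (σ j) :=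
        Finset.mem_filter.2 ⟨Finset.mem_range.2 hj, hij, hcon⟩
      rw [← h2, Finset.mem_filter, hij'] at h3
      simp at h3
  · have hi' := Finset.mem_filter.1 (hσ.1 i hi)
    refine (hdom _ hi'.1 hi'.2).resolve_right fun hcon => ?_
    have h1 := hcard i hi
    obtain ⟨j, hj⟩ := Finset.card_pos.1 (lt_of_lt_of_le (by omega) h1)
    rw [Finset.mem_filter, Finset.mem_range] at hj
    have hj' := Finset.mem_filter.1 (hσ.1 j hj.1)
    refine hnon i j hj.2 (hcon _ hj'.1 hj'.2 fun hji => ?_)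
    rw [hσ.2 j hj.1 i hi hji, (hF i hi).1] at hj
    simp at hj

theorem Setup.exists_exceptional (h : Setup G X S) : ∃ v K σ,
    Exceptional G X S 8 pairsEight v K σ ∨ Exceptional G X S 9 pairsNine v K σ ∨
      Exceptional G X S 10 pairsTen v K σ := by
  obtain ⟨v, hv, hvS, hle, K, hK, hdom⟩ := h.exists_centre
  have hge := h.seven_le hv hvS
  obtain ⟨σ₀, hσ₀⟩ := exists_enumerates (Y := X.filter (G.Adj v))
    (Finset.card_pos.1 (show 0 < dg G X v by omega))
  change Enumerates _ (dg G X v) _ at hσ₀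
  have key : ∀ m F C N, dg G X v = m → certCheck m F C N = true → F ≠ [] ∧
      ∃ σ, Enumerates (X.filter (G.Adj v)) m σ ∧ ∀ e ∈ F, ¬ G.Adj (σ e.1) (σ e.2) := by
    intro m F C N hm hC
    subst hm
    by_contra! hcon
    refine false_of_certCheck (r := G.Adj) (fun _ _ h => h.symm)
      (fun σ hσ i hi => h.card_nonadj_le hvS hσ hi) (fun σ hσ a ha hs =>
        h.no_K8 (hasK8_of_starModel hK hdom hσ ha hs)) (fun hF σ hσ hall => ?_) hC hσ₀
    obtain ⟨e, he, hadj⟩ := hcon hF σ hσ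
    exact hall e he hadj
  generalize hm : dg G X v = m at *
  have : m = 7 ∨ m = 8 ∨ m = 9 ∨ m = 10 ∨ m = 11 := by omega
  rcases this with rfl | rfl | rfl | rfl | rfl
  · exact absurd rfl (key _ _ _ _ rfl certCheck_seven).1
  · obtain ⟨-, σ, hσ, hF⟩ := key _ pairsEight _ _ rfl certCheck_eight
    exact ⟨v, K, σ, Or.inl
      (h.exceptional_of_pairs hv hvS hK hdom hm (by norm_num) (by decide +kernel) hσ hF)⟩
  · obtain ⟨-, σ, hσ, hF⟩ := key _ pairsNine _ _ rfl certCheck_nine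
    exact ⟨v, K, σ, Or.inr (Or.inl
      (h.exceptional_of_pairs hv hvS hK hdom hm (by norm_num) (by decide +kernel) hσ hF))⟩
  · obtain ⟨-, σ, hσ, hF⟩ := key _ pairsTen _ _ rfl certCheck_ten
    exact ⟨v, K, σ, Or.inr (Or.inr
      (h.exceptional_of_pairs hv hvS hK hdom hm (by norm_num) (by decide +kernel) hσ hF))⟩
  · exact absurd rfl (key _ _ _ _ rfl certCheck_eleven).1

end

end CliqueMinor

namespace CliqueMinor

/-! ### Properties of the exceptional neighbourhoods -/

section Shape

variable (m : ℕ) (F E : List (ℕ × ℕ)) (T : List ℕ)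

/-- No pair of `F` has both entries in the set `p`. -/
def isFree (p : ℕ → Bool) : Bool := F.all fun e => !(p e.1 && p e.2)

/-- The number of pairs of `E` with both entries in the set `p`. -/
def pairsIn (p : ℕ → Bool) : ℕ := E.countP fun e => p e.1 && p e.2

/-- Some member of `T` lists two pairs of indices, one contained in `p` and one in `q`. -/
def isLinked (p q : ℕ → Bool) : Bool :=
  T.any fun t => p (hexDigit t 0) && (p (hexDigit t 1) && (q (hexDigit t 2) && q (hexDigit t 3))) ||
    q (hexDigit t 0) && (q (hexDigit t 1) && (p (hexDigit t 2) && p (hexDigit t 3)))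

/-- The member `t` of `T` lists a model of `K₇` in the graph with non-edges `F`, after adding the
two pairs it starts with. -/
def modelCheck (t : ℕ) : Bool :=
  Nat.blt (hexDigit t 0) m && (Nat.blt (hexDigit t 1) m && (Nat.blt (hexDigit t 2) m &&
    (Nat.blt (hexDigit t 3) m &&
    starCheck m 7 (fun i j => !inPairs F i j || inPairs [(hexDigit t 0, hexDigit t 1),
      (hexDigit t 2, hexDigit t 3)] i j) fun i => hexDigit t (4 + i))))

/-- The number of common neighbours of `i` and `j` in the graph with non-edges `F`. -/
def commonLT (i j : ℕ) : ℕ :=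
  countLT (fun k => !Nat.beq k i && (!Nat.beq k j && (!inPairs F i k && !inPairs F j k))) m

/-- The facts about the graph on `{0, …, m - 1}` with edges `E` and non-edges `F` used in the main
argument. -/
structure Shape (d c M : ℕ) : Prop where
  card_le : ∀ p : ℕ → Bool, (∀ i, m ≤ i → p i = false) → isFree F p = true → countLT p m ≤ 4
  pairsIn_le : ∀ p : ℕ → Bool, (∀ i, m ≤ i → p i = false) → isFree F p = true → pairsIn E p ≤ c
  add_le : ∀ p q : ℕ → Bool, (∀ i, m ≤ i → p i = false) → (∀ i, m ≤ i → q i = false) →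
    isFree F p = false → isFree F q = false → isLinked T p q = false →
    (∀ i < m, p i = true ∨ q i = true) → pairsIn E p + pairsIn E q ≤ M
  edge : ∀ e ∈ E, e.1 < m ∧ e.2 < m ∧ e.1 ≠ e.2 ∧ inPairs F e.1 e.2 = false ∧
    commonLT m F e.1 e.2 ≤ d
  model : ∀ t ∈ T, modelCheck m F t = true
  linked : ∀ e ∈ F, isLinked T (fun i => Nat.blt i m) (fun i => Nat.beq i e.1 || Nat.beq i e.2) = true

/-- Boolean test for `Shape`, where `k` is a threshold speeding up the test. -/
def shapeCheck (d c M k : ℕ) : Bool :=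
  allLT (fun A => !isFree F A.testBit ||
      Nat.ble (countLT A.testBit m) 4 && Nat.ble (pairsIn E A.testBit) c) (2 ^ m) &&
  (allLT (fun A => Nat.ble (pairsIn E A.testBit) k || (isFree F A.testBit ||
      (F.all (fun e => isLinked T A.testBit fun i => Nat.beq i e.1 || Nat.beq i e.2) ||
      allLT (fun B => !allLT (fun i => A.testBit i || B.testBit i) m || (isFree F B.testBit ||
        (isLinked T A.testBit B.testBit ||
          Nat.ble (pairsIn E A.testBit + pairsIn E B.testBit) M))) (2 ^ m)))) (2 ^ m) &&
  (E.all (fun e => Nat.blt e.1 m && (Nat.blt e.2 m && (!Nat.beq e.1 e.2 &&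
    (!inPairs F e.1 e.2 && Nat.ble (commonLT m F e.1 e.2) d)))) &&
  (T.all (modelCheck m F) &&
  (F.all (fun e => isLinked T (fun i => Nat.blt i m) fun i => Nat.beq i e.1 || Nat.beq i e.2) &&
  Nat.ble (2 * k) M))))

variable {m F E T}

theorem isLinked_mono {p q q' : ℕ → Bool} (h : isLinked T p q = true)
    (hq : ∀ i, q i = true → q' i = true) : isLinked T p q' = true := by
  simp only [isLinked, List.any_eq_true, Bool.or_eq_true, Bool.and_eq_true] at h ⊢
  obtain ⟨t, ht, h | h⟩ := h
  · exact ⟨t, ht, Or.inl ⟨h.1, h.2.1, hq _ h.2.2.1, hq _ h.2.2.2⟩⟩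
  · exact ⟨t, ht, Or.inr ⟨hq _ h.1, hq _ h.2.1, h.2.2.1, h.2.2.2⟩⟩

theorem isLinked_comm {p q : ℕ → Bool} : isLinked T p q = isLinked T q p := by
  simp only [isLinked, Bool.or_comm]

theorem exists_testBit {p : ℕ → Bool} (hp : ∀ i, m ≤ i → p i = false) :
    ∃ A < 2 ^ m, p = A.testBit := by
  refine ⟨Nat.ofBits fun i : Fin m => p i, Nat.ofBits_lt_two_pow _, funext fun i => ?_⟩
  by_cases hi : i < m
  · rw [Nat.testBit_ofBits_lt _ _ hi]
  · rw [Nat.testBit_ofBits_ge _ _ (by omega), hp i (by omega)]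

theorem shape_of_shapeCheck {d c M k : ℕ} (h : shapeCheck m F E T d c M k = true) :
    Shape m F E T d c M := by
  simp only [shapeCheck, Bool.and_eq_true, allLT_iff, List.all_eq_true, Nat.blt_eq, Nat.ble_eq,
    Bool.not_eq_true', beq_eq_false, Bool.or_eq_true] at h
  obtain ⟨h1, h2, h3, h4, h5, h6⟩ := h
  have add_le : ∀ p q : ℕ → Bool, (∀ i, m ≤ i → p i = false) → (∀ i, m ≤ i → q i = false) →
      isFree F p = false → isFree F q = false → isLinked T p q = false →
      (∀ i < m, p i = true ∨ q i = true) → k < pairsIn E p → pairsIn E p + pairsIn E q ≤ M := by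
    intro p q hp hq hpF hqF hl hcov hk
    obtain ⟨A, hA, rfl⟩ := exists_testBit hp
    obtain ⟨B, hB, rfl⟩ := exists_testBit hq
    rcases h2 A hA with h | h | h | h
    · omega
    · rw [hpF] at h
      cases h
    · rw [isFree, List.all_eq_false] at hqF
      obtain ⟨e, he, heB⟩ := hqF
      rw [Bool.not_eq_true', Bool.not_eq_false, Bool.and_eq_true] at heB
      have := isLinked_mono (h e he) (q' := B.testBit) fun i hi => by
        simp only [Bool.or_eq_true, Nat.beq_eq] at hi
        rcases hi with rfl | rfl
        exacts [heB.1, heB.2]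
      rw [hl] at this
      cases this
    · have h := h B hB
      rw [← Bool.not_eq_true, allLT_iff] at h
      simp only [Bool.or_eq_true, hqF, hl, Bool.false_eq_true, false_or] at h
      exact h.resolve_left fun h => h hcov
  refine ⟨fun p hp hpF => ?_, fun p hp hpF => ?_, fun p q hp hq hpF hqF hl hcov => ?_, h3, h4, h5⟩
  · obtain ⟨A, hA, rfl⟩ := exists_testBit hp
    rcases h1 A hA with h | h
    · rw [hpF] at h
      cases h
    · exact h.1
  · obtain ⟨A, hA, rfl⟩ := exists_testBit hp
    rcases h1 A hA with h | h
    · rw [hpF] at h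
      cases h
    · exact h.2
  · by_cases hk : k < pairsIn E p
    · exact add_le p q hp hq hpF hqF hl hcov hk
    · by_cases hk' : k < pairsIn E q
      · rw [add_comm]
        exact add_le q p hq hp hqF hpF (isLinked_comm.trans hl) (fun i hi => (hcov i hi).symm) hk'
      · omega

end Shape

/-- The edges of `K₂,₂,₂,₂`. -/
def edgesEight : List (ℕ × ℕ) :=
  [(2, 0), (2, 1), (3, 0), (3, 1), (4, 0), (4, 1), (4, 2), (4, 3), (5, 0), (5, 1), (5, 2),
    (5, 3), (6, 0), (6, 1), (6, 2), (6, 3), (6, 4), (6, 5), (7, 0), (7, 1), (7, 2), (7, 3),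
    (7, 4), (7, 5)]

/-- Models of `K₇` in `K₂,₂,₂,₂` with two additional edges. -/
def modelsEight : List ℕ :=
  [111481011057168, 111340082451472, 92785823741456, 111338997175346, 92784738465330,
    92575358809684]

/-- The edges of `K₃,₃,₃`. -/
def edgesNine : List (ℕ × ℕ) :=
  [(3, 0), (3, 1), (3, 2), (4, 0), (4, 1), (4, 2), (5, 0), (5, 1), (5, 2), (6, 0), (6, 1),
    (6, 2), (6, 3), (6, 4), (6, 5), (7, 0), (7, 1), (7, 2), (7, 3), (7, 4), (7, 5), (8, 0),
    (8, 1), (8, 2), (8, 3), (8, 4), (8, 5)]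

/-- Models of `K₇` in `K₃,₃,₃` with two additional edges. -/
def modelsNine : List ℕ :=
  [1781634660582160, 1781441387057936, 1781425280930832, 1762951552857616, 1235185971529232,
    1185707948279568, 1781634597667616, 1781441324143392, 1781425218016288, 1762951489943072,
    1235185908614688, 1185707885365024, 1781634592752417, 1781441319228193, 1781425213101089,
    1762951485027873, 1235185903699489, 1185707880449825, 1762869701015107, 1235104119686723,
    1185626096437059, 1762676427486803, 1234910846158419, 1185432822908755, 1762660321359444,
    1234894740031060, 1185416716781396]

/-- The edges of the complement of the Petersen graph. -/
def edgesTen : List (ℕ × ℕ) :=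
  [(2, 0), (3, 0), (3, 1), (4, 1), (4, 2), (5, 1), (5, 2), (5, 3), (5, 4), (6, 0), (6, 2),
    (6, 3), (6, 4), (6, 5), (7, 0), (7, 1), (7, 3), (7, 4), (7, 6), (8, 0), (8, 1), (8, 2),
    (8, 4), (8, 7), (9, 0), (9, 1), (9, 2), (9, 3), (9, 5), (9, 8)]

/-- Models of `K₇` in the complement of the Petersen graph with two additional edges. -/
def modelsTen : List ℕ :=
  [28769083123053072, 28769083123057424, 28769018698560016, 15310996374590480, 28769018698560784,
    15310996374590992, 27907067080640016, 27907067080639760, 28804121952011041, 28520654114406433,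
    28502800472231969, 27958803668763425, 28803022440461601, 15293271530313505, 15290110439364129,
    27956617534277153, 28520662167470130, 28503069982482738, 15292304631829554, 28486302223988018,
    15292304631830322, 28503069982492210, 28520387004761394, 28502799213940803, 28486431089717827,
    15240691791730499, 15290109684389443, 27956463435875907, 28503954556290371, 28520516677558592,
    27959765747401536, 28484366002844992, 15240623089030976, 28520516677572160, 27959765747402048,
    28502796178317648, 28502800472240720, 28502799213953872, 15292167729747024, 15292167729747792,
    28502796178327120, 28484245678748257, 28502794898408289, 28502782818817121, 28484240656406369,
    28502794915120481, 27907002074170226, 15292150801798258, 28484245678757490, 27907002074170738,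
    14185096204555395, 27907001319191939, 15290109684389507, 28486290144392596, 14185080092526228,
    15307492155496053, 27902741531625077, 27902741531625111, 14098373044897175, 14185990373803414]

theorem shape_eight : Shape 8 pairsEight edgesEight modelsEight 4 6 18 :=
  shape_of_shapeCheck (k := 9) (by decide +kernel)

theorem shape_nine : Shape 9 pairsNine edgesNine modelsNine 3 3 14 :=
  shape_of_shapeCheck (k := 7) (by decide +kernel)

theorem shape_ten : Shape 10 pairsTen edgesTen modelsTen 3 6 23 :=
  shape_of_shapeCheck (k := 11) (by decide +kernel)

end CliqueMinor

namespace CliqueMinor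

noncomputable section

open Classical

variable {V : Type} {G : SimpleGraph V} {X S : Finset V}

/-! ### The exceptional neighbourhoods -/

theorem countLT_eq {f : ℕ → Bool} {n : ℕ} :
    countLT f n = ((Finset.range n).filter (f · = true)).card := by
  induction n with
  | zero => simp [countLT]
  | succ n ih =>
    rw [countLT, ih, Finset.range_add_one, Finset.filter_insert]
    cases hf : f n with
    | false => simp
    | true =>
      rw [if_pos rfl, Finset.card_insert_of_notMem (by simp)]
      simp [add_comm]

theorem fill_le {S' Y : Finset V} (h : ∀ a ∈ S', ∀ b ∈ S', a ≠ b → G.Adj a b) :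
    fill G S' Y ≤ G := fun _ _ hab => hab.2.2.2.elim id fun h' => h _ h'.1 _ h'.2 hab.1

theorem StarModel.extend {m k : ℕ} {R : ℕ → ℕ → Prop} {a : ℕ → ℕ} (h : StarModel m k R a)
    (hR : ∀ i < m, R m i) :
    StarModel (m + 1) (k + 1) R fun i => if i = m then k else if k ≤ a i then k + 1 else a i := by
  have ha : ∀ i < m, ∀ c < k, a i = c →
      (if i = m then k else if k ≤ a i then k + 1 else a i) = c := by
    intro i hi c hc hic
    rw [if_neg hi.ne, if_neg (by omega), hic]
  refine ⟨fun c hc => ?_, fun c hc e he => ?_⟩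
  · by_cases hck : c < k
    · obtain ⟨i, hi, hic, hstar⟩ := h.1 c hck
      refine ⟨i, by omega, ha i hi c hck hic, fun j hj hjc => ?_⟩
      dsimp only at hjc
      split_ifs at hjc with h1 h2
      · omega
      · omega
      · exact hstar j (by omega) hjc
    · obtain rfl : c = k := by omega
      refine ⟨m, by omega, if_pos rfl, fun j hj hjc => Or.inl ?_⟩
      dsimp only at hjc
      split_ifs at hjc with h1 h2
      · exact h1
      · omega
      · omega
  · by_cases hck : c < k
    · obtain ⟨i, hi, j, hj, hic, hjd, hij⟩ := h.2 c hck e he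
      exact ⟨i, by omega, j, by omega, ha i hi c hck hic, ha j hj e (by omega) hjd, hij⟩
    · obtain rfl : c = k := by omega
      obtain ⟨i, hi, hid, -⟩ := h.1 e he
      exact ⟨m, by omega, i, by omega, if_pos rfl, ha i hi e he hid, hR i hi⟩

/-- The indices of vertices attached to `L`. -/
def hit (G : SimpleGraph V) (σ : ℕ → V) (m : ℕ) (L : Finset V) (i : ℕ) : Bool :=
  decide (i < m ∧ Touch G {σ i} L)

theorem hit_iff {σ : ℕ → V} {m : ℕ} {L : Finset V} {i : ℕ} :
    hit G σ m L i = true ↔ i < m ∧ Touch G {σ i} L := by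
  rw [hit, decide_eq_true_iff]

theorem hit_eq_false {σ : ℕ → V} {m : ℕ} {L : Finset V} {i : ℕ} (hi : m ≤ i) :
    hit G σ m L i = false := by
  rw [← Bool.not_eq_true, hit_iff]
  omega

/-- The indices of vertices in `S`. -/
def inside (S : Finset V) (σ : ℕ → V) (m i : ℕ) : Bool := decide (i < m ∧ σ i ∈ S)

theorem inside_iff {σ : ℕ → V} {m : ℕ} {i : ℕ} :
    inside S σ m i = true ↔ i < m ∧ σ i ∈ S := by
  rw [inside, decide_eq_true_iff]

/-- The neighbours of `v` attached to `L`. -/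
def att (G : SimpleGraph V) (X : Finset V) (v : V) (L : Finset V) : Finset V :=
  (X.filter (G.Adj v)).filter fun w => Touch G {w} L

theorem mem_att {v w : V} {L : Finset V} :
    w ∈ att G X v L ↔ (w ∈ X ∧ G.Adj v w) ∧ Touch G {w} L := by
  rw [att, Finset.mem_filter, Finset.mem_filter]

namespace Exceptional

variable {m : ℕ} {F E : List (ℕ × ℕ)} {T : List ℕ} {d c M : ℕ} {v : V} {K : Finset V} {σ : ℕ → V}

theorem mem_and_adj (he : Exceptional G X S m F v K σ) {i : ℕ} (hi : i < m) :
    σ i ∈ X ∧ G.Adj v (σ i) := Finset.mem_filter.1 (he.enum.1 i hi)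

theorem exists_index (he : Exceptional G X S m F v K σ) {w : V} (hw : w ∈ X) (hvw : G.Adj v w) :
    ∃ i < m, σ i = w := by
  have h1 : (X.filter (G.Adj v)).card = m := he.dg_eq
  have h2 := he.enum
  rw [← h1] at h2 ⊢
  exact h2.exists_eq (Finset.mem_filter.2 ⟨hw, hvw⟩)

theorem not_mem_cnb {x : V} (hx : x ∈ X \ cnb G X v) : x ≠ v ∧ ¬ G.Adj v x := by
  rw [Finset.mem_sdiff, mem_cnb] at hx
  exact ⟨fun h => hx.2 (Or.inl h), fun h => hx.2 (Or.inr ⟨hx.1, h⟩)⟩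

theorem hasK8_of_isLinked (he : Exceptional G X S m F v K σ) (hF : Shape m F E T d c M)
    {L D : Finset V} (hL : Conn G L) (hD : Conn G D) (hLX : L ⊆ X \ cnb G X v)
    (hDX : D ⊆ X \ cnb G X v) (hLD : Disjoint L D)
    (hl : isLinked T (hit G σ m L) (hit G σ m D) = true) : HasK8 G := by
  wlog hl' : ∃ t ∈ T, hit G σ m L (hexDigit t 0) = true ∧ hit G σ m L (hexDigit t 1) = true ∧
      hit G σ m D (hexDigit t 2) = true ∧ hit G σ m D (hexDigit t 3) = true generalizing L D
  · refine this hD hL hDX hLX hLD.symm (isLinked_comm.trans hl) ?_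
    simp only [isLinked, List.any_eq_true, Bool.or_eq_true, Bool.and_eq_true] at hl
    obtain ⟨t, ht, h | h⟩ := hl
    · exact absurd ⟨t, ht, h⟩ hl'
    · exact ⟨t, ht, h⟩
  obtain ⟨t, ht, hx1, hy1, hx2, hy2⟩ := hl'
  have hm := hF.model t ht
  simp only [modelCheck, Bool.and_eq_true, Nat.blt_eq] at hm
  obtain ⟨-, -, -, -, hm⟩ := hm
  rw [hit_iff] at hx1 hy1 hx2 hy2
  generalize hexDigit t 0 = x1 at *
  generalize hexDigit t 1 = y1 at *
  generalize hexDigit t 2 = x2 at *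
  generalize hexDigit t 3 = y2 at *
  let f : ℕ → Finset V := fun i => if i = m then {v} else
    ({σ i} ∪ if i = x1 then L else ∅) ∪ if i = x2 then D else ∅
  have hfm : f m = {v} := if_pos rfl
  have hf : ∀ i < m, f i = ({σ i} ∪ if i = x1 then L else ∅) ∪ if i = x2 then D else ∅ :=
    fun i hi => if_neg hi.ne
  have hsub : ∀ i < m, σ i ∈ f i := fun i hi => by simp [hf i hi]
  have hmem : ∀ i < m, ∀ x ∈ f i, x = σ i ∨ i = x1 ∧ x ∈ L ∨ i = x2 ∧ x ∈ D := by
    intro i hi x hx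
    rw [hf i hi] at hx
    simp only [Finset.mem_union, Finset.mem_singleton] at hx
    rcases hx with (hx | hx) | hx
    · exact Or.inl hx
    · split_ifs at hx with h
      · exact Or.inr (Or.inl ⟨h, hx⟩)
      · simp at hx
    · split_ifs at hx with h
      · exact Or.inr (Or.inr ⟨h, hx⟩)
      · simp at hx
  have hLf : L ⊆ f x1 := fun x hx => by simp [hf x1 hx1.1, hx]
  have hDf : D ⊆ f x2 := fun x hx => by simp [hf x2 hx2.1, hx]
  have t1 : Touch G (f x1) (f y1) := hy1.2.symm.mono hLf (by simpa using hsub y1 hy1.1)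
  have t2 : Touch G (f x2) (f y2) := hy2.2.symm.mono hDf (by simpa using hsub y2 hy2.1)
  have hstar := starModel_of_starCheck (R := fun i j => Touch G (f i) (f j))
    (fun i hi j hj hij hadj => by
      rw [Bool.or_eq_true, Bool.not_eq_true', inPairs_iff] at hadj
      rcases hadj with h | h
      · exact ⟨_, hsub i hi, _, hsub j hj, (he.adj_iff i hi j hj hij).2 h⟩
      · simp only [List.mem_cons, Prod.mk.injEq, List.not_mem_nil, or_false] at h
        rcases h with (⟨rfl, rfl⟩ | ⟨rfl, rfl⟩) | (⟨rfl, rfl⟩ | ⟨rfl, rfl⟩)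
        exacts [t1, t2, t1.symm, t2.symm]) hm
  refine (hstar.extend fun i hi => ⟨v, by simp [hfm], _, hsub i hi, (he.mem_and_adj hi).2⟩).hasK8
    (fun i hi => ?_) fun i hi j hj hij => ?_
  · by_cases him : i = m
    · rw [him, hfm]
      exact conn_singleton v
    · rw [hf i (by omega)]
      have h1 : Conn G ({σ i} ∪ if i = x1 then L else ∅) := by
        split_ifs with h
        · exact (conn_singleton _).union hL (h ▸ hx1.2)
        · rw [Finset.union_empty]
          exact conn_singleton _
      by_cases h : i = x2
      · rw [if_pos h]
        exact h1.union hD ((h ▸ hx2.2).mono Finset.subset_union_left subset_rfl)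
      · rw [if_neg h, Finset.union_empty]
        exact h1
  · have hout : ∀ i < m, ∀ x ∈ f i, x = σ i ∨ x ∈ X \ cnb G X v := by
      intro i hi x hx
      rcases hmem i hi x hx with h | h | h
      exacts [Or.inl h, Or.inr (hLX h.2), Or.inr (hDX h.2)]
    have key : ∀ i < m, v ∉ f i := by
      intro i hi hvi
      rcases hout i hi v hvi with h | h
      · exact (he.mem_and_adj hi).2.ne h
      · exact (not_mem_cnb h).1 rfl
    rw [Finset.disjoint_left]
    intro x hxi hxj
    by_cases him : i = m
    · rw [him, hfm, Finset.mem_singleton] at hxi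
      exact key j (by omega) (hxi ▸ hxj)
    · by_cases hjm : j = m
      · rw [hjm, hfm, Finset.mem_singleton] at hxj
        exact key i (by omega) (hxj ▸ hxi)
      · have hi' : i < m := by omega
        have hj' : j < m := by omega
        rcases hmem i hi' x hxi with h | h
        · rcases hout j hj' x hxj with h' | h'
          · exact hij (he.enum.2 i hi' j hj' (h.symm.trans h'))
          · exact (not_mem_cnb h').2 (h ▸ (he.mem_and_adj hi').2)
        · rcases hmem j hj' x hxj with h' | h'
          · rcases hout i hi' x hxi with h'' | h''
            · exact hij (he.enum.2 i hi' j hj' (h''.symm.trans h'))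
            · exact (not_mem_cnb h'').2 (h' ▸ (he.mem_and_adj hj').2)
          · rcases h with h | h <;> rcases h' with h' | h'
            · exact hij (h.1.trans h'.1.symm)
            · exact Finset.disjoint_left.1 hLD h.2 h'.2
            · exact Finset.disjoint_left.1 hLD h'.2 h.2
            · exact hij (h.1.trans h'.1.symm)

theorem adj_of_isFree (he : Exceptional G X S m F v K σ) {p : ℕ → Bool} (hp : isFree F p = true)
    {i j : ℕ} (hi : i < m) (hj : j < m) (hij : i ≠ j) (hpi : p i = true) (hpj : p j = true) :
    G.Adj (σ i) (σ j) := by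
  rw [he.adj_iff i hi j hj hij, ← Bool.not_eq_true, inPairs_iff]
  simp only [isFree, List.all_eq_true, Bool.not_eq_true', Bool.and_eq_false_iff] at hp
  rintro (h | h)
  · simpa [hpi, hpj] using hp _ h
  · simpa [hpi, hpj] using hp _ h

theorem isFree_inside (h : Setup G X S) (he : Exceptional G X S m F v K σ) :
    isFree F (inside S σ m) = true := by
  simp only [isFree, List.all_eq_true, Bool.not_eq_true', ← Bool.not_eq_true, Bool.and_eq_true,
    inside_iff]
  rintro ⟨i, j⟩ hij ⟨⟨hi, hiS⟩, hj, hjS⟩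
  have hp : inPairs F i j = true := inPairs_iff.2 (Or.inl hij)
  by_cases hne : i = j
  · subst hne
    simp [he.loopless i hi] at hp
  · have := h.clique _ hiS _ hjS fun h => hne (he.enum.2 i hi j hj h)
    rw [he.adj_iff i hi j hj hne, hp] at this
    cases this

theorem att_clique (he : Exceptional G X S m F v K σ) {L : Finset V}
    (hL : isFree F (hit G σ m L) = true) :
    ∀ a ∈ att G X v L, ∀ b ∈ att G X v L, a ≠ b → G.Adj a b := by
  intro a ha b hb hab
  rw [mem_att] at ha hb
  obtain ⟨i, hi, rfl⟩ := he.exists_index ha.1.1 ha.1.2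
  obtain ⟨j, hj, rfl⟩ := he.exists_index hb.1.1 hb.1.2
  exact he.adj_of_isFree hL hi hj (fun h => hab (h ▸ rfl)) (hit_iff.2 ⟨hi, ha.2⟩)
    (hit_iff.2 ⟨hj, hb.2⟩)

theorem card_att_le (he : Exceptional G X S m F v K σ) (hF : Shape m F E T d c M) {L : Finset V}
    (hL : isFree F (hit G σ m L) = true) : (att G X v L).card ≤ 4 := by
  have h1 := hF.card_le _ (fun i hi => hit_eq_false hi) hL
  rw [countLT_eq] at h1
  refine le_trans (le_trans (Finset.card_le_card fun w hw => ?_) (Finset.card_image_le (f := σ))) h1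
  rw [mem_att] at hw
  obtain ⟨i, hi, rfl⟩ := he.exists_index hw.1.1 hw.1.2
  exact Finset.mem_image.2 ⟨i, Finset.mem_filter.2 ⟨Finset.mem_range.2 hi, hit_iff.2 ⟨hi, hw.2⟩⟩, rfl⟩

/-- The complement of the closed neighbourhood of `v` is connected. -/
theorem sdiff_cnb_eq (h : Setup G X S) (he : Exceptional G X S m F v K σ)
    (hF : Shape m F E T d c M) : X \ cnb G X v = K := by
  refine Finset.Subset.antisymm (fun x hx => ?_) he.comp.1
  by_contra hxK
  obtain ⟨K', hK', hxK'⟩ := exists_isComp (G := G) hx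
  have hdisj : Disjoint K K' := Finset.disjoint_left.2 fun y hy hy' =>
    hxK (he.comp.subset_of_conn hK'.2.1 hK'.1 hy' hy hxK')
  by_cases hfree : isFree F (hit G σ m K') = true
  · have hcl := he.att_clique hfree
    have hv : v ∈ X \ (K' ∪ att G X v K') := by
      rw [Finset.mem_sdiff, Finset.mem_union, mem_att]
      refine ⟨he.mem, ?_⟩
      rintro (h' | h')
      · exact (not_mem_cnb (hK'.1 h')).1 rfl
      · exact h'.1.2.ne rfl
    have := h.noSep K' (att G X v K') hK'.2.1.1
      (Finset.disjoint_left.2 fun y hy hy' => (not_mem_cnb (hK'.1 hy)).2 (mem_att.1 hy').1.2)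
      (Finset.union_subset (hK'.1.trans Finset.sdiff_subset)
        ((Finset.filter_subset _ _).trans (Finset.filter_subset _ _)))
      ((he.card_att_le hF hfree).trans (by norm_num)) ⟨v, hv⟩ fun a ha b hab => by
        have hbX := h.supp' hab
        rw [Finset.mem_union]
        by_cases hb : b ∈ X \ cnb G X v
        · exact Or.inl (hK'.2.2 a ha b hb hab)
        · rw [Finset.mem_sdiff, mem_cnb, not_and_not_right] at hb
          rcases hb hbX with rfl | hb
          · exact absurd hab.symm (not_mem_cnb (hK'.1 ha)).2
          · exact Or.inr (mem_att.2 ⟨hb, b, by simp, a, ha, hab.symm⟩)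
    exact h.no_K8 (this.elim (fun h => h.mono (fill_le hcl)) fun h => h.mono (fill_le hcl))
  · rw [Bool.not_eq_true, isFree, List.all_eq_false] at hfree
    obtain ⟨e, heF, hee⟩ := hfree
    rw [Bool.not_eq_true', Bool.not_eq_false, Bool.and_eq_true] at hee
    refine h.no_K8 (he.hasK8_of_isLinked hF he.comp.2.1 hK'.2.1 he.comp.1 hK'.1 hdisj ?_)
    rw [isLinked_comm]
    refine isLinked_mono (isLinked_comm.trans (isLinked_mono (hF.linked e heF) fun i hi => ?_))
      fun i hi => hit_iff.2 ⟨by simpa using hi, he.touch i (by simpa using hi)⟩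
    simp only [Bool.or_eq_true, Nat.beq_eq] at hi
    rcases hi with rfl | rfl
    exacts [hee.1, hee.2]

/-- Edges in the neighbourhood of `v` and outside `S` have common neighbours in `K`. -/
theorem le_card_carriers (h : Setup G X S) (he : Exceptional G X S m F v K σ)
    (hF : Shape m F E T d c M) {e : ℕ × ℕ} (heE : e ∈ E)
    (heS : ¬ (σ e.1 ∈ S ∧ σ e.2 ∈ S)) :
    5 ≤ d + (K.filter fun w => G.Adj (σ e.1) w ∧ G.Adj (σ e.2) w).card := by
  obtain ⟨h1, h2, h3, h4, h5⟩ := hF.edge e heE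
  have h6 := h.tri _ _ ((he.adj_iff _ h1 _ h2 h3).2 h4) heS
  rw [commonLT, countLT_eq] at h5
  set R := (Finset.range m).filter fun k => (!Nat.beq k e.1 && (!Nat.beq k e.2 &&
    (!inPairs F e.1 k && !inPairs F e.2 k))) = true with hR
  have h7 : common G X (σ e.1) (σ e.2) ⊆
      ({v} ∪ R.image σ) ∪ K.filter fun w => G.Adj (σ e.1) w ∧ G.Adj (σ e.2) w := by
    intro w hw
    rw [common, Finset.mem_filter] at hw
    rw [Finset.mem_union, Finset.mem_union, Finset.mem_singleton]
    by_cases hwK : w ∈ X \ cnb G X v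
    · exact Or.inr (Finset.mem_filter.2 ⟨he.sdiff_cnb_eq h hF ▸ hwK, hw.2⟩)
    · rw [Finset.mem_sdiff, mem_cnb, not_and_not_right] at hwK
      rcases hwK hw.1 with rfl | hvw
      · exact Or.inl (Or.inl rfl)
      · obtain ⟨k, hk, rfl⟩ := he.exists_index hvw.1 hvw.2
        have hne : k ≠ e.1 ∧ k ≠ e.2 := by
          constructor
          · rintro rfl
            exact hw.2.1.ne rfl
          · rintro rfl
            exact hw.2.2.ne rfl
        refine Or.inl (Or.inr (Finset.mem_image_of_mem σ (Finset.mem_filter.2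
          ⟨Finset.mem_range.2 hk, ?_⟩)))
        simp only [Bool.and_eq_true, Bool.not_eq_true', beq_eq_false]
        exact ⟨hne.1, hne.2, (he.adj_iff _ h1 _ hk hne.1.symm).1 hw.2.1,
          (he.adj_iff _ h2 _ hk hne.2.symm).1 hw.2.2⟩
  have h8 := Finset.card_le_card h7
  have h9 := Finset.card_union_le ({v} ∪ R.image σ)
    (K.filter fun w => G.Adj (σ e.1) w ∧ G.Adj (σ e.2) w)
  have h10 := Finset.card_union_le {v} (R.image σ)
  have h11 : (R.image σ).card ≤ R.card := Finset.card_image_le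
  rw [Finset.card_singleton] at h10
  omega

end Exceptional

end

end CliqueMinor

namespace CliqueMinor

noncomputable section

open Classical

variable {V : Type} {G : SimpleGraph V} {X S : Finset V}

namespace Exceptional

variable {m : ℕ} {F E : List (ℕ × ℕ)} {T : List ℕ} {d c M : ℕ} {v : V} {K : Finset V} {σ : ℕ → V}

theorem length_le_countP {α : Type} {E : List α} {p q r s : α → Bool}
    (h : ∀ e ∈ E, p e = true ∨ q e = true ∨ r e = true ∨ s e = true) :
    E.length ≤ E.countP p + E.countP q + E.countP r + E.countP s := by
  induction E with
  | nil => simp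
  | cons e E ih =>
    have ih' := ih fun e he => h e (List.mem_cons_of_mem _ he)
    simp only [List.countP_cons, List.length_cons]
    rcases h e List.mem_cons_self with h | h | h | h <;> rw [if_pos h] <;> omega

/-- If `L₁`, `L₂` and `L₃` cover `K`, then every edge in the neighbourhood of `v` is attached to
one of them or contained in `S`. -/
theorem length_le (h : Setup G X S) (he : Exceptional G X S m F v K σ) (hF : Shape m F E T d c M)
    (hd : d ≤ 4) {L₁ L₂ L₃ : Finset V} (hL : K ⊆ L₁ ∪ L₂ ∪ L₃) :
    E.length ≤ pairsIn E (hit G σ m L₁) + pairsIn E (hit G σ m L₂) + pairsIn E (hit G σ m L₃) +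
      pairsIn E (inside S σ m) := by
  refine length_le_countP fun e heE => ?_
  obtain ⟨h1, h2, -⟩ := hF.edge e heE
  simp only [Bool.and_eq_true, hit_iff, inside_iff]
  by_cases heS : σ e.1 ∈ S ∧ σ e.2 ∈ S
  · exact Or.inr (Or.inr (Or.inr ⟨⟨h1, heS.1⟩, h2, heS.2⟩))
  · have h3 := he.le_card_carriers h hF heE heS
    obtain ⟨w, hw⟩ := Finset.card_pos.1 (show 0 <
      (K.filter fun w => G.Adj (σ e.1) w ∧ G.Adj (σ e.2) w).card by omega)
    obtain ⟨hwK, hw1, hw2⟩ := Finset.mem_filter.1 hw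
    have key : ∀ L : Finset V, w ∈ L → (e.1 < m ∧ Touch G {σ e.1} L) ∧ e.2 < m ∧ Touch G {σ e.2} L :=
      fun L hwL => ⟨⟨h1, _, by simp, w, hwL, hw1⟩, h2, _, by simp, w, hwL, hw2⟩
    have := hL hwK
    rw [Finset.mem_union, Finset.mem_union] at this
    rcases this with (h' | h') | h'
    exacts [Or.inl (key _ h'), Or.inr (Or.inl (key _ h')), Or.inr (Or.inr (Or.inl (key _ h')))]

theorem isFree_hit_empty : isFree F (hit G σ m ∅) = true := by
  simp [isFree, hit, Touch]

theorem pairsIn_hit_empty : pairsIn E (hit G σ m ∅) = 0 := by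
  simp [pairsIn, hit, Touch]

/-- The graph on the neighbours of `v` is not covered by the parts attached to three sets, none of
which is attached to a non-edge. -/
theorem not_cover (h : Setup G X S) (he : Exceptional G X S m F v K σ) (hF : Shape m F E T d c M)
    (hd : d ≤ 4) {s : ℕ} (hs : pairsIn E (inside S σ m) ≤ s) (hE : 3 * c + s < E.length)
    {L₁ L₂ L₃ : Finset V} (hL : K ⊆ L₁ ∪ L₂ ∪ L₃) (h1 : isFree F (hit G σ m L₁) = true)
    (h2 : isFree F (hit G σ m L₂) = true) (h3 : isFree F (hit G σ m L₃) = true) : False := by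
  have h4 := he.length_le h hF hd hL
  have h5 := hF.pairsIn_le (hit G σ m L₁) (fun i hi => hit_eq_false hi) h1
  have h6 := hF.pairsIn_le (hit G σ m L₂) (fun i hi => hit_eq_false hi) h2
  have h7 := hF.pairsIn_le (hit G σ m L₃) (fun i hi => hit_eq_false hi) h3
  omega

/-- If `K` is split into two connected parts, one of them is not attached to a non-edge. -/
theorem isFree_or_isFree (h : Setup G X S) (he : Exceptional G X S m F v K σ)
    (hF : Shape m F E T d c M) (hd : d ≤ 4) {s : ℕ} (hs : pairsIn E (inside S σ m) ≤ s)
    (hE : M + s < E.length) {L D : Finset V} (hLD : L ∪ D = K) (hdisj : Disjoint L D)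
    (hL : Conn G L) (hD : Conn G D) :
    isFree F (hit G σ m L) = true ∨ isFree F (hit G σ m D) = true := by
  by_contra! hcon
  have hLf : isFree F (hit G σ m L) = false := by simpa using hcon.1
  have hDf : isFree F (hit G σ m D) = false := by simpa using hcon.2
  have hX := he.comp.1
  rw [← hLD, Finset.union_subset_iff] at hX
  have h1 := he.length_le h hF hd (L₁ := L) (L₂ := D) (L₃ := ∅) (by simp [hLD])
  rw [pairsIn_hit_empty] at h1
  have h2 := hF.add_le (hit G σ m L) (hit G σ m D) (fun i hi => hit_eq_false hi)
    (fun i hi => hit_eq_false hi) hLf hDf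
    (by
      rw [← Bool.not_eq_true]
      exact fun hl => h.no_K8 (he.hasK8_of_isLinked hF hL hD hX.1 hX.2 hdisj hl))
    fun i hi => by
      obtain ⟨a, ha, b, hb, hab⟩ := he.touch i hi
      rw [← hLD, Finset.mem_union] at hb
      rcases hb with hb | hb
      · exact Or.inl (hit_iff.2 ⟨hi, a, ha, b, hb, hab⟩)
      · exact Or.inr (hit_iff.2 ⟨hi, a, ha, b, hb, hab⟩)
  omega

/-- No connected part of `K` that is not attached to a non-edge is separated from the rest of `K`
by a single vertex. -/
theorem not_attached_at (h : Setup G X S) (he : Exceptional G X S m F v K σ)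
    (hF : Shape m F E T d c M) (hm : 4 < m) {D : Finset V} {z : V} (hDK : D ⊆ K) (hD : Conn G D)
    (hfree : isFree F (hit G σ m D) = true) (hz : z ∈ K) (hzD : z ∉ D) (hKD : Conn G (K \ D))
    (honly : ∀ a ∈ D, ∀ b ∈ K, b ∉ D → G.Adj a b → b = z) : False := by
  have hcl := he.att_clique hfree
  have hKX : K ⊆ X := he.comp.1.trans Finset.sdiff_subset
  have hKv : ∀ w ∈ K, w ≠ v ∧ ¬ G.Adj v w := fun w hw => not_mem_cnb (he.comp.1 hw)
  have hDz : Touch G D {z} := by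
    obtain ⟨a, ha, b, hb, hab⟩ := he.comp.2.1.2 D hDK hD.1 (by
      rintro rfl
      exact hzD hz)
    rw [Finset.mem_sdiff] at hb
    have := honly a ha b hb.1 hb.2 hab
    exact ⟨a, ha, b, by simpa using this, hab⟩
  obtain ⟨i, hi, hiD⟩ : ∃ i < m, ¬ Touch G {σ i} D := by
    by_contra! hcon
    have h1 := hF.card_le (hit G σ m D) (fun i hi => hit_eq_false hi) hfree
    rw [countLT_eq, Finset.filter_true_of_mem, Finset.card_range] at h1
    · omega
    · intro i hi
      rw [Finset.mem_range] at hi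
      exact hit_iff.2 ⟨hi, hcon i hi⟩
  set y := σ i with hy
  obtain ⟨hyX, hvy⟩ := he.mem_and_adj hi
  have hyK : Touch G {y} (K \ D) := by
    obtain ⟨a, ha, b, hb, hab⟩ := he.touch i hi
    exact ⟨a, ha, b, Finset.mem_sdiff.2 ⟨hb, fun hbD => hiD ⟨a, ha, b, hbD, hab⟩⟩, hab⟩
  set A := att G X v D with hA
  have hAm : ∀ w ∈ A, G.Adj v w ∧ Touch G {w} D := fun w hw =>
    ⟨(mem_att.1 hw).1.2, (mem_att.1 hw).2⟩
  have hzA : z ∉ A := fun hzA => (hKv z hz).2 (hAm z hzA).1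
  have hDA : ∀ w ∈ D, w ∉ A := fun w hw hwA => (hKv w (hDK hw)).2 (hAm w hwA).1
  have hvS' : v ∈ X \ (D ∪ insert z A) := by
    rw [Finset.mem_sdiff, Finset.mem_union, Finset.mem_insert]
    refine ⟨he.mem, ?_⟩
    rintro (h' | rfl | h')
    · exact (hKv v (hDK h')).1 rfl
    · exact (hKv _ hz).1 rfl
    · exact (hAm v h').1.ne rfl
  have hsep := h.noSep D (insert z A) hD.1
    (Finset.disjoint_left.2 fun w hw hw' => by
      rcases Finset.mem_insert.1 hw' with rfl | hw'
      · exact hzD hw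
      · exact hDA w hw hw')
    (Finset.union_subset (hDK.trans hKX) (Finset.insert_subset (hKX hz)
      ((Finset.filter_subset _ _).trans (Finset.filter_subset _ _))))
    ((Finset.card_insert_le _ _).trans (Nat.succ_le_succ (he.card_att_le hF hfree))) ⟨v, hvS'⟩
    fun a ha b hab => by
      rw [Finset.mem_union, Finset.mem_insert]
      by_cases hbD : b ∈ D
      · exact Or.inl hbD
      by_cases hbK : b ∈ K
      · exact Or.inr (Or.inl (honly a ha b hbK hbD hab))
      rw [← he.sdiff_cnb_eq h hF, Finset.mem_sdiff, mem_cnb, not_and_not_right] at hbK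
      rcases hbK (h.supp' hab) with rfl | hb
      · exact absurd hab.symm (hKv a (hDK ha)).2
      · exact Or.inr (Or.inr (mem_att.2 ⟨hb, b, by simp, a, ha, hab.symm⟩))
  refine h.no_K8 (hsep.elim (fun h8 => ?_) fun h8 => ?_)
  · set B := (K \ D) ∪ {y, v} with hB
    have hBm : ∀ w ∈ B, w ∈ K \ D ∨ w = y ∨ w = v := fun w hw => by
      simp only [hB, Finset.mem_union, Finset.mem_insert, Finset.mem_singleton] at hw
      exact hw
    have hzB : z ∈ B := by simp [hB, hz, hzD]
    have hvB : v ∈ B := by simp [hB]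
    have hnot : ∀ w ∈ D ∪ insert z A, w ≠ z → w ∉ B := by
      intro w hw hwz hwB
      rw [Finset.mem_union, Finset.mem_insert] at hw
      have hw' : w ∈ D ∨ w ∈ A := hw.imp id fun h => h.resolve_left hwz
      rcases hBm w hwB with h' | rfl | rfl
      · rw [Finset.mem_sdiff] at h'
        exact hw'.elim h'.2 fun hwA => (hKv w h'.1).2 (hAm w hwA).1
      · exact hw'.elim (fun hwD => (hKv _ (hDK hwD)).2 hvy) fun hwA => hiD (hAm _ hwA).2
      · exact hw'.elim (fun hwD => (hKv _ (hDK hwD)).1 rfl) fun hwA => (hAm _ hwA).1.ne rfl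
    have hside : ∀ b, (fill G (insert z A) (D ∪ insert z A)).Adj z b → Touch G B {b} := by
      rintro b ⟨hne, -, -, h' | h'⟩
      · exact ⟨z, hzB, b, by simp, h'⟩
      · have := (Finset.mem_insert.1 h'.2).resolve_left hne.symm
        exact ⟨v, hvB, b, by simp, (hAm b this).1⟩
    refine h8.bind (· ∈ D ∪ insert z A) (fun w => if w = z then B else {w}) (fun w _ => ?_)
      (fun a b ha hb hab => ?_) fun a b hab => ⟨hab.2.1, ?_⟩
    · split_ifs
      · refine hKD.union (conn_pair hvy.symm) (hyK.symm.mono subset_rfl (by simp))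
      · exact conn_singleton w
    · split_ifs with h1 h2 h2
      · exact absurd (h1.trans h2.symm) hab
      · rw [Finset.disjoint_singleton_right]
        exact hnot b hb h2
      · rw [Finset.disjoint_singleton_left]
        exact hnot a ha h1
      · simpa using hab
    · split_ifs with h1 h2 h2
      · exact absurd (h1.trans h2.symm) hab.1
      · exact hside b (h1 ▸ hab)
      · exact (hside a (h2 ▸ hab.symm)).symm
      · obtain ⟨hne, -, -, h' | h'⟩ := hab
        · exact ⟨a, by simp, b, by simp, h'⟩
        · refine ⟨a, by simp, b, by simp, hcl a ?_ b ?_ hne⟩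
          · exact (Finset.mem_insert.1 h'.1).resolve_left h1
          · exact (Finset.mem_insert.1 h'.2).resolve_left h2
  · have hside : ∀ b, (fill G (insert z A) (X \ D)).Adj z b → Touch G ({z} ∪ D) {b} := by
      rintro b ⟨hne, -, -, h' | h'⟩
      · exact ⟨z, by simp, b, by simp, h'⟩
      · have := (Finset.mem_insert.1 h'.2).resolve_left hne.symm
        exact (hAm b this).2.symm.mono Finset.subset_union_right subset_rfl
    refine h8.bind (· ∈ X \ D) (fun w => if w = z then {z} ∪ D else {w}) (fun w _ => ?_)
      (fun a b ha hb hab => ?_) fun a b hab => ⟨hab.2.1, ?_⟩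
    · split_ifs
      · exact (conn_singleton z).union hD hDz.symm
      · exact conn_singleton w
    · rw [Finset.mem_sdiff] at ha hb
      split_ifs with h1 h2 h2
      · exact absurd (h1.trans h2.symm) hab
      · simp [h2, hb.2]
      · simp [h1, ha.2]
      · simpa using hab
    · split_ifs with h1 h2 h2
      · exact absurd (h1.trans h2.symm) hab.1
      · exact hside b (h1 ▸ hab)
      · exact (hside a (h2 ▸ hab.symm)).symm
      · obtain ⟨hne, -, -, h' | h'⟩ := hab
        · exact ⟨a, by simp, b, by simp, h'⟩
        · refine ⟨a, by simp, b, by simp, hcl a ?_ b ?_ hne⟩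
          · exact (Finset.mem_insert.1 h'.1).resolve_left h1
          · exact (Finset.mem_insert.1 h'.2).resolve_left h2

/-- The set `K` is a single vertex. -/
theorem exists_eq_singleton (h : Setup G X S) (he : Exceptional G X S m F v K σ)
    (hF : Shape m F E T d c M) (hm : 4 < m) (hd : d ≤ 4) {s : ℕ}
    (hs : pairsIn E (inside S σ m) ≤ s) (hE : M + s < E.length) (hE3 : 3 * c + s < E.length) :
    ∃ z, K = {z} := by
  have hKfree : isFree F (hit G σ m K) ≠ true := fun hK =>
    he.not_cover h hF hd hs hE3 (L₁ := K) (L₂ := ∅) (L₃ := ∅) (by simp) hK isFree_hit_empty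
      isFree_hit_empty
  obtain ⟨D, hD, hmin⟩ := Finset.exists_min_image
    (K.powerset.filter fun D => Conn G D ∧ isFree F (hit G σ m D) ≠ true ∧
      (K \ D = ∅ ∨ Conn G (K \ D))) Finset.card
    ⟨K, Finset.mem_filter.2 ⟨by simp, he.comp.2.1, hKfree, by simp⟩⟩
  rw [Finset.mem_filter, Finset.mem_powerset] at hD
  obtain ⟨hDK, hDc, hDfree, hR⟩ := hD
  have hmin' : ∀ D' ⊆ K, D'.card < D.card → Conn G D' → Conn G (K \ D') →
      isFree F (hit G σ m D') = true := by
    intro D' hD' hlt hc hc'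
    by_contra hcon
    have := hmin D' (Finset.mem_filter.2 ⟨Finset.mem_powerset.2 hD', hc, hcon, Or.inr hc'⟩)
    omega
  have hDR : D ∪ K \ D = K := Finset.union_sdiff_of_subset hDK
  have hRfree : isFree F (hit G σ m (K \ D)) = true := by
    rcases hR with hR | hR
    · rw [hR]
      exact isFree_hit_empty
    · exact (he.isFree_or_isFree h hF hd hs hE hDR Finset.disjoint_sdiff hDc hR).resolve_left hDfree
  obtain ⟨z, hz, hzR⟩ : ∃ z ∈ D, K \ D = ∅ ∨ Conn G (K \ D) ∧ Touch G {z} (K \ D) := by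
    rcases hR with hR | hR
    · obtain ⟨z, hz⟩ := hDc.1
      exact ⟨z, hz, Or.inl hR⟩
    · obtain ⟨a, ha, b, hb, hab⟩ := he.comp.2.1.2 D hDK hDc.1 (by
        rintro rfl
        simpa using hR.1)
      exact ⟨a, ha, Or.inr ⟨hR, a, by simp, b, hb, hab⟩⟩
  by_cases hDz : D = {z}
  · rcases hzR with hzR | hzR
    · refine ⟨z, ?_⟩
      rw [← hDR, hzR, Finset.union_empty, hDz]
    · exfalso
      refine he.not_attached_at h hF hm Finset.sdiff_subset hzR.1 hRfree (hDK hz) (by simp [hz])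
        (by rwa [Finset.sdiff_sdiff_eq_self hDK]) fun a ha b hb hbR _ => ?_
      have : b ∈ D := by
        by_contra hbD
        exact hbR (Finset.mem_sdiff.2 ⟨hb, hbD⟩)
      simpa [hDz] using this
  · exfalso
    obtain ⟨x, hx⟩ : (D.erase z).Nonempty := by
      rw [Finset.nonempty_iff_ne_empty]
      intro h'
      rcases (Finset.erase_eq_empty_iff D z).1 h' with h' | h'
      · exact hDc.1.ne_empty h'
      · exact hDz h'
    obtain ⟨C, hC, hxC⟩ := exists_isComp (G := G) hx
    have hCD : C ⊆ D := hC.1.trans (Finset.erase_subset _ _)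
    have hzC : z ∉ C := fun hzC => by simpa using hC.1 hzC
    have hDC := hC.conn_sdiff hDc hz
    have hsplit : K \ C = D \ C ∪ K \ D := by
      ext w
      simp only [Finset.mem_sdiff, Finset.mem_union]
      constructor
      · tauto
      · rintro (hw | hw)
        · exact ⟨hDK hw.1, hw.2⟩
        · exact ⟨hw.1, fun hwC => hw.2 (hCD hwC)⟩
    have hKC : Conn G (K \ C) := by
      rw [hsplit]
      rcases hzR with hzR | hzR
      · rw [hzR, Finset.union_empty]
        exact hDC
      · exact hDC.union hzR.1 (hzR.2.mono (by simp [hz, hzC]) subset_rfl)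
    have hCfree := hmin' C (hCD.trans hDK)
      (Finset.card_lt_card ⟨hCD, fun h' => hzC (h' hz)⟩) hC.2.1 hKC
    by_cases hCR : Touch G C (K \ D)
    · have hRc : Conn G (K \ D) := hzR.elim (fun h' => by
        rw [h'] at hCR
        obtain ⟨_, _, _, hb, _⟩ := hCR
        simp at hb) fun h' => h'.1
      have hsplit' : K \ (D \ C) = C ∪ K \ D := by
        ext w
        simp only [Finset.mem_sdiff, Finset.mem_union]
        constructor
        · tauto
        · rintro (hw | hw)
          · exact ⟨hDK (hCD hw), fun h' => h'.2 hw⟩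
          · exact ⟨hw.1, fun h' => hw.2 h'.1⟩
      refine he.not_cover h hF hd hs hE3 (L₁ := C) (L₂ := D \ C) (L₃ := K \ D) (fun w hw => ?_)
        hCfree (hmin' (D \ C) (Finset.sdiff_subset.trans hDK)
          (Finset.card_lt_card ⟨Finset.sdiff_subset, fun h' =>
            (Finset.mem_sdiff.1 (h' (hCD hxC))).2 hxC⟩) hDC
          (by rw [hsplit']; exact hC.2.1.union hRc hCR)) hRfree
      simp only [Finset.mem_union, Finset.mem_sdiff]
      tauto
    · refine he.not_attached_at h hF hm (hCD.trans hDK) hC.2.1 hCfree (hDK hz) hzC hKC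
        fun a ha b hb hbC hab => ?_
      by_contra hbz
      by_cases hbD : b ∈ D
      · exact hbC (hC.2.2 a ha b (Finset.mem_erase.2 ⟨hbz, hbD⟩) hab)
      · exact hCR ⟨a, ha, b, Finset.mem_sdiff.2 ⟨hb, hbD⟩, hab⟩

theorem four_le (h : Setup G X S) (he : Exceptional G X S m F v K σ)
    (hF : Shape m F E T d c M) {z : V} (hK : K = {z}) {s : ℕ}
    (hs : pairsIn E (inside S σ m) ≤ s) (hE : M + s < E.length) : 4 ≤ d := by
  obtain ⟨e, heE, heS⟩ : ∃ e ∈ E, ¬ (σ e.1 ∈ S ∧ σ e.2 ∈ S) := by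
    by_contra! hcon
    have : pairsIn E (inside S σ m) = E.length := List.countP_eq_length.2 fun e heE => by
      obtain ⟨h1, h2, -⟩ := hF.edge e heE
      rw [Bool.and_eq_true, inside_iff, inside_iff]
      exact ⟨⟨h1, (hcon e heE).1⟩, h2, (hcon e heE).2⟩
    omega
  have h1 := he.le_card_carriers h hF heE heS
  have h2 := Finset.card_filter_le K fun w => G.Adj (σ e.1) w ∧ G.Adj (σ e.2) w
  rw [hK, Finset.card_singleton] at h2
  rw [hK] at h1
  omega

end Exceptional

/-- A graph as in `Setup` has a vertex of degree 8, and it has ten vertices of degree at most 8. -/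
theorem Setup.final (h : Setup G X S) : (∃ v ∈ X, v ∉ S ∧ dg G X v = 8) ∧
    X.card = 10 ∧ ee G X X ≤ 80 := by
  obtain ⟨v, K, σ, he | he | he⟩ := h.exists_exceptional
  · have hS : S = ∅ := h.big.resolve_right fun hbig => by
      have := hbig v he.mem he.not_mem
      rw [he.dg_eq] at this
      omega
    have hs : pairsIn edgesEight (inside S σ 8) ≤ 0 := by
      simp [pairsIn, inside, hS]
    obtain ⟨z, hz⟩ := he.exists_eq_singleton h shape_eight (by norm_num) (by norm_num) hs
      (by decide) (by decide)
    have hXc : X.card = 10 := by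
      have h1 : (X \ cnb G X v).card = 1 := by
        rw [he.sdiff_cnb_eq h shape_eight, hz, Finset.card_singleton]
      have h2 : (cnb G X v).card = dg G X v + 1 := Finset.card_insert_of_notMem (by simp)
      have h3 : cnb G X v ⊆ X := Finset.insert_subset he.mem (Finset.filter_subset _ _)
      have h4 := Finset.card_sdiff_add_card_eq_card h3
      rw [he.dg_eq] at h2
      omega
    have hzX := he.sdiff_cnb_eq h shape_eight
    have hmiss : ∀ a ∈ X, ∃ b ∈ X, b ≠ a ∧ ¬ G.Adj a b := by
      intro a ha
      have hzz : z ∈ X \ cnb G X v := by rw [hzX, hz, Finset.mem_singleton]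
      have hzv := Exceptional.not_mem_cnb hzz
      rcases eq_or_ne a v with rfl | hav
      · exact ⟨z, (Finset.mem_sdiff.1 hzz).1, hzv⟩
      by_cases hva : G.Adj v a
      · obtain ⟨i, hi, rfl⟩ := he.exists_index ha hva
        have hp : ∀ i < 8, ∃ j < 8, i ≠ j ∧ inPairs pairsEight i j = true := by decide
        obtain ⟨j, hj, hij, hp⟩ := hp i hi
        refine ⟨σ j, (he.mem_and_adj hj).1, fun h' => hij (he.enum.2 j hj i hi h').symm, ?_⟩
        rw [he.adj_iff i hi j hj hij, hp]
        exact Bool.noConfusion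
      · exact ⟨v, he.mem, hav.symm, fun h' => hva h'.symm⟩
    refine ⟨⟨v, he.mem, he.not_mem, he.dg_eq⟩, hXc, ?_⟩
    have : ee G X X ≤ X.card * 8 := by
      rw [ee, ← smul_eq_mul]
      refine Finset.sum_le_card_nsmul _ _ _ fun a ha => ?_
      obtain ⟨b, hb, hba, hab⟩ := hmiss a ha
      have h1 : X.filter (G.Adj a) ⊆ (X.erase a).erase b := fun w hw => by
        rw [Finset.mem_filter] at hw
        refine Finset.mem_erase.2 ⟨?_, Finset.mem_erase.2 ⟨hw.2.ne', hw.1⟩⟩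
        rintro rfl
        exact hab hw.2
      have h2 := Finset.card_le_card h1
      rw [Finset.card_erase_of_mem (Finset.mem_erase.2 ⟨hba, hb⟩), Finset.card_erase_of_mem ha,
        hXc] at h2
      exact h2
    omega
  · exfalso
    have hs := shape_nine.pairsIn_le (inside S σ 9) (fun i hi => by
      rw [← Bool.not_eq_true, inside_iff]
      omega) (he.isFree_inside h)
    obtain ⟨z, hz⟩ := he.exists_eq_singleton h shape_nine (by norm_num) (by norm_num) hs
      (by decide) (by decide)
    have := he.four_le h shape_nine hz hs (by decide)
    omega
  · exfalso
    have hs := shape_ten.pairsIn_le (inside S σ 10) (fun i hi => by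
      rw [← Bool.not_eq_true, inside_iff]
      omega) (he.isFree_inside h)
    obtain ⟨z, hz⟩ := he.exists_eq_singleton h shape_ten (by norm_num) (by norm_num) hs
      (by decide) (by decide)
    have := he.four_le h shape_ten hz hs (by decide)
    omega

end

end CliqueMinor

namespace CliqueMinor

noncomputable section

open Classical

variable {V : Type} {G : SimpleGraph V} {X S : Finset V}

/-! ### The extremal function for `K₈` minors -/

theorem even_ee_self (Y : Finset V) : Even (ee G Y Y) := by
  induction Y using Finset.induction_on with
  | empty => exact ⟨0, rfl⟩
  | insert a Y ha ih =>
    rw [Finset.insert_eq, ee_self_union (Finset.disjoint_singleton_left.2 ha)]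
    have : ee G {a} {a} = 0 := by simp [ee, dg]
    rw [this, zero_add]
    exact (even_two_mul _).add ih

theorem ee_self_erase {v : V} (hv : v ∈ X) :
    ee G X X = ee G (X.erase v) (X.erase v) + 2 * dg G (X.erase v) v := by
  conv_lhs => rw [← Finset.insert_erase hv, Finset.insert_eq]
  rw [ee_self_union (Finset.disjoint_singleton_left.2 (Finset.notMem_erase v X))]
  have h1 : ee G {v} {v} = 0 := by simp [ee, dg]
  have h2 : ee G {v} (X.erase v) = dg G (X.erase v) v := by simp [ee]
  omega

theorem dg_le_of_forall {G' : SimpleGraph V} {Y Y' : Finset V} {v : V}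
    (h : ∀ w ∈ Y, G.Adj v w → w ∈ Y' ∧ G'.Adj v w) : dg G Y v ≤ dg G' Y' v :=
  Finset.card_le_card fun w hw => by
    rw [Finset.mem_filter] at hw
    exact Finset.mem_filter.2 (h w hw.1 hw.2)

/-- A graph with many edges has a spanning subgraph with exactly the given number of edges. -/
theorem exists_le_ee_eq {k : ℕ} (h : 2 * k ≤ ee G X X) :
    ∃ G' ≤ G, (∀ a b, G'.Adj a b → a ∈ X) ∧ ee G' X X = 2 * k := by
  have hex : ∃ m, ∃ G' ≤ G, (∀ a b, G'.Adj a b → a ∈ X) ∧ 2 * k ≤ ee G' X X ∧ ee G' X X = m :=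
    ⟨_, fill G ∅ X, fill_le (by simp), fun _ _ hab => hab.2.1, h.trans (ee_mono_graph
      fun a ha b hb hab => ⟨hab.ne, ha, hb, Or.inl hab⟩), rfl⟩
  obtain ⟨G', hle, hsupp, hk, hm⟩ := Nat.find_spec hex
  refine ⟨G', hle, hsupp, ?_⟩
  obtain ⟨r, hr⟩ := even_ee_self (G := G') X
  by_contra hne
  obtain ⟨a, ha, hpos⟩ : ∃ a ∈ X, 0 < dg G' X a := by
    by_contra! hcon
    have : ee G' X X = 0 := Finset.sum_eq_zero fun a ha => Nat.le_zero.1 (hcon a ha)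
    omega
  obtain ⟨b, hb⟩ := Finset.card_pos.1 hpos
  obtain ⟨hbX, hab⟩ := Finset.mem_filter.1 hb
  obtain ⟨G'', hG''⟩ : ∃ G'' : SimpleGraph V, ∀ x y, G''.Adj x y ↔ G'.Adj x y ∧ s(x, y) ≠ s(a, b) :=
    ⟨G'.deleteEdges {s(a, b)}, fun x y => SimpleGraph.deleteEdges_adj⟩
  have hle'' : G'' ≤ G' := fun x y hxy => ((hG'' x y).1 hxy).1
  have hb' := ee_self_erase (G := G') (v := a) ha
  have hb'' := ee_self_erase (G := G'') (v := a) ha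
  have h1 : ee G' (X.erase a) (X.erase a) ≤ ee G'' (X.erase a) (X.erase a) :=
    ee_mono_graph fun x hx y hy hxy => by
      rw [Finset.mem_erase] at hx hy
      rw [hG'']
      refine ⟨hxy, ?_⟩
      simp [hx.1, hy.1]
  have h2 : dg G' (X.erase a) a ≤ dg G'' (X.erase a) a + 1 := by
    have : (X.erase a).filter (G'.Adj a) ⊆ insert b ((X.erase a).filter (G''.Adj a)) := by
      intro w hw
      rw [Finset.mem_filter] at hw
      rw [Finset.mem_insert, Finset.mem_filter, hG'']
      by_cases hwb : w = b
      · exact Or.inl hwb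
      · exact Or.inr ⟨hw.1, hw.2, by simp [hwb, hw.2.ne']⟩
    exact (Finset.card_le_card this).trans (Finset.card_insert_le _ _)
  have h3 : ee G'' (X.erase a) (X.erase a) ≤ ee G' (X.erase a) (X.erase a) :=
    ee_mono_graph fun x _ y _ hxy => hle'' hxy
  have h4 : dg G'' (X.erase a) a < dg G' (X.erase a) a := by
    refine Finset.card_lt_card ⟨fun w hw => ?_, fun h => ?_⟩
    · rw [Finset.mem_filter] at hw ⊢
      exact ⟨hw.1, hle'' hw.2⟩
    · have := h (Finset.mem_filter.2 ⟨Finset.mem_erase.2 ⟨hab.ne', hbX⟩, hab⟩)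
      rw [Finset.mem_filter, hG''] at this
      exact this.2.2 rfl
  exact Nat.find_min hex (m := ee G'' X X) (by omega)
    ⟨G'', hle''.trans hle, fun x y hxy => hsupp x y (hle'' hxy), by omega, rfl⟩

/-- The graph on `X.erase v` obtained by contracting the edge `uv`. -/
def contract (G : SimpleGraph V) (X : Finset V) (u v : V) : SimpleGraph V where
  Adj a b := a ≠ b ∧ a ∈ X.erase v ∧ b ∈ X.erase v ∧
    (G.Adj a b ∨ a = u ∧ G.Adj v b ∨ b = u ∧ G.Adj v a)
  symm := ⟨fun _ _ ⟨h1, h2, h3, h4⟩ => ⟨h1.symm, h3, h2, h4.imp (fun h => h.symm) Or.symm⟩⟩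
  loopless := ⟨fun _ h => h.1 rfl⟩

theorem HasK8.of_contract {u v : V} (huv : G.Adj u v) (h : HasK8 (contract G X u v)) :
    HasK8 G := by
  have hside : ∀ b, (contract G X u v).Adj u b → Touch G {u, v} {b} := by
    rintro b ⟨hne, -, -, h' | h' | h'⟩
    · exact ⟨u, by simp, b, by simp, h'⟩
    · exact ⟨v, by simp, b, by simp, h'.2⟩
    · exact absurd h'.1.symm hne
  refine h.bind (· ∈ X.erase v) (fun w => if w = u then {u, v} else {w}) (fun w _ => ?_)
    (fun a b ha hb hab => ?_) fun a b hab => ⟨hab.2.1, ?_⟩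
  · split_ifs
    · exact conn_pair huv
    · exact conn_singleton w
  · rw [Finset.mem_erase] at ha hb
    split_ifs with h1 h2 h2
    · exact absurd (h1.trans h2.symm) hab
    · simp [h2, hb.1]
    · simp [h1, ha.1]
    · simpa using hab
  · split_ifs with h1 h2 h2
    · exact absurd (h1.trans h2.symm) hab.1
    · exact hside b (h1 ▸ hab)
    · exact (hside a (h2 ▸ hab.symm)).symm
    · obtain ⟨-, -, -, h' | h' | h'⟩ := hab
      · exact ⟨a, by simp, b, by simp, h'⟩
      · exact absurd h'.1 h1
      · exact absurd h'.1 h2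

theorem ee_le_contract {u v : V} (huv : G.Adj u v) (hu : u ∈ X) (hv : v ∈ X) :
    ee G X X ≤ ee (contract G X u v) (X.erase v) (X.erase v) + 2 * (common G X u v).card + 2 := by
  set G' := contract G X u v with hG'
  set Y := (X.erase v).erase u with hY
  have hYX : Y ⊆ X.erase v := Finset.erase_subset _ _
  have hu' : u ∈ X.erase v := Finset.mem_erase.2 ⟨huv.ne, hu⟩
  have h1 := ee_self_erase (G := G) hv
  have h2 : _ = ee G Y Y + 2 * dg G Y u := ee_self_erase (G := G) hu'
  have h3 : _ = ee G' Y Y + 2 * dg G' Y u := ee_self_erase (G := G') hu'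
  have h4 : ee G Y Y ≤ ee G' Y Y := ee_mono_graph fun a ha b hb hab =>
    ⟨hab.ne, hYX ha, hYX hb, Or.inl hab⟩
  have h5 : dg G (X.erase v) v ≤ dg G Y v + 1 := by
    have : (X.erase v).filter (G.Adj v) ⊆ insert u (Y.filter (G.Adj v)) := by
      intro w hw
      rw [Finset.mem_filter] at hw
      rw [Finset.mem_insert, Finset.mem_filter, hY, Finset.mem_erase]
      by_cases hwu : w = u
      · exact Or.inl hwu
      · exact Or.inr ⟨⟨hwu, hw.1⟩, hw.2⟩
    exact (Finset.card_le_card this).trans (Finset.card_insert_le _ _)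
  have h6 : dg G Y u + dg G Y v ≤ dg G' Y u + (common G X u v).card := by
    rw [dg, dg, ← Finset.card_union_add_card_inter]
    refine Nat.add_le_add (Finset.card_le_card fun w hw => ?_) (Finset.card_le_card fun w hw => ?_)
    · rw [Finset.mem_union, Finset.mem_filter, Finset.mem_filter] at hw
      have hwY : w ∈ Y := hw.elim And.left And.left
      refine Finset.mem_filter.2 ⟨hwY, (Finset.ne_of_mem_erase hwY).symm, hu', hYX hwY, ?_⟩
      exact hw.imp And.right fun h => Or.inl ⟨rfl, h.2⟩
    · rw [Finset.mem_inter, Finset.mem_filter, Finset.mem_filter] at hw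
      exact Finset.mem_filter.2 ⟨Finset.mem_of_mem_erase (hYX hw.1.1), hw.1.2, hw.2.2⟩
  omega

/-- The number of edges of a graph is bounded in terms of the two sides of a separation. -/
theorem ee_le_of_sep {T S' : Finset V} (hd : Disjoint T S') (hsub : T ∪ S' ⊆ X)
    (hcl : ∀ a ∈ T, ∀ b, G.Adj a b → b ∈ T ∪ S') :
    ee G X X + S'.card * (S'.card - 1) ≤ ee (fill G S' (T ∪ S')) (T ∪ S') (T ∪ S') +
      ee (fill G S' (X \ T)) (X \ T) (X \ T) := by
  set R := X \ (T ∪ S') with hR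
  have hRT : X \ T = R ∪ S' := by
    ext w
    have := @hsub w
    simp only [hR, Finset.mem_sdiff, Finset.mem_union] at this ⊢
    have : w ∈ T → w ∉ S' := fun hw => Finset.disjoint_left.1 hd hw
    tauto
  have hX : X = T ∪ (R ∪ S') := by
    rw [← hRT, Finset.union_sdiff_of_subset (Finset.subset_union_left.trans hsub)]
  have hdR : Disjoint T (R ∪ S') := by
    rw [← hRT]
    exact Finset.disjoint_sdiff
  have hRS : Disjoint R S' := Finset.disjoint_left.2 fun w hw hw' =>
    (Finset.mem_sdiff.1 hw).2 (Finset.mem_union_right _ hw')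
  have hTR : ee G T R = 0 := Finset.sum_eq_zero fun a ha => by
    rw [dg, Finset.card_eq_zero, Finset.filter_eq_empty_iff]
    exact fun b hb hab => (Finset.mem_sdiff.1 hb).2 (hcl a ha b hab)
  have key : ∀ T' : Finset V, Disjoint T' S' → ee G T' T' + 2 * ee G T' S' +
      S'.card * (S'.card - 1) ≤ ee (fill G S' (T' ∪ S')) (T' ∪ S') (T' ∪ S') := by
    intro T' hT'
    have hle : ∀ a ∈ T' ∪ S', ∀ b ∈ T' ∪ S', G.Adj a b → (fill G S' (T' ∪ S')).Adj a b :=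
      fun a ha b hb hab => ⟨hab.ne, ha, hb, Or.inl hab⟩
    rw [ee_self_union hT', ee_clique (G := fill G S' (T' ∪ S')) (S := S') fun a ha b hb hab =>
      ⟨hab, Finset.mem_union_right _ ha, Finset.mem_union_right _ hb, Or.inr ⟨ha, hb⟩⟩]
    have h1 : ee G T' T' ≤ ee (fill G S' (T' ∪ S')) T' T' := ee_mono_graph fun a ha b hb =>
      hle a (Finset.mem_union_left _ ha) b (Finset.mem_union_left _ hb)
    have h2 : ee G T' S' ≤ ee (fill G S' (T' ∪ S')) T' S' := ee_mono_graph fun a ha b hb =>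
      hle a (Finset.mem_union_left _ ha) b (Finset.mem_union_right _ hb)
    omega
  have h1 := key T hd
  have h2 := key R hRS
  have h3 := ee_self_union (G := G) hdR
  rw [← hX, ee_union_right hRS, hTR, ee_self_union hRS] at h3
  have h4 := ee_self_le (G := G) S'
  rw [hRT]
  omega

theorem hasK8_of_ee_le : ∀ (n : ℕ) {G : SimpleGraph V} {X : Finset V}, X.card = n → 5 ≤ n →
    12 * n ≤ ee G X X + 38 → HasK8 G := by
  intro n
  induction n using Nat.strong_induction_on with
  | _ n ih =>
  intro G₀ X hn h5 hee
  have hself := ee_self_le (G := G₀) X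
  rw [hn] at hself
  have h9 : 9 ≤ n := by
    by_contra! hlt
    interval_cases n <;> omega
  obtain ⟨G, hle, hsupp, hG⟩ := exists_le_ee_eq (G := G₀) (X := X) (k := 6 * n - 19) (by omega)
  refine HasK8.mono ?_ hle
  by_contra hno
  have hsupp' : ∀ a b, G.Adj a b → b ∈ X := fun a b hab => hsupp b a hab.symm
  have htri : ∀ a b, G.Adj a b → 6 ≤ (common G X a b).card := by
    intro a b hab
    have hb := hsupp' a b hab
    have h1 := ee_le_contract hab (hsupp a b hab) hb
    have h2 : ¬ 12 * (n - 1) ≤ ee (contract G X a b) (X.erase b) (X.erase b) + 38 := fun h' =>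
      hno ((ih (n - 1) (by omega) (by rw [Finset.card_erase_of_mem hb, hn]) (by omega)
        h').of_contract hab)
    omega
  have hpos : ∀ v ∈ X, ∃ w, G.Adj v w := by
    intro v hv
    by_contra! hcon
    have h1 : dg G (X.erase v) v = 0 := by simp [dg, hcon]
    have h2 := ee_self_erase (G := G) hv
    exact hno (ih (n - 1) (by omega) (X := X.erase v) (by rw [Finset.card_erase_of_mem hv, hn])
      (by omega) (by omega))
  have hsparse : ∀ Y ⊆ X, 5 ≤ Y.card → ee G Y Y + 38 ≤ 12 * Y.card := by
    intro Y hY hY5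
    rcases hY.eq_or_ssubset with rfl | hss
    · omega
    · have := Finset.card_lt_card hss
      by_contra hcon
      exact hno (ih Y.card (by omega) rfl hY5 (by omega))
  have hX : (X \ ∅).Nonempty := by
    rw [Finset.sdiff_empty, ← Finset.card_pos]
    omega
  have hdeg : ∀ v ∈ X, ∀ Y ⊆ X, (∀ w, G.Adj v w → w ∈ Y) → v ∈ Y → 8 ≤ Y.card := by
    intro v hv Y hYX hY hvY
    obtain ⟨w, hw⟩ := hpos v hv
    have h1 : common G X v w ⊆ (Y.erase v).erase w := fun x hx => by
      obtain ⟨-, hx1, hx2⟩ := Finset.mem_filter.1 hx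
      exact Finset.mem_erase.2 ⟨hx2.ne', Finset.mem_erase.2 ⟨hx1.ne', hY x hx1⟩⟩
    have h2 := (htri v w hw).trans (Finset.card_le_card h1)
    rw [Finset.card_erase_of_mem (Finset.mem_erase.2 ⟨hw.ne', hY w hw⟩),
      Finset.card_erase_of_mem hvY] at h2
    omega
  have hsep : NoSep G X := by
    intro T S' hT hd hsub hS' hR hcl
    have hTX : T ⊆ X := Finset.subset_union_left.trans hsub
    have hRX : X \ T ⊆ X := Finset.sdiff_subset
    obtain ⟨a, ha⟩ := hT
    obtain ⟨b, hb⟩ := hR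
    rw [Finset.mem_sdiff] at hb
    have h1 := hdeg a (hTX ha) (T ∪ S') hsub (hcl a ha) (Finset.mem_union_left _ ha)
    have h2 := hdeg b hb.1 (X \ T) hRX (fun w hw => Finset.mem_sdiff.2 ⟨hsupp' _ _ hw, fun hwT =>
      hb.2 (hcl w hwT b hw.symm)⟩) (Finset.mem_sdiff.2 ⟨hb.1, fun h' =>
      hb.2 (Finset.mem_union_left _ h')⟩)
    have h3 : (T ∪ S').card < n := hn ▸ Finset.card_lt_card ⟨hsub, fun h' => hb.2 (h' hb.1)⟩
    have h4 : (X \ T).card < n := hn ▸ Finset.card_lt_card ⟨hRX, fun h' =>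
      (Finset.mem_sdiff.1 (h' (hTX ha))).2 ha⟩
    by_contra! hcon
    have h5 : ¬ 12 * (T ∪ S').card ≤ ee (fill G S' (T ∪ S')) (T ∪ S') (T ∪ S') + 38 := fun h' =>
      hcon.1 (ih _ h3 rfl (by omega) h')
    have h6 : ¬ 12 * (X \ T).card ≤ ee (fill G S' (X \ T)) (X \ T) (X \ T) + 38 := fun h' =>
      hcon.2 (ih _ h4 rfl (by omega) h')
    obtain ⟨r, hr⟩ := even_ee_self (G := fill G S' (T ∪ S')) (T ∪ S')
    obtain ⟨r', hr'⟩ := even_ee_self (G := fill G S' (X \ T)) (X \ T)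
    have h7 := ee_le_of_sep hd hsub hcl
    have h8 := Finset.card_sdiff_add_card_eq_card hTX
    have h9 := Finset.card_union_of_disjoint hd
    have hs : ∀ s ≤ 5, 12 * s ≤ s * (s - 1) + 40 := by decide
    have := hs _ hS'
    omega
  have hset : Setup G X ∅ := ⟨hno, hsupp, hsparse, by simp, by simp, by simp, hX,
    fun a b hab _ => htri a b hab, fun v hv _ => hpos v hv, hsep, Or.inl rfl⟩
  have := hset.final.2
  omega

/-! ### Graphs of minimum degree nine -/

theorem hasK8_fill (ih : ∀ {G : SimpleGraph V} {Y S : Finset V}, Y.card < X.card →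
      (∀ a b, G.Adj a b → a ∈ Y) → (∀ a ∈ S, ∀ b ∈ S, a ≠ b → G.Adj a b) → S ⊆ Y → S.card ≤ 5 →
      (Y \ S).Nonempty → (∀ v ∈ Y, v ∉ S → 9 ≤ dg G Y v) →
      (∀ a b, G.Adj a b → ¬ (a ∈ S ∧ b ∈ S) → 6 ≤ (common G Y a b).card) → HasK8 G)
    (hdeg : ∀ v ∈ X, v ∉ S → 9 ≤ dg G X v)
    (htri : ∀ a b, G.Adj a b → ¬ (a ∈ S ∧ b ∈ S) → 6 ≤ (common G X a b).card)
    {T S' : Finset V} (hT : T.Nonempty) (hd : Disjoint T S') (hsub : T ∪ S' ⊂ X)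
    (hS' : S'.card ≤ 5) (hcl : ∀ a ∈ T, ∀ b, G.Adj a b → b ∈ T ∪ S') (hTS : ∀ a ∈ T, a ∉ S) :
    HasK8 (fill G S' (T ∪ S')) := by
  have hdiff : (T ∪ S') \ S' = T := by
    rw [Finset.union_sdiff_right, Finset.sdiff_eq_self_of_disjoint hd]
  have hmem : ∀ v ∈ T ∪ S', v ∉ S' → v ∈ T := fun v hv hv' =>
    (Finset.mem_union.1 hv).resolve_right hv'
  have hadj : ∀ a ∈ T, ∀ b, G.Adj a b → (fill G S' (T ∪ S')).Adj a b := fun a ha b hab =>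
    ⟨hab.ne, Finset.mem_union_left _ ha, hcl a ha b hab, Or.inl hab⟩
  have htri' : ∀ a b, a ∈ T → (fill G S' (T ∪ S')).Adj a b →
      6 ≤ (common (fill G S' (T ∪ S')) (T ∪ S') a b).card := by
    rintro a b haT ⟨-, ha, hb, h'⟩
    have hab : G.Adj a b := h'.resolve_right fun h' => Finset.disjoint_left.1 hd haT h'.1
    refine (htri a b hab fun h => hTS a haT h.1).trans (Finset.card_le_card fun w hw => ?_)
    obtain ⟨-, h1, h2⟩ := Finset.mem_filter.1 hw
    have hw' := hcl a haT w h1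
    exact Finset.mem_filter.2 ⟨hw', hadj a haT w h1, h2.ne, hb, hw', Or.inl h2⟩
  refine ih (Finset.card_lt_card hsub) (fun a b hab => hab.2.1) (fun a ha b hb hab =>
    ⟨hab, Finset.mem_union_right _ ha, Finset.mem_union_right _ hb, Or.inr ⟨ha, hb⟩⟩)
    Finset.subset_union_right hS' (by rwa [hdiff]) (fun v hv hv' => ?_) fun a b hab hS => ?_
  · have hvT := hmem v hv hv'
    exact (hdeg v (hsub.1 hv) (hTS v hvT)).trans (dg_le_of_forall fun w _ hw =>
      ⟨hcl v hvT w hw, hadj v hvT w hw⟩)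
  · by_cases ha : a ∈ S'
    · have hb : b ∉ S' := fun hb => hS ⟨ha, hb⟩
      have hcomm : common (fill G S' (T ∪ S')) (T ∪ S') a b =
          common (fill G S' (T ∪ S')) (T ∪ S') b a := Finset.filter_congr fun _ _ => and_comm
      rw [hcomm]
      exact htri' b a (hmem b hab.2.2.1 hb) hab.symm
    · exact htri' a b (hmem a hab.2.1 ha) hab

/-- A graph of minimum degree at least nine outside a clique `S`, all of whose edges outside `S` lie
in at least six triangles, has a `K₈` minor. -/
theorem hasK8_of_triangles : ∀ (n : ℕ) {G : SimpleGraph V} {X S : Finset V}, X.card = n →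
    (∀ a b, G.Adj a b → a ∈ X) → (∀ a ∈ S, ∀ b ∈ S, a ≠ b → G.Adj a b) → S ⊆ X → S.card ≤ 5 →
    (X \ S).Nonempty → (∀ v ∈ X, v ∉ S → 9 ≤ dg G X v) →
    (∀ a b, G.Adj a b → ¬ (a ∈ S ∧ b ∈ S) → 6 ≤ (common G X a b).card) → HasK8 G := by
  intro n
  induction n using Nat.strong_induction_on with
  | _ n ih =>
  intro G X S hn hsupp hclique hSX hS hne hdeg htri
  by_contra hno
  have hsep : NoSep G X := by
    intro T S' hT hd hsub hS' hR hcl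
    have hfill := fun {T : Finset V} => hasK8_fill (X := X) (T := T) (S' := S')
      (fun hlt => ih _ (hn ▸ hlt) rfl) hdeg htri
    have hssub : T ∪ S' ⊂ X := ⟨hsub, fun h' => by
      obtain ⟨b, hb⟩ := hR
      rw [Finset.mem_sdiff] at hb
      exact hb.2 (h' hb.1)⟩
    by_cases hTS : ∀ a ∈ T, a ∉ S
    · exact Or.inl (hfill hT hd hssub hS' hcl hTS)
    · push Not at hTS
      obtain ⟨a, ha, haS⟩ := hTS
      have hXT : X \ T = X \ (T ∪ S') ∪ S' := by
        ext w
        have := @hsub w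
        simp only [Finset.mem_sdiff, Finset.mem_union] at this ⊢
        have : w ∈ T → w ∉ S' := fun hw => Finset.disjoint_left.1 hd hw
        tauto
      refine Or.inr (hXT ▸ hfill hR ?_ ?_ hS' ?_ ?_)
      · exact Finset.disjoint_left.2 fun w hw hw' =>
          (Finset.mem_sdiff.1 hw).2 (Finset.mem_union_right _ hw')
      · rw [← hXT]
        exact ⟨Finset.sdiff_subset, fun h' => (Finset.mem_sdiff.1 (h' (hsub
          (Finset.mem_union_left _ ha)))).2 ha⟩
      · intro b hb c hbc
        rw [← hXT, Finset.mem_sdiff]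
        exact ⟨hsupp c b hbc.symm, fun hc => (Finset.mem_sdiff.1 hb).2 (hcl c hc b hbc.symm)⟩
      · intro b hb hbS
        have hb' := (Finset.mem_sdiff.1 hb).2
        refine hb' (hcl a ha b (hclique a haS b hbS ?_))
        rintro rfl
        exact hb' (Finset.mem_union_left _ ha)
  have hsparse : ∀ Y ⊆ X, 5 ≤ Y.card → ee G Y Y + 38 ≤ 12 * Y.card := by
    intro Y _ hY
    by_contra hcon
    exact hno (hasK8_of_ee_le _ rfl hY (by omega))
  have hpos : ∀ v ∈ X, v ∉ S → ∃ w, G.Adj v w := by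
    intro v hv hvS
    obtain ⟨w, hw⟩ := Finset.card_pos.1 ((Nat.succ_pos 8).trans_le (hdeg v hv hvS))
    exact ⟨w, (Finset.mem_filter.1 hw).2⟩
  obtain ⟨⟨v, hv, hvS, h8⟩, -⟩ := (Setup.mk hno hsupp hsparse hclique hSX hS hne htri hpos hsep
    (Or.inr hdeg)).final
  have := hdeg v hv hvS
  omega

end

end CliqueMinor

open CliqueMinor

/-- Every finite simple graph with no `K_8`-minor and minimum degree at least 9
has an edge that belongs to at most 5 triangles. -/
theorem statement2 {V : Type} [Fintype V] (G : SimpleGraph V) [DecidableRel G.Adj]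
    (hfree : ¬ (⊤ : SimpleGraph (Fin 8)).MinorOf G)
    (hmin : 9 ≤ G.minDegree) :
    ∃ u v : V, G.Adj u v ∧ (G.neighborSet u ∩ G.neighborSet v).ncard ≤ 5 := by
  classical
  by_contra! hcon
  have hdeg : ∀ v, 9 ≤ dg G Finset.univ v := fun v => by
    refine (hmin.trans (G.minDegree_le_degree v)).trans_eq ?_
    rw [← SimpleGraph.card_neighborFinset_eq_degree, SimpleGraph.neighborFinset_eq_filter, dg]
    congr
  have hne : Nonempty V := by
    by_contra hV
    rw [not_nonempty_iff] at hV
    simp at hmin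
  refine hfree (HasK8.minorOf (hasK8_of_triangles _ (X := Finset.univ) (S := ∅) rfl (by simp)
    (by simp) (by simp) (by simp) (by simp) (fun v _ _ => hdeg v) fun a b hab _ => ?_))
  have := hcon a b hab
  have h' : G.neighborSet a ∩ G.neighborSet b = (common G Finset.univ a b : Set V) := by
    ext w
    simp [common]
  rw [h', Set.ncard_coe_finset] at this
  exact this
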